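/- (Theorem 2.5 of the paper, stated via characteristic functions.) Fix α ∈ (0,1)∪(1,2), β ∈ [−1,1], and set γ = 1/α. Let ν_β be the probability measure on {−1,1} with ν_β({±1}) = (1±β)/2, and consider the product probability measure μ_Y ⊗ ν_β^{⊗ℕ} on Y × {−1,1}^ℕ. Then for every t ∈ ℝ, ∫_{Y×{−1,1}^ℕ} exp( i·t·n^{−γ}·d_α^{−γ}·(Σ_{j=0}^{n−1} ω_j·τ(F^j(y)) − n·β·ℓ_α) ) d(μ_Y ⊗ ν_β^{⊗ℕ})(y,ω) → exp( −|t|^α·(1 − i·β·sgn(t)·tan(απ/2)) ) as n → ∞; that is, the randomly signed, normalized Birkhoff sums of the return time converge in distribution to the α-stable law X_{α,1,β}. -/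

import Mathlib

open Real Set MeasureTheory Filter Topology

noncomputable section

/-- The common branch formula of the Thaler map:
`g(x) = (x^(1-γ) + (1+x)^(1-γ) − 1)^(1/(1-γ))` (real powers). -/
def thalerG (γ x : ℝ) : ℝ := (x ^ (1 - γ) + (1 + x) ^ (1 - γ) - 1) ^ (1 / (1 - γ))

/-- The Thaler map with branch point `xs`: `T 0 = 0`, `T x = g x` on `(0, xs]` and
`T x = g x − 1` on `(xs, 1]`. -/
def thalerT (γ xs : ℝ) (x : ℝ) : ℝ :=
  if x ≤ 0 then 0 else if x ≤ xs then thalerG γ x else thalerG γ x - 1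

/-- The invariant density `h(x) = x^(-γ) + (x+1)^(-γ)`. -/
def thalerH (γ x : ℝ) : ℝ := x ^ (-γ) + (x + 1) ^ (-γ)

/-- The measure `μ` on `[0,1]` with density `h` with respect to Lebesgue measure. -/
def thalerMu (γ : ℝ) : Measure ℝ :=
  (volume.restrict (Set.Icc (0 : ℝ) 1)).withDensity fun x => ENNReal.ofReal (thalerH γ x)

/-- The normalized restriction `μ_Y = μ|_Y / μ(Y)` of `μ` to `Y = (xs,1]`. -/
def thalerMuY (γ xs : ℝ) : Measure ℝ :=
  (thalerMu γ (Set.Ioc xs 1))⁻¹ • (thalerMu γ).restrict (Set.Ioc xs 1)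

/-- The first return time `τ(y) = inf{n ≥ 1 : T^n y ∈ Y}` to `Y = (xs, 1]`. -/
def thalerTau (γ xs : ℝ) (y : ℝ) : ℕ :=
  sInf {n : ℕ | 1 ≤ n ∧ (thalerT γ xs)^[n] y ∈ Set.Ioc xs 1}

/-- The first return map `F(y) = T^(τ(y))(y)`. -/
def thalerF (γ xs : ℝ) (y : ℝ) : ℝ := (thalerT γ xs)^[thalerTau γ xs y] y

/-- `g_α = Γ(1−α)·cos(απ/2)`. -/
def stableGa (α : ℝ) : ℝ := Real.Gamma (1 - α) * Real.cos (α * π / 2)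

/-- `d_α = α^α·((1−γ)/(2^(1−γ)−1))·g_α` with `γ = 1/α`. -/
def stableDa (α : ℝ) : ℝ := α ^ α * ((1 - α⁻¹) / (2 ^ (1 - α⁻¹) - 1)) * stableGa α

/-- `ℓ_α = 0` for `α ∈ (0,1)` and `ℓ_α = (1 − 2^(γ−1))⁻¹` for `α ∈ (1,2)`, `γ = 1/α`. -/
def stableLa (α : ℝ) : ℝ := if α < 1 then 0 else (1 - 2 ^ (α⁻¹ - 1))⁻¹

lemma thalerG_base_pos {γ x : ℝ} (hx : x ∈ Ioc (0 : ℝ) 1) :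
    0 < x ^ (1 - γ) + (1 + x) ^ (1 - γ) - 1 := by
  have hx0 : 0 < x := hx.1
  have h1 : 0 < x ^ (1 - γ) := rpow_pos_of_pos hx0 _
  have h2 : 0 < (1 + x) ^ (1 - γ) := rpow_pos_of_pos (by linarith) _
  rcases le_total γ 1 with h | h
  · have := one_le_rpow (x := 1 + x) (by linarith) (sub_nonneg.2 h)
    linarith
  · have := one_le_rpow_of_pos_of_le_one_of_nonpos hx0 hx.2 (sub_nonpos.2 h)
    linarith

lemma thalerG_pos {γ x : ℝ} (hx : x ∈ Ioc (0 : ℝ) 1) : 0 < thalerG γ x :=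
  rpow_pos_of_pos (thalerG_base_pos hx) _

lemma thalerG_rpow {γ x : ℝ} (hγ1 : γ ≠ 1) (hx : x ∈ Ioc (0 : ℝ) 1) :
    thalerG γ x ^ (1 - γ) = x ^ (1 - γ) + (1 + x) ^ (1 - γ) - 1 := by
  have : 1 - γ ≠ 0 := sub_ne_zero.2 hγ1.symm
  rw [thalerG, ← rpow_mul (thalerG_base_pos hx).le, one_div_mul_cancel this, rpow_one]

lemma thalerH_pos {γ x : ℝ} (hx : 0 < x) : 0 < thalerH γ x :=
  add_pos (rpow_pos_of_pos hx _) (rpow_pos_of_pos (by linarith) _)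

lemma hasDerivAt_thalerG {γ x : ℝ} (hγ1 : γ ≠ 1) (hx : x ∈ Ioc (0 : ℝ) 1) :
    HasDerivAt (thalerG γ) (thalerH γ x * thalerG γ x ^ γ) x := by
  have hne : 1 - γ ≠ 0 := sub_ne_zero.2 hγ1.symm
  have hb := thalerG_base_pos (γ := γ) hx
  have h1 : HasDerivAt (fun y : ℝ => y ^ (1 - γ)) ((1 - γ) * x ^ (1 - γ - 1)) x :=
    hasDerivAt_rpow_const (Or.inl hx.1.ne')
  have h2 : HasDerivAt (fun y : ℝ => (1 + y) ^ (1 - γ)) (1 * (1 - γ) * (1 + x) ^ (1 - γ - 1)) x :=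
    ((hasDerivAt_id x).const_add 1).rpow_const (Or.inl (by have := hx.1; simp; linarith))
  have h3 := ((h1.add h2).sub_const 1).rpow_const (p := 1 / (1 - γ)) (Or.inl hb.ne')
  refine HasDerivAt.congr_deriv (f := thalerG γ) h3 (Eq.symm ?_)
  have e1 : 1 - γ - 1 = -γ := by ring
  have e2 : 1 / (1 - γ) - 1 = 1 / (1 - γ) * γ := by field_simp; ring
  simp only [Pi.add_apply]
  rw [thalerH, thalerG, ← rpow_mul hb.le, e1, e2, add_comm x 1]
  field_simp

lemma strictMonoOn_thalerG {γ : ℝ} (hγ1 : γ ≠ 1) : StrictMonoOn (thalerG γ) (Ioc 0 1) := by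
  refine strictMonoOn_of_deriv_pos (convex_Ioc 0 1)
    (fun x hx => (hasDerivAt_thalerG hγ1 hx).continuousAt.continuousWithinAt) fun x hx => ?_
  rw [interior_Ioc] at hx
  have hx' : x ∈ Ioc (0 : ℝ) 1 := ⟨hx.1, hx.2.le⟩
  rw [(hasDerivAt_thalerG hγ1 hx').deriv]
  exact mul_pos (thalerH_pos hx.1) (rpow_pos_of_pos (thalerG_pos hx') _)

lemma thalerG_one {γ : ℝ} (hγ1 : γ ≠ 1) : thalerG γ 1 = 2 := by
  have hne : 1 - γ ≠ 0 := sub_ne_zero.2 hγ1.symm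
  rw [thalerG, one_rpow, add_sub_cancel_left, ← rpow_mul (by norm_num), mul_one_div_cancel hne,
    rpow_one]
  norm_num

lemma lt_thalerG {γ x : ℝ} (hγ1 : γ ≠ 1) (hx : x ∈ Ioc (0 : ℝ) 1) : x < thalerG γ x := by
  have hg := thalerG_pos (γ := γ) hx
  have he := thalerG_rpow hγ1 hx
  have h1x : 1 < 1 + x := by linarith [hx.1]
  by_contra! hle
  rcases lt_or_gt_of_ne hγ1 with h | h
  · have := rpow_le_rpow hg.le hle (sub_nonneg.2 h.le)
    have := one_lt_rpow h1x (sub_pos.2 h)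
    linarith
  · have := rpow_le_rpow_of_nonpos hg hle (sub_nonpos.2 h.le)
    have := rpow_lt_one_of_one_lt_of_neg h1x (sub_neg.2 h)
    linarith

/-- The relative increment `w` with `g(x) = x (1 + w)^(1/(1-γ))`. -/
def thalerW (γ x : ℝ) : ℝ := x ^ (γ - 1) * ((1 + x) ^ (1 - γ) - 1)

lemma thalerG_eq_mul {γ x : ℝ} (hγ1 : γ ≠ 1) (hx : x ∈ Ioc (0 : ℝ) 1) :
    0 < 1 + thalerW γ x ∧ thalerG γ x = x * (1 + thalerW γ x) ^ (1 / (1 - γ)) := by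
  have hne : 1 - γ ≠ 0 := sub_ne_zero.2 hγ1.symm
  have hx0 : 0 < x := hx.1
  have hb := thalerG_base_pos (γ := γ) hx
  have hxp : 0 < x ^ (1 - γ) := rpow_pos_of_pos hx0 _
  have hinv : x ^ (γ - 1) * x ^ (1 - γ) = 1 := by
    rw [← rpow_add hx0]; simp
  have hfac : x ^ (1 - γ) + (1 + x) ^ (1 - γ) - 1 = x ^ (1 - γ) * (1 + thalerW γ x) := by
    rw [thalerW]; linear_combination (-(1 + x) ^ (1 - γ) + 1) * hinv
  have hw : 0 < 1 + thalerW γ x := by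
    rw [hfac] at hb; exact pos_of_mul_pos_right hb hxp.le
  refine ⟨hw, ?_⟩
  rw [thalerG, hfac, mul_rpow hxp.le hw.le, ← rpow_mul hx0.le, mul_one_div_cancel hne, rpow_one]

lemma thalerW_ne_zero {γ x : ℝ} (hγ1 : γ ≠ 1) (hx : 0 < x) : thalerW γ x ≠ 0 := by
  have h1x : 1 < 1 + x := by linarith
  refine mul_ne_zero (rpow_pos_of_pos hx _).ne' ?_
  rcases lt_or_gt_of_ne hγ1 with h | h
  · have := one_lt_rpow h1x (sub_pos.2 h)
    linarith
  · have := rpow_lt_one_of_one_lt_of_neg h1x (sub_neg.2 h)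
    linarith

lemma tendsto_one_add_rpow_sub_one_div (p : ℝ) :
    Tendsto (fun x : ℝ => ((1 + x) ^ p - 1) / x) (𝓝[≠] 0) (𝓝 p) := by
  have h : HasDerivAt (fun y : ℝ => (1 + y) ^ p) (1 * p * (1 + 0) ^ (p - 1)) 0 :=
    ((hasDerivAt_id (0 : ℝ)).const_add 1).rpow_const (Or.inl (by simp))
  have := h.tendsto_slope_zero
  simp only [zero_add, add_zero, one_rpow, smul_eq_mul, one_mul, mul_one] at this
  refine this.congr fun x => ?_
  rw [inv_mul_eq_div]

lemma tendsto_thalerW_div (γ : ℝ) :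
    Tendsto (fun x : ℝ => thalerW γ x / x ^ γ) (𝓝[>] 0) (𝓝 (1 - γ)) := by
  refine ((tendsto_one_add_rpow_sub_one_div (1 - γ)).mono_left
    (nhdsWithin_mono _ fun x hx => ne_of_gt hx)).congr' ?_
  filter_upwards [self_mem_nhdsWithin] with x (hx : 0 < x)
  rw [thalerW, rpow_sub hx, rpow_one]
  have := (rpow_pos_of_pos hx γ).ne'
  field_simp

lemma tendsto_rpow_nhdsGT_zero {γ : ℝ} (hγ : 0 < γ) :
    Tendsto (fun x : ℝ => x ^ γ) (𝓝[>] 0) (𝓝 0) := by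
  have := (continuousAt_rpow_const 0 γ (Or.inr hγ.le)).tendsto
  rw [zero_rpow hγ.ne'] at this
  exact this.mono_left nhdsWithin_le_nhds

lemma tendsto_thalerW {γ : ℝ} (hγ : 0 < γ) (hγ1 : γ ≠ 1) :
    Tendsto (thalerW γ) (𝓝[>] 0) (𝓝[≠] 0) := by
  refine tendsto_nhdsWithin_iff.2 ⟨?_, ?_⟩
  · have := (tendsto_thalerW_div γ).mul (tendsto_rpow_nhdsGT_zero hγ)
    rw [mul_zero] at this
    refine this.congr' ?_
    filter_upwards [self_mem_nhdsWithin] with x (hx : 0 < x)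
    exact div_mul_cancel₀ _ (rpow_pos_of_pos hx γ).ne'
  · filter_upwards [self_mem_nhdsWithin] with x hx
    exact thalerW_ne_zero hγ1 hx

lemma tendsto_thalerW_rpow {γ : ℝ} (hγ : 0 < γ) (hγ1 : γ ≠ 1) (q : ℝ) :
    Tendsto (fun x => ((1 + thalerW γ x) ^ q - 1) / x ^ γ) (𝓝[>] 0) (𝓝 (q * (1 - γ))) := by
  refine (((tendsto_one_add_rpow_sub_one_div q).comp (tendsto_thalerW hγ hγ1)).mul
    (tendsto_thalerW_div γ)).congr' ?_
  filter_upwards [self_mem_nhdsWithin] with x hx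
  have := thalerW_ne_zero hγ1 hx
  simp only [Function.comp_apply]
  field_simp

lemma Ioc_mem_nhdsGT_zero : Ioc (0 : ℝ) 1 ∈ 𝓝[>] (0 : ℝ) := Ioc_mem_nhdsGT one_pos

lemma tendsto_thalerG_sub_div {γ : ℝ} (hγ : 0 < γ) (hγ1 : γ ≠ 1) :
    Tendsto (fun x => (thalerG γ x - x) / x ^ (1 + γ)) (𝓝[>] 0) (𝓝 1) := by
  have hne : 1 - γ ≠ 0 := sub_ne_zero.2 hγ1.symm
  have := tendsto_thalerW_rpow hγ hγ1 (1 / (1 - γ))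
  rw [one_div_mul_cancel hne] at this
  refine this.congr' ?_
  filter_upwards [Ioc_mem_nhdsGT_zero] with x hx
  have hx0 : 0 < x := hx.1
  rw [(thalerG_eq_mul hγ1 hx).2, rpow_add hx0, rpow_one]
  have := (rpow_pos_of_pos hx0 γ).ne'
  field_simp

lemma tendsto_rpow_sub_thalerG_rpow {γ : ℝ} (hγ : 0 < γ) (hγ1 : γ ≠ 1) :
    Tendsto (fun x => x ^ (-γ) - thalerG γ x ^ (-γ)) (𝓝[>] 0) (𝓝 γ) := by
  have hne : 1 - γ ≠ 0 := sub_ne_zero.2 hγ1.symm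
  have := (tendsto_thalerW_rpow hγ hγ1 (1 / (1 - γ) * (-γ))).neg
  rw [show -(1 / (1 - γ) * (-γ) * (1 - γ)) = γ by field_simp] at this
  refine this.congr' ?_
  filter_upwards [Ioc_mem_nhdsGT_zero] with x hx
  have hx0 : 0 < x := hx.1
  obtain ⟨hw, hg⟩ := thalerG_eq_mul hγ1 hx
  rw [hg, mul_rpow hx0.le (rpow_nonneg hw.le _), ← rpow_mul hw.le, rpow_neg hx0.le]
  have := (rpow_pos_of_pos hx0 γ).ne'
  field_simp
  ring

lemma tendsto_thalerG_zero {γ : ℝ} (hγ : 0 < γ) (hγ1 : γ ≠ 1) :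
    Tendsto (thalerG γ) (𝓝[>] 0) (𝓝 0) := by
  have h1 := (tendsto_thalerG_sub_div hγ hγ1).mul
    (tendsto_rpow_nhdsGT_zero (show 0 < 1 + γ by linarith))
  have h2 := h1.add (tendsto_id.mono_left nhdsWithin_le_nhds : Tendsto id (𝓝[>] (0 : ℝ)) (𝓝 0))
  simp only [mul_zero, add_zero] at h2
  refine h2.congr' ?_
  filter_upwards [self_mem_nhdsWithin] with x (hx : 0 < x)
  rw [div_mul_cancel₀ _ (rpow_pos_of_pos hx _).ne']
  simp

lemma image_thalerG {γ : ℝ} (hγ : 0 < γ) (hγ1 : γ ≠ 1) : thalerG γ '' Ioc 0 1 = Ioc 0 2 := by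
  apply Subset.antisymm
  · rintro _ ⟨x, hx, rfl⟩
    refine ⟨thalerG_pos hx, ?_⟩
    rw [← thalerG_one hγ1]
    exact (strictMonoOn_thalerG hγ1).monotoneOn hx (by simp) hx.2
  · intro y hy
    obtain ⟨x, hxy, hx⟩ := (((tendsto_thalerG_zero hγ hγ1).eventually_lt_const hy.1).and
      Ioc_mem_nhdsGT_zero).exists
    have hc : ContinuousOn (thalerG γ) (Icc x 1) := fun z hz =>
      (hasDerivAt_thalerG hγ1 ⟨hx.1.trans_le hz.1, hz.2⟩).continuousAt.continuousWithinAt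
    obtain ⟨z, hz, rfl⟩ := intermediate_value_Icc hx.2 hc
      ⟨hxy.le, by rw [thalerG_one hγ1]; exact hy.2⟩
    exact ⟨z, ⟨hx.1.trans_le hz.1, hz.2⟩, rfl⟩

/-- The inverse of `g`, extended to a monotone function on the line. -/
def thalerInv (γ y : ℝ) : ℝ := sSup {x | x ∈ Icc (0 : ℝ) 1 ∧ (x = 0 ∨ thalerG γ x ≤ y)}

lemma monotone_thalerInv (γ : ℝ) : Monotone (thalerInv γ) := fun y z hyz =>
  csSup_le_csSup ⟨1, fun _ hx => hx.1.2⟩ ⟨0, by simp⟩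
    fun _ hx => ⟨hx.1, hx.2.imp_right fun h => h.trans hyz⟩

lemma thalerInv_thalerG {γ x : ℝ} (hγ1 : γ ≠ 1) (hx : x ∈ Ioc (0 : ℝ) 1) :
    thalerInv γ (thalerG γ x) = x := by
  refine IsLUB.csSup_eq (IsGreatest.isLUB ⟨⟨⟨hx.1.le, hx.2⟩, Or.inr le_rfl⟩, ?_⟩) ⟨0, by simp⟩
  rintro z ⟨hz, hz0⟩
  rcases hz.1.eq_or_lt with h | h
  · rw [← h]; exact hx.1.le
  · rcases hz0 with h0 | h0
    · exact absurd h0 h.ne'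
    · exact ((strictMonoOn_thalerG hγ1).le_iff_le ⟨h, hz.2⟩ hx).1 h0

lemma thalerInv_mem {γ y : ℝ} (hγ : 0 < γ) (hγ1 : γ ≠ 1) (hy : y ∈ Ioc (0 : ℝ) 2) :
    thalerInv γ y ∈ Ioc (0 : ℝ) 1 := by
  rw [← image_thalerG hγ hγ1] at hy
  obtain ⟨x, hx, rfl⟩ := hy
  rwa [thalerInv_thalerG hγ1 hx]

lemma thalerG_thalerInv {γ y : ℝ} (hγ : 0 < γ) (hγ1 : γ ≠ 1) (hy : y ∈ Ioc (0 : ℝ) 2) :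
    thalerG γ (thalerInv γ y) = y := by
  rw [← image_thalerG hγ hγ1] at hy
  obtain ⟨x, hx, rfl⟩ := hy
  rw [thalerInv_thalerG hγ1 hx]

lemma thalerInv_lt {γ y : ℝ} (hγ : 0 < γ) (hγ1 : γ ≠ 1) (hy : y ∈ Ioc (0 : ℝ) 2) :
    thalerInv γ y < y := by
  have := lt_thalerG hγ1 (thalerInv_mem hγ hγ1 hy)
  rwa [thalerG_thalerInv hγ hγ1 hy] at this

lemma strictMonoOn_thalerInv {γ : ℝ} (hγ : 0 < γ) (hγ1 : γ ≠ 1) :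
    StrictMonoOn (thalerInv γ) (Ioc 0 2) := by
  intro y hy z hz hyz
  refine lt_of_not_ge fun h => ?_
  have := (strictMonoOn_thalerG hγ1).monotoneOn (thalerInv_mem hγ hγ1 hz)
    (thalerInv_mem hγ hγ1 hy) h
  rw [thalerG_thalerInv hγ hγ1 hz, thalerG_thalerInv hγ hγ1 hy] at this
  linarith

lemma thalerInv_two {γ : ℝ} (hγ1 : γ ≠ 1) : thalerInv γ 2 = 1 := by
  rw [← thalerG_one hγ1, thalerInv_thalerG hγ1 (by simp)]

lemma thalerG_branch_point {γ xs : ℝ} (h : xs ^ (1 - γ) + (1 + xs) ^ (1 - γ) = 2) :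
    thalerG γ xs = 1 := by
  rw [thalerG, h]; norm_num

lemma thalerInv_one {γ xs : ℝ} (hγ1 : γ ≠ 1) (hxs : xs ∈ Ioo (0 : ℝ) 1)
    (h : xs ^ (1 - γ) + (1 + xs) ^ (1 - γ) = 2) : thalerInv γ 1 = xs := by
  rw [← thalerG_branch_point h, thalerInv_thalerG hγ1 ⟨hxs.1, hxs.2.le⟩]

/-- The backward orbit of `1` under the first branch. -/
def thalerX (γ : ℝ) (k : ℕ) : ℝ := (thalerInv γ)^[k] 1

lemma thalerX_zero (γ : ℝ) : thalerX γ 0 = 1 := rfl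

lemma thalerX_succ (γ : ℝ) (k : ℕ) : thalerX γ (k + 1) = thalerInv γ (thalerX γ k) :=
  Function.iterate_succ_apply' _ _ _

lemma thalerInv_mem_of_mem {γ y : ℝ} (hγ : 0 < γ) (hγ1 : γ ≠ 1) (hy : y ∈ Ioc (0 : ℝ) 1) :
    thalerInv γ y ∈ Ioc (0 : ℝ) 1 :=
  thalerInv_mem hγ hγ1 ⟨hy.1, hy.2.trans one_le_two⟩

lemma iterate_thalerInv_mem {γ y : ℝ} (hγ : 0 < γ) (hγ1 : γ ≠ 1) (hy : y ∈ Ioc (0 : ℝ) 1)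
    (k : ℕ) : (thalerInv γ)^[k] y ∈ Ioc (0 : ℝ) 1 := by
  induction k with
  | zero => exact hy
  | succ k ih =>
    rw [Function.iterate_succ_apply']
    exact thalerInv_mem_of_mem hγ hγ1 ih

lemma thalerX_mem {γ : ℝ} (hγ : 0 < γ) (hγ1 : γ ≠ 1) (k : ℕ) : thalerX γ k ∈ Ioc (0 : ℝ) 1 :=
  iterate_thalerInv_mem hγ hγ1 (by simp) k

lemma thalerG_thalerX_succ {γ : ℝ} (hγ : 0 < γ) (hγ1 : γ ≠ 1) (k : ℕ) :
    thalerG γ (thalerX γ (k + 1)) = thalerX γ k := by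
  have h := thalerX_mem hγ hγ1 k
  rw [thalerX_succ, thalerG_thalerInv hγ hγ1 ⟨h.1, h.2.trans one_le_two⟩]

lemma strictAnti_thalerX {γ : ℝ} (hγ : 0 < γ) (hγ1 : γ ≠ 1) : StrictAnti (thalerX γ) := by
  refine strictAnti_nat_of_succ_lt fun k => ?_
  have := lt_thalerG hγ1 (thalerX_mem hγ hγ1 (k + 1))
  rwa [thalerG_thalerX_succ hγ hγ1] at this

lemma tendsto_thalerX {γ : ℝ} (hγ : 0 < γ) (hγ1 : γ ≠ 1) :
    Tendsto (thalerX γ) atTop (𝓝 0) := by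
  have hbdd : BddBelow (range (thalerX γ)) :=
    ⟨0, by rintro _ ⟨k, rfl⟩; exact (thalerX_mem hγ hγ1 k).1.le⟩
  have hL := tendsto_atTop_ciInf (strictAnti_thalerX hγ hγ1).antitone hbdd
  set L := ⨅ k, thalerX γ k
  have hL0 : 0 ≤ L := le_ciInf fun k => (thalerX_mem hγ hγ1 k).1.le
  have hL1 : L ≤ 1 := ciInf_le hbdd 0
  rcases hL0.eq_or_lt with h | h
  · rwa [h]
  · exfalso
    have hmem : L ∈ Ioc (0 : ℝ) 1 := ⟨h, hL1⟩
    have h1 := (hasDerivAt_thalerG hγ1 hmem).continuousAt.tendsto.comp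
      (hL.comp (tendsto_add_atTop_nat 1))
    have h2 : Tendsto (thalerG γ ∘ thalerX γ ∘ fun k => k + 1) atTop (𝓝 L) :=
      hL.congr fun k => (thalerG_thalerX_succ hγ hγ1 k).symm
    exact (lt_thalerG hγ1 hmem).ne (tendsto_nhds_unique h2 h1)

lemma tendsto_thalerX_nhdsGT {γ : ℝ} (hγ : 0 < γ) (hγ1 : γ ≠ 1) :
    Tendsto (thalerX γ) atTop (𝓝[>] 0) :=
  tendsto_nhdsWithin_iff.2 ⟨tendsto_thalerX hγ hγ1,
    Eventually.of_forall fun k => (thalerX_mem hγ hγ1 k).1⟩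

lemma tendsto_thalerX_rpow_div {γ : ℝ} (hγ : 0 < γ) (hγ1 : γ ≠ 1) :
    Tendsto (fun k : ℕ => (k : ℝ) * thalerX γ k ^ γ) atTop (𝓝 γ⁻¹) := by
  have h1 : Tendsto (fun k => thalerX γ (k + 1) ^ (-γ) - thalerX γ k ^ (-γ)) atTop (𝓝 γ) := by
    refine ((tendsto_rpow_sub_thalerG_rpow hγ hγ1).comp
      ((tendsto_thalerX_nhdsGT hγ hγ1).comp (tendsto_add_atTop_nat 1))).congr fun k => ?_
    simp only [Function.comp_apply]
    rw [thalerG_thalerX_succ hγ hγ1]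
  have h2 := h1.cesaro
  simp only [Finset.sum_range_sub (fun k => thalerX γ k ^ (-γ)), thalerX_zero, one_rpow] at h2
  have h3 : Tendsto (fun k : ℕ => (k : ℝ)⁻¹ * thalerX γ k ^ (-γ)) atTop (𝓝 γ) := by
    have := h2.add tendsto_inv_atTop_nhds_zero_nat
    rw [add_zero] at this
    exact this.congr fun k => by ring
  refine (h3.inv₀ hγ.ne').congr fun k => ?_
  rw [mul_inv, inv_inv, rpow_neg (thalerX_mem hγ hγ1 k).1.le, inv_inv]

lemma tendsto_thalerX_sub {γ : ℝ} (hγ : 0 < γ) (hγ1 : γ ≠ 1) :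
    Tendsto (fun k : ℕ => ((k : ℝ) + 1) ^ (1 + γ⁻¹) * (thalerX γ k - thalerX γ (k + 1))) atTop
      (𝓝 ((γ⁻¹) ^ (1 + γ⁻¹))) := by
  have h1 := (tendsto_thalerG_sub_div hγ hγ1).comp
      ((tendsto_thalerX_nhdsGT hγ hγ1).comp (tendsto_add_atTop_nat 1))
  have h2 := ((tendsto_thalerX_rpow_div hγ hγ1).comp (tendsto_add_atTop_nat 1)).rpow_const
    (p := 1 + γ⁻¹) (Or.inr (by positivity))
  have h3 := h2.mul h1
  rw [mul_one] at h3
  refine h3.congr fun k => ?_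
  simp only [Function.comp_apply]
  have hx := (thalerX_mem hγ hγ1 (k + 1)).1
  rw [thalerG_thalerX_succ hγ hγ1, mul_rpow (by positivity) (by positivity), ← rpow_mul hx.le,
    show γ * (1 + γ⁻¹) = 1 + γ by field_simp; ring]
  have := (rpow_pos_of_pos hx (1 + γ)).ne'
  push_cast
  field_simp

lemma exists_thalerX_rpow_le {γ : ℝ} (hγ : 0 < γ) (hγ1 : γ ≠ 1) :
    ∃ C, 0 < C ∧ ∀ k : ℕ, thalerX γ k ^ γ ≤ C / ((k : ℝ) + 1) := by
  obtain ⟨C, hC⟩ := (tendsto_thalerX_rpow_div hγ hγ1).bddAbove_range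
  have hC' : ∀ k : ℕ, (k : ℝ) * thalerX γ k ^ γ ≤ C := fun k => hC ⟨k, rfl⟩
  have hC0 : 0 ≤ C := by simpa using hC' 0
  refine ⟨C + 1, by linarith, fun k => ?_⟩
  have hx := thalerX_mem hγ hγ1 k
  rw [le_div_iff₀ (by positivity)]
  have := rpow_le_one hx.1.le hx.2 hγ.le
  linarith [hC' k]

lemma exists_thalerX_le {γ : ℝ} (hγ : 0 < γ) (hγ1 : γ ≠ 1) :
    ∃ C, 0 < C ∧ ∀ k : ℕ, thalerX γ k ≤ C * ((k : ℝ) + 1) ^ (-γ⁻¹) := by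
  obtain ⟨C, hC, h⟩ := exists_thalerX_rpow_le hγ hγ1
  refine ⟨C ^ γ⁻¹, by positivity, fun k => ?_⟩
  have hx := thalerX_mem hγ hγ1 k
  have := rpow_le_rpow (rpow_nonneg hx.1.le _) (h k) (inv_nonneg.2 hγ.le)
  rwa [← rpow_mul hx.1.le, mul_inv_cancel₀ hγ.ne', rpow_one, div_rpow hC.le (by positivity),
    div_eq_mul_inv, ← rpow_neg (by positivity)] at this

/-- The conditional probability of the first branch under the backward dynamics. -/
def thalerA (γ z : ℝ) : ℝ := (1 + (z / (1 + z)) ^ γ)⁻¹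

/-- The probability that the backward dynamics started at `y` makes `k` steps along the first
branch. -/
def thalerS (γ : ℝ) (k : ℕ) (y : ℝ) : ℝ := ∏ j ∈ Finset.range k, thalerA γ ((thalerInv γ)^[j] y)

/-- The weight of the inverse branch of the first return map with return time `k + 1`. -/
def thalerP (γ : ℝ) (k : ℕ) (y : ℝ) : ℝ := thalerS γ k y * (1 - thalerA γ ((thalerInv γ)^[k] y))

/-- The inverse branch of the first return map with return time `k + 1`. -/
def thalerPsi (γ : ℝ) (k : ℕ) (y : ℝ) : ℝ := thalerInv γ (1 + (thalerInv γ)^[k] y)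

lemma thalerA_pos {γ z : ℝ} (hz : 0 ≤ z) : 0 < thalerA γ z := by
  unfold thalerA; positivity

lemma thalerA_le_one {γ z : ℝ} (hz : 0 ≤ z) : thalerA γ z ≤ 1 := by
  unfold thalerA
  have : 0 ≤ (z / (1 + z)) ^ γ := by positivity
  exact inv_le_one_of_one_le₀ (by linarith)

lemma thalerA_lt_one {γ z : ℝ} (hz : 0 < z) : thalerA γ z < 1 := by
  unfold thalerA
  have : 0 < (z / (1 + z)) ^ γ := by positivity
  exact inv_lt_one_of_one_lt₀ (by linarith)

lemma antitoneOn_thalerA {γ : ℝ} (hγ : 0 < γ) : AntitoneOn (thalerA γ) (Ici 0) := by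
  intro z (hz : 0 ≤ z) w (hw : 0 ≤ w) hzw
  unfold thalerA
  have : z / (1 + z) ≤ w / (1 + w) := by
    rw [div_le_div_iff₀ (by linarith) (by linarith)]; nlinarith
  gcongr

lemma one_sub_thalerA_le {γ z : ℝ} (hγ : 0 < γ) (hz : 0 ≤ z) : 1 - thalerA γ z ≤ z ^ γ := by
  have h0 : 0 ≤ (z / (1 + z)) ^ γ := by positivity
  have h1 : (z / (1 + z)) ^ γ ≤ z ^ γ :=
    rpow_le_rpow (by positivity) (div_le_self hz (by linarith)) hγ.le
  have h2 : 1 - thalerA γ z = (z / (1 + z)) ^ γ * thalerA γ z := by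
    unfold thalerA; field_simp; ring
  rw [h2]
  exact (mul_le_of_le_one_right h0 (thalerA_le_one hz)).trans h1

lemma thalerA_mul_thalerH {γ z : ℝ} (hz : 0 < z) : thalerA γ z * thalerH γ z = z ^ (-γ) := by
  unfold thalerA thalerH
  have h1 := rpow_pos_of_pos hz γ
  have h2 : 0 < (1 + z) ^ γ := rpow_pos_of_pos (by linarith) γ
  rw [div_rpow hz.le (by linarith), rpow_neg hz.le, rpow_neg (by linarith), add_comm z 1]
  field_simp

lemma one_sub_thalerA_mul_thalerH {γ z : ℝ} (hz : 0 < z) :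
    (1 - thalerA γ z) * thalerH γ z = (1 + z) ^ (-γ) := by
  rw [sub_mul, thalerA_mul_thalerH hz, thalerH, add_comm z 1]; ring

lemma measurable_thalerInv (γ : ℝ) : Measurable (thalerInv γ) := (monotone_thalerInv γ).measurable

lemma measurable_thalerA (γ : ℝ) : Measurable (thalerA γ) := by
  unfold thalerA; fun_prop

lemma measurable_thalerS (γ : ℝ) (k : ℕ) : Measurable (thalerS γ k) := by
  unfold thalerS
  exact Finset.measurable_prod _ fun j _ =>
    (measurable_thalerA γ).comp ((measurable_thalerInv γ).iterate j)

lemma measurable_thalerP (γ : ℝ) (k : ℕ) : Measurable (thalerP γ k) :=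
  (measurable_thalerS γ k).mul
    (measurable_const.sub ((measurable_thalerA γ).comp ((measurable_thalerInv γ).iterate k)))

lemma measurable_thalerPsi (γ : ℝ) (k : ℕ) : Measurable (thalerPsi γ k) :=
  (measurable_thalerInv γ).comp (measurable_const.add ((measurable_thalerInv γ).iterate k))

lemma measurable_thalerH (γ : ℝ) : Measurable (thalerH γ) := by
  unfold thalerH; fun_prop

lemma thalerS_zero (γ y : ℝ) : thalerS γ 0 y = 1 := by simp [thalerS]

lemma thalerS_succ (γ : ℝ) (k : ℕ) (y : ℝ) :
    thalerS γ (k + 1) y = thalerS γ k y * thalerA γ ((thalerInv γ)^[k] y) :=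
  Finset.prod_range_succ _ _

lemma thalerS_succ_left (γ : ℝ) (k : ℕ) (y : ℝ) :
    thalerS γ (k + 1) y = thalerA γ y * thalerS γ k (thalerInv γ y) := by
  rw [thalerS, Finset.prod_range_succ', mul_comm]
  rfl

lemma thalerP_eq_sub (γ : ℝ) (k : ℕ) (y : ℝ) :
    thalerP γ k y = thalerS γ k y - thalerS γ (k + 1) y := by
  rw [thalerP, thalerS_succ]; ring

lemma thalerP_zero (γ y : ℝ) : thalerP γ 0 y = 1 - thalerA γ y := by
  simp [thalerP, thalerS_zero]

lemma thalerP_succ_left (γ : ℝ) (k : ℕ) (y : ℝ) :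
    thalerP γ (k + 1) y = thalerA γ y * thalerP γ k (thalerInv γ y) := by
  rw [thalerP_eq_sub, thalerP_eq_sub, thalerS_succ_left, thalerS_succ_left]; ring

lemma sum_thalerP (γ : ℝ) (n : ℕ) (y : ℝ) :
    ∑ k ∈ Finset.range n, thalerP γ k y = 1 - thalerS γ n y := by
  simp only [thalerP_eq_sub]
  rw [Finset.sum_range_sub', thalerS_zero]

section

variable {γ : ℝ}

lemma thalerS_nonneg (hγ : 0 < γ) (hγ1 : γ ≠ 1) {y : ℝ} (hy : y ∈ Ioc (0 : ℝ) 1) (k : ℕ) :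
    0 ≤ thalerS γ k y :=
  Finset.prod_nonneg fun j _ => (thalerA_pos (iterate_thalerInv_mem hγ hγ1 hy j).1.le).le

lemma thalerP_nonneg (hγ : 0 < γ) (hγ1 : γ ≠ 1) {y : ℝ} (hy : y ∈ Ioc (0 : ℝ) 1) (k : ℕ) :
    0 ≤ thalerP γ k y :=
  mul_nonneg (thalerS_nonneg hγ hγ1 hy k)
    (sub_nonneg.2 (thalerA_le_one (iterate_thalerInv_mem hγ hγ1 hy k).1.le))

lemma antitoneOn_thalerS (hγ : 0 < γ) (hγ1 : γ ≠ 1) (k : ℕ) :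
    AntitoneOn (thalerS γ k) (Ioc 0 1) := by
  intro y hy z hz hyz
  refine Finset.prod_le_prod
    (fun j _ => (thalerA_pos (iterate_thalerInv_mem hγ hγ1 hz j).1.le).le) fun j _ => ?_
  exact antitoneOn_thalerA hγ (iterate_thalerInv_mem hγ hγ1 hy j).1.le
    (iterate_thalerInv_mem hγ hγ1 hz j).1.le ((monotone_thalerInv γ).iterate j hyz)

lemma setIntegral_thalerH_smul {E : Type*} [NormedAddCommGroup E] [NormedSpace ℝ E]
    (hγ : 0 < γ) (hγ1 : γ ≠ 1) {u v : ℝ} (hu : 0 < u) (huv : u ≤ v) (hv : v ≤ 2) (q : ℝ → E) :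
    ∫ x in Ioc (thalerInv γ u) (thalerInv γ v), thalerH γ x • q x =
      ∫ z in Ioc u v, z ^ (-γ) • q (thalerInv γ z) := by
  have hu' : u ∈ Ioc (0 : ℝ) 2 := ⟨hu, huv.trans hv⟩
  have hv' : v ∈ Ioc (0 : ℝ) 2 := ⟨hu.trans_le huv, hv⟩
  have hsub : Ioc (thalerInv γ u) (thalerInv γ v) ⊆ Ioc (0 : ℝ) 1 :=
    Ioc_subset_Ioc (thalerInv_mem hγ hγ1 hu').1.le (thalerInv_mem hγ hγ1 hv').2
  have himg : thalerG γ '' Ioc (thalerInv γ u) (thalerInv γ v) = Ioc u v := by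
    apply Subset.antisymm
    · rintro _ ⟨x, hx, rfl⟩
      have h1 := strictMonoOn_thalerG hγ1 (thalerInv_mem hγ hγ1 hu') (hsub hx) hx.1
      have h2 := (strictMonoOn_thalerG hγ1).monotoneOn (hsub hx) (thalerInv_mem hγ hγ1 hv') hx.2
      rw [thalerG_thalerInv hγ hγ1 hu'] at h1
      rw [thalerG_thalerInv hγ hγ1 hv'] at h2
      exact ⟨h1, h2⟩
    · intro z hz
      have hz' : z ∈ Ioc (0 : ℝ) 2 := ⟨hu.trans hz.1, hz.2.trans hv⟩
      exact ⟨thalerInv γ z, ⟨strictMonoOn_thalerInv hγ hγ1 hu' hz' hz.1,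
        monotone_thalerInv γ hz.2⟩, thalerG_thalerInv hγ hγ1 hz'⟩
  rw [← himg, integral_image_eq_integral_abs_deriv_smul measurableSet_Ioc
    (fun x hx => (hasDerivAt_thalerG hγ1 (hsub hx)).hasDerivWithinAt)
    ((strictMonoOn_thalerG hγ1).injOn.mono hsub)]
  refine setIntegral_congr_fun measurableSet_Ioc fun x hx => ?_
  have hg := thalerG_pos (γ := γ) (hsub hx)
  have hh := thalerH_pos (γ := γ) (hsub hx).1
  have hp := rpow_pos_of_pos hg γ
  rw [thalerInv_thalerG hγ1 (hsub hx), abs_of_pos (mul_pos hh hp), smul_smul, rpow_neg hg.le,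
    mul_inv_cancel_right₀ hp.ne']

lemma setIntegral_thalerX_Ioc {E : Type*} [NormedAddCommGroup E] [NormedSpace ℝ E]
    (hγ : 0 < γ) (hγ1 : γ ≠ 1) (k : ℕ) (q : ℝ → E) :
    ∫ x in Ioc (thalerX γ (k + 1)) (thalerX γ k), thalerH γ x • q x =
      ∫ z in Ioc (thalerX γ 1) 1, thalerH γ z • thalerS γ k z • q ((thalerInv γ)^[k] z) := by
  induction k generalizing q with
  | zero => simp [thalerS_zero, thalerX_zero]
  | succ k ih =>
    have hk := thalerX_mem hγ hγ1 k
    have hcv := setIntegral_thalerH_smul hγ hγ1 (thalerX_mem hγ hγ1 (k + 1)).1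
      (strictAnti_thalerX hγ hγ1 k.lt_succ_self).le (hk.2.trans one_le_two) q
    rw [← thalerX_succ, ← thalerX_succ] at hcv
    rw [hcv, setIntegral_congr_fun (g := fun z => thalerH γ z • thalerA γ z • q (thalerInv γ z))
      measurableSet_Ioc, ih]
    · refine setIntegral_congr_fun measurableSet_Ioc fun z _ => ?_
      rw [thalerS_succ, Function.iterate_succ_apply', smul_smul (thalerS γ k z)]
    · intro z hz
      have hz0 : 0 < z := (thalerX_mem hγ hγ1 (k + 1)).1.trans hz.1
      simp only
      rw [smul_smul, mul_comm, thalerA_mul_thalerH hz0]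

lemma setIntegral_thalerX_one {E : Type*} [NormedAddCommGroup E] [NormedSpace ℝ E]
    (hγ : 0 < γ) (hγ1 : γ ≠ 1) (q : ℝ → E) :
    ∫ x in Ioc (thalerX γ 1) 1, thalerH γ x • q x =
      ∫ z in Ioc 0 1, (1 + z) ^ (-γ) • q (thalerInv γ (1 + z)) := by
  have h := setIntegral_thalerH_smul hγ hγ1 one_pos one_le_two le_rfl q
  rw [thalerInv_two hγ1] at h
  rw [thalerX_succ, thalerX_zero, h, ← intervalIntegral.integral_of_le one_le_two,
    ← intervalIntegral.integral_of_le zero_le_one]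
  have := intervalIntegral.integral_comp_add_left (a := 0) (b := 1)
    (fun z => z ^ (-γ) • q (thalerInv γ z)) 1
  rw [this]
  norm_num

end

section

variable {γ : ℝ}

lemma Icc_thalerX_subset (hγ : 0 < γ) (hγ1 : γ ≠ 1) : Icc (thalerX γ 1) 1 ⊆ Ioc 0 1 :=
  fun _ hy => ⟨(thalerX_mem hγ hγ1 1).1.trans_le hy.1, hy.2⟩

lemma Ioc_thalerX_subset (hγ : 0 < γ) (hγ1 : γ ≠ 1) (k : ℕ) :
    Ioc (thalerX γ (k + 1)) (thalerX γ k) ⊆ Ioc 0 1 :=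
  fun _ hy => ⟨(thalerX_mem hγ hγ1 (k + 1)).1.trans hy.1, hy.2.trans (thalerX_mem hγ hγ1 k).2⟩

lemma thalerX_one_mem (hγ : 0 < γ) (hγ1 : γ ≠ 1) : thalerX γ 1 ∈ Icc (thalerX γ 1) 1 :=
  ⟨le_rfl, (thalerX_mem hγ hγ1 1).2⟩

lemma one_mem_Icc_thalerX (hγ : 0 < γ) (hγ1 : γ ≠ 1) : (1 : ℝ) ∈ Icc (thalerX γ 1) 1 :=
  ⟨(thalerX_mem hγ hγ1 1).2, le_rfl⟩

lemma thalerH_le (hγ : 0 < γ) {u x : ℝ} (hu : 0 < u) (hx : u ≤ x) :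
    thalerH γ x ≤ 2 * u ^ (-γ) := by
  have h1 := rpow_le_rpow_of_nonpos hu hx (neg_nonpos.2 hγ.le)
  have h2 := rpow_le_rpow_of_nonpos hu (show u ≤ x + 1 by linarith) (neg_nonpos.2 hγ.le)
  rw [thalerH]; linarith

lemma integrableOn_thalerH_of_pos (hγ : 0 < γ) {u v : ℝ} (hu : 0 < u) :
    IntegrableOn (thalerH γ) (Ioc u v) := by
  refine Measure.integrableOn_of_bounded (M := 2 * u ^ (-γ)) measure_Ioc_lt_top.ne
    (measurable_thalerH γ).aestronglyMeasurable ?_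
  filter_upwards [ae_restrict_mem measurableSet_Ioc] with x hx
  rw [norm_of_nonneg (thalerH_pos (hu.trans hx.1)).le]
  exact thalerH_le hγ hu hx.1.le

/-- The mass `μ(Y)`. -/
def thalerM (γ : ℝ) : ℝ := ∫ z in Ioc (thalerX γ 1) 1, thalerH γ z

lemma thalerM_eq (hγ : 0 < γ) (hγ1 : γ ≠ 1) :
    thalerM γ = (2 ^ (1 - γ) - 1) / (1 - γ) := by
  have h := setIntegral_thalerX_one hγ hγ1 (fun _ => (1 : ℝ))
  simp only [smul_eq_mul, mul_one] at h
  rw [thalerM, h, ← intervalIntegral.integral_of_le zero_le_one,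
    intervalIntegral.integral_comp_add_left (fun z : ℝ => z ^ (-γ)), integral_rpow]
  · norm_num
    rw [show -γ + 1 = 1 - γ by ring]
  · refine Or.inr ⟨fun h => hγ1 (by linarith), ?_⟩
    norm_num

lemma thalerM_pos (hγ : 0 < γ) (hγ1 : γ ≠ 1) : 0 < thalerM γ := by
  rw [thalerM_eq hγ hγ1]
  rcases lt_or_gt_of_ne hγ1 with h | h
  · have := one_lt_rpow (show (1 : ℝ) < 2 by norm_num) (sub_pos.2 h)
    exact div_pos (by linarith) (by linarith)
  · have := rpow_lt_one_of_one_lt_of_neg (show (1 : ℝ) < 2 by norm_num) (sub_neg.2 h)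
    exact div_pos_of_neg_of_neg (by linarith) (by linarith)

lemma thalerMu_restrict (hγ : 0 < γ) (hγ1 : γ ≠ 1) :
    (thalerMu γ).restrict (Ioc (thalerX γ 1) 1) =
      (volume.restrict (Ioc (thalerX γ 1) 1)).withDensity
        fun x => ENNReal.ofReal (thalerH γ x) := by
  rw [thalerMu, restrict_withDensity measurableSet_Ioc, Measure.restrict_restrict measurableSet_Ioc,
    inter_eq_left.2]
  exact fun x hx => ⟨((thalerX_mem hγ hγ1 1).1.trans hx.1).le, hx.2⟩

lemma thalerMu_apply (hγ : 0 < γ) (hγ1 : γ ≠ 1) :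
    thalerMu γ (Ioc (thalerX γ 1) 1) = ENNReal.ofReal (thalerM γ) := by
  rw [← Measure.restrict_apply_univ, thalerMu_restrict hγ hγ1, withDensity_apply _ MeasurableSet.univ,
    Measure.restrict_univ, thalerM, ofReal_integral_eq_lintegral_ofReal]
  · exact integrableOn_thalerH_of_pos hγ (thalerX_mem hγ hγ1 1).1
  · filter_upwards [ae_restrict_mem measurableSet_Ioc] with x hx
    exact (thalerH_pos ((thalerX_mem hγ hγ1 1).1.trans hx.1)).le

lemma isProbabilityMeasure_thalerMuY (hγ : 0 < γ) (hγ1 : γ ≠ 1) :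
    IsProbabilityMeasure (thalerMuY γ (thalerX γ 1)) := by
  constructor
  rw [thalerMuY, Measure.smul_apply, Measure.restrict_apply_univ, thalerMu_apply hγ hγ1,
    smul_eq_mul, ENNReal.inv_mul_cancel]
  · simpa using thalerM_pos hγ hγ1
  · simp

lemma ae_thalerMuY (γ : ℝ) :
    ∀ᵐ y ∂thalerMuY γ (thalerX γ 1), y ∈ Ioc (thalerX γ 1) 1 := by
  have := ae_restrict_mem (μ := thalerMu γ) (measurableSet_Ioc (a := thalerX γ 1) (b := (1 : ℝ)))
  exact Measure.ae_smul_measure this _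

lemma integral_thalerMuY {E : Type*} [NormedAddCommGroup E] [NormedSpace ℝ E]
    (hγ : 0 < γ) (hγ1 : γ ≠ 1) (f : ℝ → E) :
    ∫ y, f y ∂thalerMuY γ (thalerX γ 1) =
      (thalerM γ)⁻¹ • ∫ y in Ioc (thalerX γ 1) 1, thalerH γ y • f y := by
  rw [thalerMuY, integral_smul_measure, thalerMu_apply hγ hγ1, thalerMu_restrict hγ hγ1,
    ENNReal.toReal_inv, ENNReal.toReal_ofReal (thalerM_pos hγ hγ1).le,
    integral_withDensity_eq_integral_toReal_smul
      (measurable_thalerH γ).ennreal_ofReal (by simp)]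
  congr 1
  refine setIntegral_congr_fun measurableSet_Ioc fun x hx => ?_
  rw [ENNReal.toReal_ofReal (thalerH_pos ((thalerX_mem hγ hγ1 1).1.trans hx.1)).le]

lemma setIntegral_thalerH_eq (hγ : 0 < γ) (hγ1 : γ ≠ 1) (k : ℕ) :
    ∫ x in Ioc (thalerX γ (k + 1)) (thalerX γ k), thalerH γ x =
      ∫ z in Ioc (thalerX γ 1) 1, thalerH γ z * thalerS γ k z := by
  simpa using setIntegral_thalerX_Ioc hγ hγ1 k (fun _ => (1 : ℝ))

lemma thalerS_le_one (hγ : 0 < γ) (hγ1 : γ ≠ 1) {y : ℝ} (hy : y ∈ Ioc (0 : ℝ) 1) (k : ℕ) :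
    thalerS γ k y ≤ 1 :=
  Finset.prod_le_one (fun j _ => (thalerA_pos (iterate_thalerInv_mem hγ hγ1 hy j).1.le).le)
    fun j _ => thalerA_le_one (iterate_thalerInv_mem hγ hγ1 hy j).1.le

lemma integrable_thalerS (hγ : 0 < γ) (hγ1 : γ ≠ 1) (k : ℕ) :
    IntegrableOn (fun z => thalerH γ z * thalerS γ k z) (Ioc (thalerX γ 1) 1) := by
  refine (integrableOn_thalerH_of_pos hγ (thalerX_mem hγ hγ1 1).1).mono'
    ((measurable_thalerH γ).mul (measurable_thalerS γ k)).aestronglyMeasurable ?_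
  filter_upwards [ae_restrict_mem measurableSet_Ioc] with x hx
  have hx' := Icc_thalerX_subset hγ hγ1 ⟨hx.1.le, hx.2⟩
  have h := thalerH_pos (γ := γ) hx'.1
  rw [norm_mul, norm_of_nonneg h.le, norm_of_nonneg (thalerS_nonneg hγ hγ1 hx' k)]
  exact mul_le_of_le_one_right h.le (thalerS_le_one hγ hγ1 hx' k)

lemma thalerS_one_mul_thalerM_le (hγ : 0 < γ) (hγ1 : γ ≠ 1) (k : ℕ) :
    thalerS γ k 1 * thalerM γ ≤ ∫ x in Ioc (thalerX γ (k + 1)) (thalerX γ k), thalerH γ x := by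
  rw [setIntegral_thalerH_eq hγ hγ1, thalerM, ← integral_const_mul]
  refine setIntegral_mono_on ?_ (integrable_thalerS hγ hγ1 k) measurableSet_Ioc fun x hx => ?_
  · exact (integrableOn_thalerH_of_pos hγ (thalerX_mem hγ hγ1 1).1).const_mul _
  · have hx' := Icc_thalerX_subset hγ hγ1 ⟨hx.1.le, hx.2⟩
    rw [mul_comm]
    exact mul_le_mul_of_nonneg_left (antitoneOn_thalerS hγ hγ1 k hx' (by simp) hx'.2)
      (thalerH_pos hx'.1).le

lemma exists_setIntegral_thalerH_le (hγ : 0 < γ) (hγ1 : γ ≠ 1) :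
    ∃ C, 0 < C ∧ ∀ k : ℕ, ∫ x in Ioc (thalerX γ (k + 1)) (thalerX γ k), thalerH γ x ≤
      C * ((k : ℝ) + 1) ^ (-γ⁻¹) := by
  obtain ⟨C, hC⟩ := ((tendsto_thalerG_sub_div hγ hγ1).comp
      ((tendsto_thalerX_nhdsGT hγ hγ1).comp (tendsto_add_atTop_nat 1))).bddAbove_range
  have hC' : ∀ k : ℕ, (thalerX γ k - thalerX γ (k + 1)) / thalerX γ (k + 1) ^ (1 + γ) ≤ C := by
    intro k
    have := hC ⟨k, rfl⟩
    simp only [Function.comp_apply] at this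
    rwa [thalerG_thalerX_succ hγ hγ1] at this
  obtain ⟨B, hB, hXB⟩ := exists_thalerX_le hγ hγ1
  have hanti : ∀ k, thalerX γ (k + 1) < thalerX γ k := fun k =>
    strictAnti_thalerX hγ hγ1 k.lt_succ_self
  have hC0 : 0 < C := by
    refine lt_of_lt_of_le (div_pos (sub_pos.2 (hanti 0)) ?_) (hC' 0)
    exact rpow_pos_of_pos (thalerX_mem hγ hγ1 1).1 _
  refine ⟨2 * C * B, by positivity, fun k => ?_⟩
  have hx0 := (thalerX_mem hγ hγ1 (k + 1)).1
  have hInt : ∫ x in Ioc (thalerX γ (k + 1)) (thalerX γ k), thalerH γ x ≤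
      ∫ x in Ioc (thalerX γ (k + 1)) (thalerX γ k), 2 * thalerX γ (k + 1) ^ (-γ) :=
    setIntegral_mono_on (integrableOn_thalerH_of_pos hγ hx0)
      (integrableOn_const measure_Ioc_lt_top.ne) measurableSet_Ioc
      fun x hx => thalerH_le hγ hx0 hx.1.le
  refine hInt.trans ?_
  rw [setIntegral_const, Real.volume_real_Ioc_of_le (hanti k).le, smul_eq_mul]
  have h1 := (div_le_iff₀ (rpow_pos_of_pos hx0 (1 + γ))).1 (hC' k)
  calc (thalerX γ k - thalerX γ (k + 1)) * (2 * thalerX γ (k + 1) ^ (-γ))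
      ≤ (C * thalerX γ (k + 1) ^ (1 + γ)) * (2 * thalerX γ (k + 1) ^ (-γ)) := by gcongr
    _ = 2 * C * thalerX γ (k + 1) := by
      have : thalerX γ (k + 1) ^ (1 + γ) * thalerX γ (k + 1) ^ (-γ) = thalerX γ (k + 1) := by
        rw [← rpow_add hx0, add_neg_cancel_right, rpow_one]
      linear_combination 2 * C * this
    _ ≤ 2 * C * thalerX γ k := by gcongr; exact (hanti k).le
    _ ≤ 2 * C * (B * ((k : ℝ) + 1) ^ (-γ⁻¹)) := by gcongr; exact hXB k
    _ = _ := by ring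

lemma exists_thalerS_le (hγ : 0 < γ) (hγ1 : γ ≠ 1) :
    ∃ C, 0 < C ∧ ∀ (k : ℕ), ∀ y ∈ Icc (thalerX γ 1) 1,
      thalerS γ k y ≤ C * ((k : ℝ) + 1) ^ (-γ⁻¹) := by
  obtain ⟨C, hC, h⟩ := exists_setIntegral_thalerH_le hγ hγ1
  have hM := thalerM_pos hγ hγ1
  have hA : 0 < thalerA γ 1 := thalerA_pos zero_le_one
  refine ⟨C / thalerM γ / thalerA γ 1, by positivity, fun k y hy => ?_⟩
  have h1 := (thalerS_one_mul_thalerM_le hγ hγ1 (k + 1)).trans (h (k + 1))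
  rw [thalerS_succ_left, ← thalerX_zero γ, ← thalerX_succ, thalerX_zero] at h1
  have h2 : ((k + 1 : ℕ) + 1 : ℝ) ^ (-γ⁻¹) ≤ ((k : ℝ) + 1) ^ (-γ⁻¹) :=
    rpow_le_rpow_of_nonpos (by positivity) (by push_cast; linarith)
      (neg_nonpos.2 (inv_nonneg.2 hγ.le))
  have h3 : thalerS γ k y ≤ thalerS γ k (thalerX γ 1) :=
    antitoneOn_thalerS hγ hγ1 k (thalerX_mem hγ hγ1 1) (Icc_thalerX_subset hγ hγ1 hy) hy.1
  have h4 : thalerA γ 1 * thalerS γ k (thalerX γ 1) * thalerM γ ≤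
      C * ((k : ℝ) + 1) ^ (-γ⁻¹) := h1.trans (by gcongr)
  refine h3.trans ?_
  rw [div_div, div_mul_eq_mul_div, le_div_iff₀ (by positivity)]
  linarith

lemma hasSum_thalerP (hγ : 0 < γ) (hγ1 : γ ≠ 1) {y : ℝ} (hy : y ∈ Icc (thalerX γ 1) 1) :
    HasSum (fun k => thalerP γ k y) 1 := by
  have hy' := Icc_thalerX_subset hγ hγ1 hy
  rw [hasSum_iff_tendsto_nat_of_nonneg (thalerP_nonneg hγ hγ1 hy')]
  simp only [sum_thalerP]
  obtain ⟨C, hC, h⟩ := exists_thalerS_le hγ hγ1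
  have h0 : Tendsto (fun k => thalerS γ k y) atTop (𝓝 0) := by
    refine squeeze_zero (thalerS_nonneg hγ hγ1 hy') (fun k => h k y hy) ?_
    have := ((tendsto_rpow_neg_atTop (inv_pos.2 hγ)).comp
      (tendsto_atTop_add_const_right _ (1 : ℝ) tendsto_natCast_atTop_atTop)).const_mul C
    rwa [mul_zero] at this
  simpa using h0.const_sub 1

/-- A uniform bound for the weight `thalerP γ k` on the closure of `Y`. -/
def thalerB (γ : ℝ) (k : ℕ) : ℝ := thalerS γ k (thalerX γ 1) * (1 - thalerA γ (thalerX γ k))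

lemma thalerB_nonneg (hγ : 0 < γ) (hγ1 : γ ≠ 1) (k : ℕ) : 0 ≤ thalerB γ k :=
  mul_nonneg (thalerS_nonneg hγ hγ1 (thalerX_mem hγ hγ1 1) k)
    (sub_nonneg.2 (thalerA_le_one (thalerX_mem hγ hγ1 k).1.le))

lemma exists_thalerB_le (hγ : 0 < γ) (hγ1 : γ ≠ 1) :
    ∃ C, 0 < C ∧ ∀ k : ℕ, thalerB γ k ≤ C * ((k : ℝ) + 1) ^ (-(1 + γ⁻¹)) := by
  obtain ⟨C, hC, h⟩ := exists_thalerS_le hγ hγ1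
  obtain ⟨B, hB, hX⟩ := exists_thalerX_rpow_le hγ hγ1
  refine ⟨C * B, by positivity, fun k => ?_⟩
  have hk : (0 : ℝ) < (k : ℝ) + 1 := by positivity
  calc thalerB γ k ≤ (C * ((k : ℝ) + 1) ^ (-γ⁻¹)) * (B / ((k : ℝ) + 1)) := by
        refine mul_le_mul (h k _ (thalerX_one_mem hγ hγ1)) ?_
          (sub_nonneg.2 (thalerA_le_one (thalerX_mem hγ hγ1 k).1.le)) (by positivity)
        exact (one_sub_thalerA_le hγ (thalerX_mem hγ hγ1 k).1.le).trans (hX k)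
    _ = _ := by
        rw [show -(1 + γ⁻¹) = -γ⁻¹ - 1 by ring, rpow_sub hk, rpow_one]; ring

end

section

variable {γ : ℝ} {𝕜 : Type*} [RCLike 𝕜]

/-- The twisted transfer operator of the first return map, acting on functions on the closure
of `Y`; the weight `χ k` belongs to the return time `k + 1`. -/
def thalerQ {𝕜 : Type*} [RCLike 𝕜] (γ : ℝ) (χ : ℕ → 𝕜) (f : ℝ → 𝕜) : ℝ → 𝕜 :=
  (Icc (thalerX γ 1) 1).indicator
    fun y => ∑' k, (thalerP γ k y : 𝕜) * (χ k * f (thalerPsi γ k y))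

lemma thalerPsi_mem (hγ : 0 < γ) (hγ1 : γ ≠ 1) {y : ℝ} (hy : y ∈ Ioc (0 : ℝ) 1) (k : ℕ) :
    thalerPsi γ k y ∈ Ioc (thalerX γ 1) 1 := by
  have h := iterate_thalerInv_mem hγ hγ1 hy k
  refine ⟨?_, (thalerInv_mem hγ hγ1 ⟨by linarith [h.1], by linarith [h.2]⟩).2⟩
  rw [thalerX_succ, thalerX_zero]
  exact strictMonoOn_thalerInv hγ hγ1 ⟨one_pos, one_le_two⟩ ⟨by linarith [h.1], by linarith [h.2]⟩
    (by linarith [h.1])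

lemma thalerPsi_mem_Icc (hγ : 0 < γ) (hγ1 : γ ≠ 1) {y : ℝ} (hy : y ∈ Ioc (0 : ℝ) 1) (k : ℕ) :
    thalerPsi γ k y ∈ Icc (thalerX γ 1) 1 :=
  Ioc_subset_Icc_self (thalerPsi_mem hγ hγ1 hy k)

/-- The truncated averaging operator of the backward dynamics. -/
def thalerTrunc (γ : ℝ) (R : ℝ → ℝ) (N : ℕ) (y : ℝ) : ℝ :=
  ∑ k ∈ Finset.range N, thalerP γ k y * R (thalerPsi γ k y) + thalerS γ N y * R (thalerX γ 1)

lemma thalerTrunc_succ (γ : ℝ) (R : ℝ → ℝ) (N : ℕ) (y : ℝ) :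
    thalerTrunc γ R (N + 1) y = (1 - thalerA γ y) * R (thalerInv γ (1 + y)) +
      thalerA γ y * thalerTrunc γ R N (thalerInv γ y) := by
  rw [thalerTrunc, thalerTrunc, Finset.sum_range_succ', thalerP_zero, thalerS_succ_left]
  simp only [thalerP_succ_left]
  have : ∀ k, thalerPsi γ (k + 1) y = thalerPsi γ k (thalerInv γ y) := fun k => rfl
  simp only [this, mul_add, Finset.mul_sum, mul_assoc]
  rw [show thalerPsi γ 0 y = thalerInv γ (1 + y) from rfl]
  ring

lemma monotoneOn_thalerTrunc (hγ : 0 < γ) (hγ1 : γ ≠ 1) {R : ℝ → ℝ}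
    (hR : MonotoneOn R (Icc (thalerX γ 1) 1)) (N : ℕ) :
    MonotoneOn (thalerTrunc γ R N) (Ioc 0 1) ∧
      ∀ y ∈ Ioc (0 : ℝ) 1, thalerTrunc γ R N y ≤ R (thalerInv γ (1 + y)) := by
  have hψ : ∀ {y : ℝ}, y ∈ Ioc (0 : ℝ) 1 → thalerInv γ (1 + y) ∈ Icc (thalerX γ 1) 1 :=
    fun hy => thalerPsi_mem_Icc hγ hγ1 hy 0
  have hφ : ∀ {y : ℝ}, y ∈ Ioc (0 : ℝ) 1 → thalerInv γ y ∈ Ioc (0 : ℝ) 1 :=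
    fun hy => iterate_thalerInv_mem hγ hγ1 hy 1
  induction N with
  | zero =>
    simp only [thalerTrunc, thalerS_zero, Finset.range_zero, Finset.sum_empty, zero_add, one_mul]
    exact ⟨fun _ _ _ _ _ => le_rfl, fun y hy =>
      hR (thalerX_one_mem hγ hγ1) (hψ hy) (hψ hy).1⟩
  | succ N ih =>
    obtain ⟨ih1, ih2⟩ := ih
    have key : ∀ y ∈ Ioc (0 : ℝ) 1, thalerTrunc γ R N (thalerInv γ y) ≤ R (thalerInv γ (1 + y)) := by
      intro y hy
      refine (ih2 _ (hφ hy)).trans (hR (hψ (hφ hy)) (hψ hy) (monotone_thalerInv γ ?_))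
      have := (thalerInv_lt hγ hγ1 ⟨hy.1, hy.2.trans one_le_two⟩).le
      linarith
    refine ⟨fun y hy z hz hyz => ?_, fun y hy => ?_⟩
    · rw [thalerTrunc_succ, thalerTrunc_succ]
      have hA := antitoneOn_thalerA hγ hy.1.le hz.1.le hyz
      have h1 := thalerA_le_one (γ := γ) hz.1.le
      have h0 := (thalerA_pos (γ := γ) hz.1.le).le
      have hRR := hR (hψ hy) (hψ hz) (monotone_thalerInv γ (by linarith))
      have hTT := ih1 (hφ hy) (hφ hz) (monotone_thalerInv γ hyz)
      have hk := key y hy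
      nlinarith [mul_nonneg (sub_nonneg.2 h1) (sub_nonneg.2 hRR),
        mul_nonneg h0 (sub_nonneg.2 hTT), mul_nonneg (sub_nonneg.2 hA) (sub_nonneg.2 hk)]
    · rw [thalerTrunc_succ]
      have h0 := (thalerA_pos (γ := γ) hy.1.le).le
      nlinarith [mul_nonneg h0 (sub_nonneg.2 (key y hy))]

lemma norm_thalerQ_term_le (hγ : 0 < γ) (hγ1 : γ ≠ 1) {χ : ℕ → 𝕜} {f : ℝ → 𝕜} {c C : ℝ}
    (hχ : ∀ k, ‖χ k‖ ≤ c) (hf : ∀ y ∈ Icc (thalerX γ 1) 1, ‖f y‖ ≤ C)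
    {y : ℝ} (hy : y ∈ Icc (thalerX γ 1) 1) (k : ℕ) :
    ‖(thalerP γ k y : 𝕜) * (χ k * f (thalerPsi γ k y))‖ ≤ thalerP γ k y * (c * C) := by
  have hy' := Icc_thalerX_subset hγ hγ1 hy
  have hc : 0 ≤ c := (norm_nonneg _).trans (hχ 0)
  rw [norm_mul, norm_mul, RCLike.norm_ofReal, abs_of_nonneg (thalerP_nonneg hγ hγ1 hy' k)]
  exact mul_le_mul_of_nonneg_left (mul_le_mul (hχ k) (hf _ (thalerPsi_mem_Icc hγ hγ1 hy' k))
    (norm_nonneg _) hc) (thalerP_nonneg hγ hγ1 hy' k)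

lemma summable_thalerQ_term (hγ : 0 < γ) (hγ1 : γ ≠ 1) {χ : ℕ → 𝕜} {f : ℝ → 𝕜} {c C : ℝ}
    (hχ : ∀ k, ‖χ k‖ ≤ c) (hf : ∀ y ∈ Icc (thalerX γ 1) 1, ‖f y‖ ≤ C)
    {y : ℝ} (hy : y ∈ Icc (thalerX γ 1) 1) :
    Summable fun k => (thalerP γ k y : 𝕜) * (χ k * f (thalerPsi γ k y)) :=
  Summable.of_norm_bounded ((hasSum_thalerP hγ hγ1 hy).summable.mul_right _)
    (norm_thalerQ_term_le hγ hγ1 hχ hf hy)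

lemma thalerQ_apply {χ : ℕ → 𝕜} {f : ℝ → 𝕜} {y : ℝ} (hy : y ∈ Icc (thalerX γ 1) 1) :
    thalerQ γ χ f y = ∑' k, (thalerP γ k y : 𝕜) * (χ k * f (thalerPsi γ k y)) :=
  indicator_of_mem hy _

lemma norm_thalerQ_le (hγ : 0 < γ) (hγ1 : γ ≠ 1) {χ : ℕ → 𝕜} {f : ℝ → 𝕜} {c C : ℝ}
    (hχ : ∀ k, ‖χ k‖ ≤ c) (hf : ∀ y ∈ Icc (thalerX γ 1) 1, ‖f y‖ ≤ C)
    {y : ℝ} (hy : y ∈ Icc (thalerX γ 1) 1) : ‖thalerQ γ χ f y‖ ≤ c * C := by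
  rw [thalerQ_apply hy]
  have := (hasSum_thalerP hγ hγ1 hy).mul_right (c * C)
  rw [one_mul] at this
  exact tsum_of_norm_bounded this (norm_thalerQ_term_le hγ hγ1 hχ hf hy)

lemma measurable_thalerQ (hγ : 0 < γ) (hγ1 : γ ≠ 1) {χ : ℕ → 𝕜} {f : ℝ → 𝕜} {c C : ℝ}
    (hχ : ∀ k, ‖χ k‖ ≤ c) (hfm : Measurable f)
    (hf : ∀ y ∈ Icc (thalerX γ 1) 1, ‖f y‖ ≤ C) : Measurable (thalerQ γ χ f) := by
  refine measurable_of_tendsto_metrizable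
    (f := fun N => (Icc (thalerX γ 1) 1).indicator fun y => ∑ k ∈ Finset.range N,
      (thalerP γ k y : 𝕜) * (χ k * f (thalerPsi γ k y))) (fun N => ?_) ?_
  · refine Measurable.indicator (Finset.measurable_sum _ fun k _ => ?_) measurableSet_Icc
    exact (RCLike.measurable_ofReal.comp (measurable_thalerP γ k)).mul
      (measurable_const.mul (hfm.comp (measurable_thalerPsi γ k)))
  · rw [tendsto_pi_nhds]
    intro y
    by_cases hy : y ∈ Icc (thalerX γ 1) 1
    · simp only [thalerQ, indicator_of_mem hy]
      exact (summable_thalerQ_term hγ hγ1 hχ hf hy).hasSum.tendsto_sum_nat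
    · simp only [thalerQ, indicator_of_notMem hy]
      exact tendsto_const_nhds

lemma thalerQ_ofReal (R : ℝ → ℝ) :
    thalerQ γ (fun _ => (1 : ℂ)) (fun y => (R y : ℂ)) =
      fun y => ((thalerQ γ (fun _ => (1 : ℝ)) R y : ℝ) : ℂ) := by
  ext y
  by_cases hy : y ∈ Icc (thalerX γ 1) 1
  · rw [thalerQ_apply hy, thalerQ_apply hy, Complex.ofReal_tsum]
    simp
  · simp [thalerQ, indicator_of_notMem hy]

lemma norm_le_of_monotoneOn_Icc {R : ℝ → ℝ} {a b : ℝ} (hR : MonotoneOn R (Icc a b)) {y : ℝ}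
    (hy : y ∈ Icc a b) : ‖R y‖ ≤ max |R a| |R b| := by
  have hab := hy.1.trans hy.2
  have h1 := hR ⟨le_rfl, hab⟩ hy hy.1
  have h2 := hR hy ⟨hab, le_rfl⟩ hy.2
  exact abs_le_max_abs_abs h1 h2

lemma tendsto_thalerS (hγ : 0 < γ) (hγ1 : γ ≠ 1) {y : ℝ} (hy : y ∈ Icc (thalerX γ 1) 1) :
    Tendsto (fun N => thalerS γ N y) atTop (𝓝 0) := by
  have := (hasSum_thalerP hγ hγ1 hy).tendsto_sum_nat.const_sub 1
  simpa [sum_thalerP] using this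

lemma tendsto_thalerTrunc (hγ : 0 < γ) (hγ1 : γ ≠ 1) {R : ℝ → ℝ}
    (hR : MonotoneOn R (Icc (thalerX γ 1) 1)) {y : ℝ} (hy : y ∈ Icc (thalerX γ 1) 1) :
    Tendsto (fun N => thalerTrunc γ R N y) atTop (𝓝 (thalerQ γ (fun _ => (1 : ℝ)) R y)) := by
  have h1 := (summable_thalerQ_term (χ := fun _ => (1 : ℝ)) (c := 1) hγ hγ1 (by simp)
    (fun y => norm_le_of_monotoneOn_Icc hR) hy).hasSum.tendsto_sum_nat
  have h2 := (tendsto_thalerS hγ hγ1 hy).mul_const (R (thalerX γ 1))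
  rw [thalerQ_apply hy]
  simpa [thalerTrunc] using h1.add h2

lemma monotoneOn_thalerQ (hγ : 0 < γ) (hγ1 : γ ≠ 1) {R : ℝ → ℝ}
    (hR : MonotoneOn R (Icc (thalerX γ 1) 1)) :
    MonotoneOn (thalerQ γ (fun _ => (1 : ℝ)) R) (Icc (thalerX γ 1) 1) :=
  fun _ hy _ hz hyz => le_of_tendsto_of_tendsto' (tendsto_thalerTrunc hγ hγ1 hR hy)
    (tendsto_thalerTrunc hγ hγ1 hR hz) fun N => (monotoneOn_thalerTrunc hγ hγ1 hR N).1
      (Icc_thalerX_subset hγ hγ1 hy) (Icc_thalerX_subset hγ hγ1 hz) hyz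

/-- The averaging operator contracts the oscillation of monotone functions. -/
lemma osc_thalerQ_le (hγ : 0 < γ) (hγ1 : γ ≠ 1) {R : ℝ → ℝ}
    (hR : MonotoneOn R (Icc (thalerX γ 1) 1)) :
    thalerQ γ (fun _ => (1 : ℝ)) R 1 - thalerQ γ (fun _ => (1 : ℝ)) R (thalerX γ 1) ≤
      (1 - thalerA γ 1) * (R 1 - R (thalerX γ 1)) := by
  have hI := thalerX_one_mem hγ hγ1
  have hX1 : thalerInv γ 1 = thalerX γ 1 := by rw [thalerX_succ, thalerX_zero]
  have h1 := (tendsto_thalerTrunc hγ hγ1 hR (one_mem_Icc_thalerX hγ hγ1)).comp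
    (tendsto_add_atTop_nat 1)
  have h2 := ((tendsto_thalerTrunc hγ hγ1 hR hI).const_mul (thalerA γ 1)).const_add
    ((1 - thalerA γ 1) * R (thalerInv γ (1 + 1)))
  have h3 := tendsto_nhds_unique h1 (h2.congr fun N => by
    rw [Function.comp_apply, thalerTrunc_succ, hX1])
  rw [one_add_one_eq_two, thalerInv_two hγ1] at h3
  have h4 : R (thalerX γ 1) ≤ thalerQ γ (fun _ => (1 : ℝ)) R (thalerX γ 1) := by
    rw [thalerQ_apply hI]
    have ha := (hasSum_thalerP hγ hγ1 hI).mul_right (R (thalerX γ 1))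
    rw [one_mul] at ha
    refine hasSum_le (fun k => ?_) ha (summable_thalerQ_term (χ := fun _ => (1 : ℝ)) (c := 1) hγ hγ1
      (by simp) (fun y => norm_le_of_monotoneOn_Icc hR) hI).hasSum
    have hI' := Icc_thalerX_subset hγ hγ1 hI
    have := thalerPsi_mem_Icc hγ hγ1 hI' k
    simp only [RCLike.ofReal_real_eq_id, id_eq, one_mul]
    exact mul_le_mul_of_nonneg_left (hR hI this this.1) (thalerP_nonneg hγ hγ1 hI' k)
  have h5 := thalerA_lt_one (γ := γ) one_pos
  nlinarith [mul_nonneg (sub_nonneg.2 h5.le) (sub_nonneg.2 h4)]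

end

section

variable {γ : ℝ} {𝕜 : Type*} [RCLike 𝕜]

lemma iUnion_Ioc_thalerX (hγ : 0 < γ) (hγ1 : γ ≠ 1) :
    ⋃ k, Ioc (thalerX γ (k + 1)) (thalerX γ k) = Ioc 0 1 := by
  refine Subset.antisymm (iUnion_subset fun k => Ioc_thalerX_subset hγ hγ1 k) fun y hy => ?_
  have hex : ∃ k, thalerX γ k < y := ((tendsto_thalerX hγ hγ1).eventually_lt_const hy.1).exists
  classical
  have hpos : Nat.find hex ≠ 0 := by
    intro h0
    have := Nat.find_spec hex
    rw [h0, thalerX_zero] at this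
    exact absurd hy.2 (not_le.2 this)
  obtain ⟨k, hk⟩ := Nat.exists_eq_succ_of_ne_zero hpos
  refine mem_iUnion.2 ⟨k, ?_, not_lt.1 (Nat.find_min hex (by omega))⟩
  have := Nat.find_spec hex
  rwa [hk] at this

lemma pairwise_disjoint_Ioc_thalerX (hγ : 0 < γ) (hγ1 : γ ≠ 1) :
    Pairwise (Function.onFun Disjoint fun k => Ioc (thalerX γ (k + 1)) (thalerX γ k)) :=
  (strictAnti_thalerX hγ hγ1).antitone.pairwise_disjoint_on_Ioc_succ

lemma hasSum_integral_thalerP {E : Type*} [NormedAddCommGroup E] [NormedSpace ℝ E]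
    [MeasurableSpace E] [BorelSpace E] [SecondCountableTopology E]
    (hγ : 0 < γ) (hγ1 : γ ≠ 1) {Φ : ℝ → E} {C : ℝ}
    (hΦm : Measurable Φ) (hΦ : ∀ y ∈ Icc (thalerX γ 1) 1, ‖Φ y‖ ≤ C) :
    HasSum (fun k => ∫ y, thalerP γ k y • Φ (thalerPsi γ k y) ∂thalerMuY γ (thalerX γ 1))
      (∫ y, Φ y ∂thalerMuY γ (thalerX γ 1)) := by
  have hInt : IntegrableOn (fun z : ℝ => (1 + z) ^ (-γ) • Φ (thalerInv γ (1 + z)))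
      (⋃ k, Ioc (thalerX γ (k + 1)) (thalerX γ k)) := by
    rw [iUnion_Ioc_thalerX hγ hγ1]
    refine Measure.integrableOn_of_bounded (M := C) measure_Ioc_lt_top.ne
      (Measurable.smul (by fun_prop) (hΦm.comp
        ((measurable_thalerInv γ).comp (measurable_const.add measurable_id)))).aestronglyMeasurable ?_
    filter_upwards [ae_restrict_mem measurableSet_Ioc] with z hz
    rw [norm_smul, norm_of_nonneg (rpow_nonneg (by linarith [hz.1]) _)]
    have h1 := hΦ _ (thalerPsi_mem_Icc hγ hγ1 hz 0)
    have h2 : (1 + z) ^ (-γ) ≤ 1 :=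
      rpow_le_one_of_one_le_of_nonpos (by linarith [hz.1]) (by linarith)
    exact (mul_le_of_le_one_left (norm_nonneg _) h2).trans h1
  have hs := hasSum_integral_iUnion (fun k => measurableSet_Ioc)
    (pairwise_disjoint_Ioc_thalerX hγ hγ1) hInt
  rw [iUnion_Ioc_thalerX hγ hγ1, ← setIntegral_thalerX_one hγ hγ1] at hs
  have hs' := hs.const_smul (thalerM γ)⁻¹
  rw [← integral_thalerMuY hγ hγ1] at hs'
  convert hs' using 2 with k
  rw [integral_thalerMuY hγ hγ1]
  congr 1
  have := setIntegral_thalerX_Ioc hγ hγ1 k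
    (fun z => (1 - thalerA γ z) • Φ (thalerInv γ (1 + z)))
  rw [setIntegral_congr_fun (g := fun z => (1 + z) ^ (-γ) • Φ (thalerInv γ (1 + z)))
    measurableSet_Ioc fun z hz => ?_] at this
  · rw [this]
    refine setIntegral_congr_fun measurableSet_Ioc fun z _ => ?_
    simp only [thalerP, thalerPsi, smul_smul]
  · simp only [smul_smul]
    rw [← one_sub_thalerA_mul_thalerH (Ioc_thalerX_subset hγ hγ1 k hz).1,
      mul_comm (thalerH γ z)]

lemma ae_mem_Icc_thalerMuY (γ : ℝ) :
    ∀ᵐ y ∂thalerMuY γ (thalerX γ 1), y ∈ Icc (thalerX γ 1) 1 :=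
  (ae_thalerMuY γ).mono fun _ hy => Ioc_subset_Icc_self hy

lemma hasSum_integral_thalerQ (hγ : 0 < γ) (hγ1 : γ ≠ 1) {χ : ℕ → 𝕜} {f : ℝ → 𝕜} {c C : ℝ}
    (hχ : ∀ k, ‖χ k‖ ≤ c) (hfm : Measurable f)
    (hf : ∀ y ∈ Icc (thalerX γ 1) 1, ‖f y‖ ≤ C) :
    HasSum (fun k => ∫ y, (thalerP γ k y : 𝕜) * (χ k * f (thalerPsi γ k y))
      ∂thalerMuY γ (thalerX γ 1)) (∫ y, thalerQ γ χ f y ∂thalerMuY γ (thalerX γ 1)) := by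
  have := isProbabilityMeasure_thalerMuY hγ hγ1
  refine hasSum_integral_of_dominated_convergence (fun k y => thalerP γ k y * (c * C))
    (fun k => ?_) (fun k => ?_) ?_ ?_ ?_
  · exact ((RCLike.measurable_ofReal.comp (measurable_thalerP γ k)).mul
      (measurable_const.mul (hfm.comp (measurable_thalerPsi γ k)))).aestronglyMeasurable
  · filter_upwards [ae_mem_Icc_thalerMuY γ] with y hy
    exact norm_thalerQ_term_le hγ hγ1 hχ hf hy k
  · filter_upwards [ae_mem_Icc_thalerMuY γ] with y hy
    exact (hasSum_thalerP hγ hγ1 hy).summable.mul_right _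
  · refine (integrable_const (1 * (c * C))).congr ?_
    filter_upwards [ae_mem_Icc_thalerMuY γ] with y hy
    exact ((hasSum_thalerP hγ hγ1 hy).mul_right _).tsum_eq.symm
  · filter_upwards [ae_mem_Icc_thalerMuY γ] with y hy
    rw [thalerQ_apply hy]
    exact (summable_thalerQ_term hγ hγ1 hχ hf hy).hasSum

/-- The averaging operator preserves the integral with respect to `μ_Y`. -/
lemma integral_thalerQ_one (hγ : 0 < γ) (hγ1 : γ ≠ 1) {f : ℝ → 𝕜} {C : ℝ} (hfm : Measurable f)
    (hf : ∀ y ∈ Icc (thalerX γ 1) 1, ‖f y‖ ≤ C) :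
    ∫ y, thalerQ γ (fun _ => (1 : 𝕜)) f y ∂thalerMuY γ (thalerX γ 1) =
      ∫ y, f y ∂thalerMuY γ (thalerX γ 1) := by
  have h1 := hasSum_integral_thalerQ (χ := fun _ => (1 : 𝕜)) (c := 1) hγ hγ1 (by simp) hfm hf
  have h2 := hasSum_integral_thalerP hγ hγ1 hfm hf
  simp only [one_mul] at h1
  simp only [RCLike.real_smul_eq_coe_mul] at h2
  exact h1.unique h2

lemma thalerX_one_eq (γ : ℝ) : thalerX γ 1 = thalerInv γ 1 := by rw [thalerX_succ, thalerX_zero]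

lemma thalerT_thalerInv (hγ : 0 < γ) (hγ1 : γ ≠ 1) {y : ℝ} (hy : y ∈ Ioc (0 : ℝ) 1) :
    thalerT γ (thalerX γ 1) (thalerInv γ y) = y := by
  have hy2 : y ∈ Ioc (0 : ℝ) 2 := ⟨hy.1, hy.2.trans one_le_two⟩
  rw [thalerT, if_neg (not_le.2 (thalerInv_mem hγ hγ1 hy2).1), if_pos, thalerG_thalerInv hγ hγ1 hy2]
  rw [thalerX_one_eq]; exact monotone_thalerInv γ hy.2

lemma thalerT_thalerInv_one_add (hγ : 0 < γ) (hγ1 : γ ≠ 1) {y : ℝ} (hy : y ∈ Ioc (0 : ℝ) 1) :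
    thalerT γ (thalerX γ 1) (thalerInv γ (1 + y)) = y := by
  have hy2 : 1 + y ∈ Ioc (0 : ℝ) 2 := ⟨by linarith [hy.1], by linarith [hy.2]⟩
  have : thalerX γ 1 < thalerInv γ (1 + y) := (thalerPsi_mem hγ hγ1 hy 0).1
  rw [thalerT, if_neg (not_le.2 (thalerInv_mem hγ hγ1 hy2).1), if_neg (not_le.2 this),
    thalerG_thalerInv hγ hγ1 hy2]
  ring

lemma iterate_thalerT_thalerPsi (hγ : 0 < γ) (hγ1 : γ ≠ 1) {y : ℝ} (hy : y ∈ Ioc (0 : ℝ) 1)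
    {j k : ℕ} (hjk : j ≤ k) :
    (thalerT γ (thalerX γ 1))^[j + 1] (thalerPsi γ k y) = (thalerInv γ)^[k - j] y := by
  rw [Function.iterate_succ_apply, thalerPsi,
    thalerT_thalerInv_one_add hγ hγ1 (iterate_thalerInv_mem hγ hγ1 hy k)]
  induction j with
  | zero => rfl
  | succ j ih =>
    rw [Function.iterate_succ_apply', ih (by omega), show k - j = (k - (j + 1)) + 1 by omega,
      Function.iterate_succ_apply', thalerT_thalerInv hγ hγ1 (iterate_thalerInv_mem hγ hγ1 hy _)]

lemma thalerTau_thalerPsi (hγ : 0 < γ) (hγ1 : γ ≠ 1) {y : ℝ} (hy : y ∈ Ioc (thalerX γ 1) 1)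
    (k : ℕ) : thalerTau γ (thalerX γ 1) (thalerPsi γ k y) = k + 1 := by
  have hy' := Icc_thalerX_subset hγ hγ1 (Ioc_subset_Icc_self hy)
  refine IsLeast.csInf_eq ⟨⟨by omega, ?_⟩, ?_⟩
  · rw [iterate_thalerT_thalerPsi hγ hγ1 hy' le_rfl]; simpa using hy
  · rintro n ⟨hn, hnY⟩
    by_contra hlt
    obtain ⟨j, rfl⟩ : ∃ j, n = j + 1 := ⟨n - 1, by omega⟩
    rw [iterate_thalerT_thalerPsi hγ hγ1 hy' (by omega),
      show k - j = (k - j - 1) + 1 by omega, Function.iterate_succ_apply'] at hnY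
    refine absurd hnY.1 (not_lt.2 ?_)
    rw [thalerX_one_eq]
    exact monotone_thalerInv γ (iterate_thalerInv_mem hγ hγ1 hy' _).2

lemma thalerF_thalerPsi (hγ : 0 < γ) (hγ1 : γ ≠ 1) {y : ℝ} (hy : y ∈ Ioc (thalerX γ 1) 1)
    (k : ℕ) : thalerF γ (thalerX γ 1) (thalerPsi γ k y) = y := by
  have hy' := Icc_thalerX_subset hγ hγ1 (Ioc_subset_Icc_self hy)
  rw [thalerF, thalerTau_thalerPsi hγ hγ1 hy, iterate_thalerT_thalerPsi hγ hγ1 hy' le_rfl]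
  simp

lemma measurable_thalerT (γ xs : ℝ) : Measurable (thalerT γ xs) := by
  have hG : Measurable (thalerG γ) := by unfold thalerG; fun_prop
  exact Measurable.ite measurableSet_Iic measurable_const
    (Measurable.ite measurableSet_Iic hG (hG.sub_const 1))

lemma measurable_thalerTau (γ xs : ℝ) : Measurable (thalerTau γ xs) := by
  have hm : ∀ n, MeasurableSet {y | (thalerT γ xs)^[n] y ∈ Ioc xs 1} := fun n =>
    (measurable_thalerT γ xs).iterate n measurableSet_Ioc
  have hex : Measurable fun y => sInf {n : ℕ | 1 ≤ n ∧ (thalerT γ xs)^[n] y ∈ Ioc xs 1} := by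
    refine measurable_to_countable' fun n => ?_
    rcases Nat.eq_zero_or_pos n with rfl | hn
    · have : (fun y => sInf {n : ℕ | 1 ≤ n ∧ (thalerT γ xs)^[n] y ∈ Ioc xs 1}) ⁻¹' {0} =
          ⋂ n : ℕ, {y | 1 ≤ n → ¬ (thalerT γ xs)^[n] y ∈ Ioc xs 1} := by
        ext y
        simp only [mem_preimage, mem_singleton_iff, mem_iInter, mem_ofPred_eq, Nat.sInf_eq_zero]
        constructor
        · rintro (h | h) m hm1 hm2
          · exact absurd h.1 (by norm_num)
          · exact (h ▸ (⟨hm1, hm2⟩ : m ∈ {n : ℕ | 1 ≤ n ∧ (thalerT γ xs)^[n] y ∈ Ioc xs 1}) :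
              m ∈ (∅ : Set ℕ))
        · intro h
          exact Or.inr (eq_empty_of_forall_notMem fun m hm => h m hm.1 hm.2)
      rw [this]
      refine MeasurableSet.iInter fun m => ?_
      by_cases h1 : 1 ≤ m
      · simp only [h1, forall_true_left]; exact (hm m).compl
      · simp [h1]
    · have : (fun y => sInf {n : ℕ | 1 ≤ n ∧ (thalerT γ xs)^[n] y ∈ Ioc xs 1}) ⁻¹' {n} =
          {y | (thalerT γ xs)^[n] y ∈ Ioc xs 1} ∩
            ⋂ m : ℕ, {y | 1 ≤ m ∧ m < n → ¬ (thalerT γ xs)^[m] y ∈ Ioc xs 1} := by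
        ext y
        simp only [mem_preimage, mem_singleton_iff, mem_inter_iff, mem_iInter]
        constructor
        · rintro rfl
          have hs := Nat.sInf_mem (Nat.nonempty_of_pos_sInf hn)
          exact ⟨hs.2, fun m hm1 hm2 => Nat.notMem_of_lt_sInf hm1.2 ⟨hm1.1, hm2⟩⟩
        · rintro ⟨h1, h2⟩
          refine IsLeast.csInf_eq ⟨⟨hn, h1⟩, fun m hm1 => ?_⟩
          by_contra hlt
          exact h2 m ⟨hm1.1, not_le.1 hlt⟩ hm1.2
      rw [this]
      refine (hm n).inter (MeasurableSet.iInter fun m => ?_)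
      by_cases h1 : 1 ≤ m ∧ m < n
      · simp only [h1, forall_true_left, and_self]; exact (hm m).compl
      · simp [h1]
  exact hex

lemma measurable_thalerF (γ xs : ℝ) : Measurable (thalerF γ xs) := by
  have h : Measurable fun p : ℕ × ℝ => (thalerT γ xs)^[p.1] p.2 :=
    measurable_from_prod_countable_right fun n => (measurable_thalerT γ xs).iterate n
  exact h.comp ((measurable_thalerTau γ xs).prodMk measurable_id)

/-- Duality between the first return map and the twisted transfer operator. -/
lemma integral_thalerF_mul (hγ : 0 < γ) (hγ1 : γ ≠ 1) {χ : ℕ → 𝕜} {f G : ℝ → 𝕜} {C : ℝ}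
    (hχ : ∀ k, ‖χ k‖ ≤ 1) (hfm : Measurable f) (hf : ∀ y ∈ Icc (thalerX γ 1) 1, ‖f y‖ ≤ C)
    (hGm : Measurable G) (hG : ∀ y, ‖G y‖ ≤ 1) :
    ∫ y, χ (thalerTau γ (thalerX γ 1) y) * G (thalerF γ (thalerX γ 1) y) * f y
        ∂thalerMuY γ (thalerX γ 1) =
      ∫ y, G y * thalerQ γ (fun k => χ (k + 1)) f y ∂thalerMuY γ (thalerX γ 1) := by
  have hm : Measurable fun y =>
      χ (thalerTau γ (thalerX γ 1) y) * G (thalerF γ (thalerX γ 1) y) * f y :=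
    (((measurable_of_countable χ).comp (measurable_thalerTau γ _)).mul
      (hGm.comp (measurable_thalerF γ _))).mul hfm
  rw [← integral_thalerQ_one (C := C) hγ hγ1 hm]
  · refine integral_congr_ae ?_
    filter_upwards [ae_thalerMuY γ] with y hy
    have hyI := Ioc_subset_Icc_self hy
    rw [thalerQ_apply hyI, thalerQ_apply hyI, ← tsum_mul_left]
    refine tsum_congr fun k => ?_
    rw [thalerTau_thalerPsi hγ hγ1 hy, thalerF_thalerPsi hγ hγ1 hy]
    ring
  · intro y hy
    rw [norm_mul, norm_mul]
    have := mul_le_mul (hχ (thalerTau γ (thalerX γ 1) y)) (hG (thalerF γ (thalerX γ 1) y))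
      (norm_nonneg _) zero_le_one
    rw [one_mul] at this
    exact (mul_le_of_le_one_left (norm_nonneg _) this).trans (hf y hy)

end

section

variable {γ : ℝ} {𝕜 : Type*} [RCLike 𝕜]

lemma thalerQ_add (hγ : 0 < γ) (hγ1 : γ ≠ 1) {χ : ℕ → 𝕜} {f g : ℝ → 𝕜} {c C D : ℝ}
    (hχ : ∀ k, ‖χ k‖ ≤ c) (hf : ∀ y ∈ Icc (thalerX γ 1) 1, ‖f y‖ ≤ C)
    (hg : ∀ y ∈ Icc (thalerX γ 1) 1, ‖g y‖ ≤ D) :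
    thalerQ γ χ (fun y => f y + g y) = fun y => thalerQ γ χ f y + thalerQ γ χ g y := by
  ext y
  by_cases hy : y ∈ Icc (thalerX γ 1) 1
  · rw [thalerQ_apply hy, thalerQ_apply hy, thalerQ_apply hy,
      ← (summable_thalerQ_term hγ hγ1 hχ hf hy).tsum_add (summable_thalerQ_term hγ hγ1 hχ hg hy)]
    exact tsum_congr fun k => by ring
  · simp [thalerQ, indicator_of_notMem hy]

lemma thalerQ_const_mul {χ : ℕ → 𝕜} {f : ℝ → 𝕜} (a : 𝕜) :
    thalerQ γ χ (fun y => a * f y) = fun y => a * thalerQ γ χ f y := by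
  ext y
  by_cases hy : y ∈ Icc (thalerX γ 1) 1
  · rw [thalerQ_apply hy, thalerQ_apply hy, ← tsum_mul_left]
    exact tsum_congr fun k => by ring
  · simp [thalerQ, indicator_of_notMem hy]

lemma thalerQ_one_const (hγ : 0 < γ) (hγ1 : γ ≠ 1) (a : 𝕜) {y : ℝ}
    (hy : y ∈ Icc (thalerX γ 1) 1) : thalerQ γ (fun _ => (1 : 𝕜)) (fun _ => a) y = a := by
  rw [thalerQ_apply hy]
  have := (RCLike.hasSum_ofReal (𝕜 := 𝕜)).2 (hasSum_thalerP hγ hγ1 hy)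
  have := this.mul_right (1 * a)
  simpa using this.tsum_eq

lemma integrable_thalerMuY (hγ : 0 < γ) (hγ1 : γ ≠ 1) {f : ℝ → 𝕜} {C : ℝ} (hfm : Measurable f)
    (hf : ∀ y ∈ Icc (thalerX γ 1) 1, ‖f y‖ ≤ C) : Integrable f (thalerMuY γ (thalerX γ 1)) := by
  have := isProbabilityMeasure_thalerMuY hγ hγ1
  exact Integrable.of_bound hfm.aestronglyMeasurable C
    ((ae_mem_Icc_thalerMuY γ).mono fun y hy => hf y hy)

/-- `r - ∫ r` is, up to arbitrarily small uniform errors, a coboundary `u - Q u` of the averaging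
operator with transfer function `u` bounded by `C`. -/
def IsThalerCoboundary (γ : ℝ) (r : ℝ → ℂ) (C : ℝ) : Prop :=
  Integrable r (thalerMuY γ (thalerX γ 1)) ∧ ∀ ε > 0, ∃ u : ℝ → ℂ, Measurable u ∧
    (∀ y ∈ Icc (thalerX γ 1) 1, ‖u y‖ ≤ C) ∧ ∀ y ∈ Icc (thalerX γ 1) 1,
      ‖(r y - ∫ x, r x ∂thalerMuY γ (thalerX γ 1)) -
        (u y - thalerQ γ (fun _ => (1 : ℂ)) u y)‖ ≤ ε

lemma IsThalerCoboundary.add (hγ : 0 < γ) (hγ1 : γ ≠ 1) {r s : ℝ → ℂ} {C D : ℝ}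
    (hr : IsThalerCoboundary γ r C) (hs : IsThalerCoboundary γ s D) :
    IsThalerCoboundary γ (fun y => r y + s y) (C + D) := by
  refine ⟨hr.1.add hs.1, fun ε hε => ?_⟩
  obtain ⟨u, hum, hu, hu'⟩ := hr.2 (ε / 2) (half_pos hε)
  obtain ⟨v, hvm, hv, hv'⟩ := hs.2 (ε / 2) (half_pos hε)
  refine ⟨fun y => u y + v y, hum.add hvm,
    fun y hy => (norm_add_le _ _).trans (add_le_add (hu y hy) (hv y hy)), fun y hy => ?_⟩
  rw [thalerQ_add (c := 1) hγ hγ1 (by simp) hu hv, integral_add hr.1 hs.1]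
  calc _ = ‖_ + _‖ := by congr 1; ring
    _ ≤ ε / 2 + ε / 2 := (norm_add_le _ _).trans (add_le_add (hu' y hy) (hv' y hy))
    _ = ε := by ring

lemma IsThalerCoboundary.const_mul {r : ℝ → ℂ} {C : ℝ}
    (hr : IsThalerCoboundary γ r C) (a : ℂ) :
    IsThalerCoboundary γ (fun y => a * r y) (‖a‖ * C) := by
  refine ⟨hr.1.const_mul a, fun ε hε => ?_⟩
  have ha : 0 < ‖a‖ + 1 := by positivity
  obtain ⟨u, hum, hu, hu'⟩ := hr.2 (ε / (‖a‖ + 1)) (div_pos hε ha)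
  refine ⟨fun y => a * u y, hum.const_mul a, fun y hy => ?_, fun y hy => ?_⟩
  · rw [norm_mul]; exact mul_le_mul_of_nonneg_left (hu y hy) (norm_nonneg _)
  · rw [thalerQ_const_mul, integral_const_mul]
    calc _ = ‖a * ((r y - ∫ x, r x ∂thalerMuY γ (thalerX γ 1)) -
          (u y - thalerQ γ (fun _ => (1 : ℂ)) u y))‖ := by congr 1; ring
      _ ≤ ‖a‖ * (ε / (‖a‖ + 1)) := by
        rw [norm_mul]; exact mul_le_mul_of_nonneg_left (hu' y hy) (norm_nonneg _)
      _ ≤ ε := by rw [mul_div_assoc', div_le_iff₀ ha]; nlinarith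

lemma isThalerCoboundary_const (hγ : 0 < γ) (hγ1 : γ ≠ 1) (a : ℂ) :
    IsThalerCoboundary γ (fun _ => a) 0 := by
  have := isProbabilityMeasure_thalerMuY hγ hγ1
  refine ⟨integrable_const a, fun ε hε => ⟨fun _ => 0, measurable_const, by simp, fun y hy => ?_⟩⟩
  rw [thalerQ_one_const hγ hγ1 _ hy]
  simpa using hε.le

lemma IsThalerCoboundary.mono {r : ℝ → ℂ} {C D : ℝ} (hr : IsThalerCoboundary γ r C) (h : C ≤ D) :
    IsThalerCoboundary γ r D := by
  refine ⟨hr.1, fun ε hε => ?_⟩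
  obtain ⟨u, hum, hu, hu'⟩ := hr.2 ε hε
  exact ⟨u, hum, fun y hy => (hu y hy).trans h, hu'⟩

lemma isThalerCoboundary_of_approx (hγ : 0 < γ) (hγ1 : γ ≠ 1) {r : ℝ → ℂ} {C : ℝ}
    (hr : Integrable r (thalerMuY γ (thalerX γ 1)))
    (h : ∀ ε > 0, ∃ s, IsThalerCoboundary γ s C ∧ ∀ y ∈ Icc (thalerX γ 1) 1, ‖r y - s y‖ ≤ ε) :
    IsThalerCoboundary γ r C := by
  have := isProbabilityMeasure_thalerMuY hγ hγ1
  refine ⟨hr, fun ε hε => ?_⟩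
  obtain ⟨s, hs, hrs⟩ := h (ε / 3) (by positivity)
  obtain ⟨u, hum, hu, hu'⟩ := hs.2 (ε / 3) (by positivity)
  refine ⟨u, hum, hu, fun y hy => ?_⟩
  have hInt : ‖∫ x, (r x - s x) ∂thalerMuY γ (thalerX γ 1)‖ ≤ ε / 3 := by
    have := norm_integral_le_of_norm_le_const (μ := thalerMuY γ (thalerX γ 1))
      ((ae_mem_Icc_thalerMuY γ).mono fun y hy => hrs y hy)
    simpa using this
  rw [integral_sub hr hs.1] at hInt
  calc _ = ‖(r y - s y) - (∫ x, r x ∂thalerMuY γ (thalerX γ 1) - ∫ x, s x ∂thalerMuY γ (thalerX γ 1))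
        + ((s y - ∫ x, s x ∂thalerMuY γ (thalerX γ 1)) -
        (u y - thalerQ γ (fun _ => (1 : ℂ)) u y))‖ := by congr 1; ring
    _ ≤ ε / 3 + ε / 3 + ε / 3 :=
      (norm_add_le _ _).trans (add_le_add ((norm_sub_le _ _).trans (add_le_add (hrs y hy) hInt))
        (hu' y hy))
    _ = ε := by ring

lemma abs_sub_integral_le (hγ : 0 < γ) (hγ1 : γ ≠ 1) {R : ℝ → ℝ} (hRm : Measurable R)
    (hR : MonotoneOn R (Icc (thalerX γ 1) 1)) {y : ℝ} (hy : y ∈ Icc (thalerX γ 1) 1) :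
    |R y - ∫ x, R x ∂thalerMuY γ (thalerX γ 1)| ≤ R 1 - R (thalerX γ 1) := by
  have := isProbabilityMeasure_thalerMuY hγ hγ1
  have hInt : Integrable R (thalerMuY γ (thalerX γ 1)) :=
    integrable_thalerMuY hγ hγ1 hRm fun y hy => norm_le_of_monotoneOn_Icc hR hy
  have hlo : ∀ {x}, x ∈ Icc (thalerX γ 1) 1 → R (thalerX γ 1) ≤ R x := fun hx =>
    hR (thalerX_one_mem hγ hγ1) hx hx.1
  have hhi : ∀ {x}, x ∈ Icc (thalerX γ 1) 1 → R x ≤ R 1 := fun hx =>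
    hR hx (one_mem_Icc_thalerX hγ hγ1) hx.2
  have h1 : R (thalerX γ 1) ≤ ∫ x, R x ∂thalerMuY γ (thalerX γ 1) := by
    simpa using integral_mono_ae (integrable_const (R (thalerX γ 1))) hInt
      ((ae_mem_Icc_thalerMuY γ).mono fun x hx => hlo hx)
  have h2 : ∫ x, R x ∂thalerMuY γ (thalerX γ 1) ≤ R 1 := by
    simpa using integral_mono_ae hInt (integrable_const (R 1))
      ((ae_mem_Icc_thalerMuY γ).mono fun x hx => hhi hx)
  rw [abs_le]
  constructor <;> linarith [hlo hy, hhi hy]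

lemma iterate_thalerQ_monotone (hγ : 0 < γ) (hγ1 : γ ≠ 1) {R : ℝ → ℝ} (hRm : Measurable R)
    (hR : MonotoneOn R (Icc (thalerX γ 1) 1)) (m : ℕ) :
    Measurable ((thalerQ γ (fun _ => (1 : ℝ)))^[m] R) ∧
    MonotoneOn ((thalerQ γ (fun _ => (1 : ℝ)))^[m] R) (Icc (thalerX γ 1) 1) ∧
    (thalerQ γ (fun _ => (1 : ℝ)))^[m] R 1 - (thalerQ γ (fun _ => (1 : ℝ)))^[m] R (thalerX γ 1) ≤
      (1 - thalerA γ 1) ^ m * (R 1 - R (thalerX γ 1)) ∧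
    ∫ x, (thalerQ γ (fun _ => (1 : ℝ)))^[m] R x ∂thalerMuY γ (thalerX γ 1) =
      ∫ x, R x ∂thalerMuY γ (thalerX γ 1) := by
  induction m with
  | zero => simpa using ⟨hRm, hR⟩
  | succ m ih =>
    obtain ⟨h1, h2, h3, h4⟩ := ih
    rw [Function.iterate_succ_apply']
    have hb := fun y hy => norm_le_of_monotoneOn_Icc h2 (y := y) hy
    refine ⟨measurable_thalerQ (c := 1) hγ hγ1 (by simp) h1 hb, monotoneOn_thalerQ hγ hγ1 h2,
      (osc_thalerQ_le hγ hγ1 h2).trans ?_, (integral_thalerQ_one hγ hγ1 h1 hb).trans h4⟩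
    rw [pow_succ', mul_assoc]
    exact mul_le_mul_of_nonneg_left h3 (sub_nonneg.2 (thalerA_le_one zero_le_one))

lemma isThalerCoboundary_of_monotoneOn (hγ : 0 < γ) (hγ1 : γ ≠ 1) {R : ℝ → ℝ} {D : ℝ}
    (hRm : Measurable R) (hR : MonotoneOn R (Icc (thalerX γ 1) 1))
    (hD : R 1 - R (thalerX γ 1) ≤ D) :
    IsThalerCoboundary γ (fun y => (R y : ℂ)) (D / thalerA γ 1) := by
  have hA1 := thalerA_pos (γ := γ) zero_le_one
  have hκ0 : 0 ≤ 1 - thalerA γ 1 := sub_nonneg.2 (thalerA_le_one zero_le_one)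
  have hκ1 : 1 - thalerA γ 1 < 1 := by linarith
  have hosc : 0 ≤ R 1 - R (thalerX γ 1) :=
    sub_nonneg.2 (hR (thalerX_one_mem hγ hγ1) (one_mem_Icc_thalerX hγ hγ1)
      (thalerX_one_mem hγ hγ1).2)
  set c := ∫ x, R x ∂thalerMuY γ (thalerX γ 1) with hc
  have hbd : ∀ m, ∀ y ∈ Icc (thalerX γ 1) 1,
      ‖(thalerQ γ (fun _ => (1 : ℝ)))^[m] R y + -c‖ ≤ (1 - thalerA γ 1) ^ m * D := by
    intro m y hy
    obtain ⟨h1, h2, h3, h4⟩ := iterate_thalerQ_monotone hγ hγ1 hRm hR m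
    have := abs_sub_integral_le hγ hγ1 h1 h2 hy
    rw [h4, sub_eq_add_neg] at this
    exact (this.trans h3).trans (mul_le_mul_of_nonneg_left hD (pow_nonneg hκ0 m))
  have hex : ∀ m, ∃ U : ℝ → ℝ, Measurable U ∧
      (∀ y ∈ Icc (thalerX γ 1) 1, ‖U y‖ ≤ D * ∑ j ∈ Finset.range m, (1 - thalerA γ 1) ^ j) ∧
      ∀ y ∈ Icc (thalerX γ 1) 1, U y - thalerQ γ (fun _ => (1 : ℝ)) U y =
        R y - (thalerQ γ (fun _ => (1 : ℝ)))^[m] R y := by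
    intro m
    induction m with
    | zero =>
      refine ⟨fun _ => 0, measurable_const, by simp, fun y hy => ?_⟩
      rw [thalerQ_one_const hγ hγ1 _ hy]; simp
    | succ m ih =>
      obtain ⟨U, hUm, hU, hU'⟩ := ih
      obtain ⟨h1, h2, h3, h4⟩ := iterate_thalerQ_monotone hγ hγ1 hRm hR m
      refine ⟨fun y => U y + ((thalerQ γ (fun _ => (1 : ℝ)))^[m] R y + -c),
        hUm.add (h1.add_const _), fun y hy => ?_, fun y hy => ?_⟩
      · rw [Finset.sum_range_succ, mul_add, mul_comm D (_ ^ _)]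
        exact (norm_add_le _ _).trans (add_le_add (hU y hy) (hbd m y hy))
      · have hone : ∀ k : ℕ, ‖(fun _ => (1 : ℝ)) k‖ ≤ 1 := by simp
        rw [thalerQ_add (c := 1) hγ hγ1 hone hU (hbd m), thalerQ_add (c := 1) hγ hγ1 hone
          (fun y => norm_le_of_monotoneOn_Icc h2) (fun _ _ => le_rfl)]
        dsimp only
        rw [thalerQ_one_const hγ hγ1 _ hy, Function.iterate_succ_apply']
        linarith [hU' y hy]
  refine ⟨(integrable_thalerMuY hγ hγ1 hRm fun y hy => norm_le_of_monotoneOn_Icc hR hy).ofReal,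
    fun ε hε => ?_⟩
  have hlim := (tendsto_pow_atTop_nhds_zero_of_lt_one hκ0 hκ1).mul_const D
  rw [zero_mul] at hlim
  obtain ⟨m, hm⟩ := (hlim.eventually_lt_const hε).exists
  obtain ⟨U, hUm, hU, hU'⟩ := hex m
  refine ⟨fun y => (U y : ℂ), Complex.measurable_ofReal.comp hUm, fun y hy => ?_, fun y hy => ?_⟩
  · rw [Complex.norm_real]
    refine (hU y hy).trans ?_
    rw [div_eq_mul_inv]
    refine mul_le_mul_of_nonneg_left ?_ (hosc.trans hD)
    have hg := (summable_geometric_of_lt_one hκ0 hκ1).sum_le_tsum (Finset.range m)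
      (fun i _ => pow_nonneg hκ0 i)
    rwa [tsum_geometric_of_lt_one hκ0 hκ1, sub_sub_cancel] at hg
  · simp only [thalerQ_ofReal]
    rw [integral_complex_ofReal, ← hc, ← Complex.ofReal_sub, ← Complex.ofReal_sub,
      ← Complex.ofReal_sub, hU' y hy, Complex.norm_real]
    refine le_trans (le_of_eq ?_) ((hbd m y hy).trans hm.le)
    congr 1; ring

end

section

variable {γ : ℝ}

lemma one_sub_thalerA_iterate_mono (hγ : 0 < γ) (hγ1 : γ ≠ 1) (k : ℕ) {y z : ℝ}
    (hy : y ∈ Ioc (0 : ℝ) 1) (hz : z ∈ Ioc (0 : ℝ) 1) (hyz : y ≤ z) :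
    1 - thalerA γ ((thalerInv γ)^[k] y) ≤ 1 - thalerA γ ((thalerInv γ)^[k] z) :=
  sub_le_sub_left (antitoneOn_thalerA hγ (iterate_thalerInv_mem hγ hγ1 hy k).1.le
    (iterate_thalerInv_mem hγ hγ1 hz k).1.le ((monotone_thalerInv γ).iterate k hyz)) 1

lemma one_sub_thalerA_iterate_nonneg (hγ : 0 < γ) (hγ1 : γ ≠ 1) (k : ℕ) {y : ℝ}
    (hy : y ∈ Ioc (0 : ℝ) 1) : 0 ≤ 1 - thalerA γ ((thalerInv γ)^[k] y) :=
  sub_nonneg.2 (thalerA_le_one (iterate_thalerInv_mem hγ hγ1 hy k).1.le)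

lemma thalerS_le_thalerX_one (hγ : 0 < γ) (hγ1 : γ ≠ 1) (k : ℕ) {y : ℝ}
    (hy : y ∈ Icc (thalerX γ 1) 1) : thalerS γ k y ≤ thalerS γ k (thalerX γ 1) :=
  antitoneOn_thalerS hγ hγ1 k (thalerX_mem hγ hγ1 1) (Icc_thalerX_subset hγ hγ1 hy) hy.1

lemma thalerP_le_thalerB (hγ : 0 < γ) (hγ1 : γ ≠ 1) (k : ℕ) {y : ℝ}
    (hy : y ∈ Icc (thalerX γ 1) 1) : thalerP γ k y ≤ thalerB γ k := by
  have hy' := Icc_thalerX_subset hγ hγ1 hy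
  exact mul_le_mul (thalerS_le_thalerX_one hγ hγ1 k hy)
    (one_sub_thalerA_iterate_mono hγ hγ1 k hy' ⟨one_pos, le_rfl⟩ hy.2)
    (one_sub_thalerA_iterate_nonneg hγ hγ1 k hy')
    (thalerS_nonneg hγ hγ1 (thalerX_mem hγ hγ1 1) k)

lemma isThalerCoboundary_thalerP (hγ : 0 < γ) (hγ1 : γ ≠ 1) (k : ℕ) :
    IsThalerCoboundary γ (fun y => (thalerP γ k y : ℂ)) (2 * thalerB γ k / thalerA γ 1) := by
  have hsub := Icc_thalerX_subset hγ hγ1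
  have hS0 := thalerS_nonneg hγ hγ1 (thalerX_mem hγ hγ1 1) k
  have h1I := one_mem_Icc_thalerX hγ hγ1
  have hXI := thalerX_one_mem hγ hγ1
  have hmeas : Measurable fun y => 1 - thalerA γ ((thalerInv γ)^[k] y) :=
    measurable_const.sub ((measurable_thalerA γ).comp ((measurable_thalerInv γ).iterate k))
  have h1 := isThalerCoboundary_of_monotoneOn (D := thalerB γ k) hγ hγ1
    (R := fun y => thalerS γ k (thalerX γ 1) * (1 - thalerA γ ((thalerInv γ)^[k] y)))
    (measurable_const.mul hmeas)
    (fun y hy z hz hyz => mul_le_mul_of_nonneg_left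
      (one_sub_thalerA_iterate_mono hγ hγ1 k (hsub hy) (hsub hz) hyz) hS0)
    (sub_le_self _ (mul_nonneg hS0 (one_sub_thalerA_iterate_nonneg hγ hγ1 k (hsub hXI))))
  have h2 := isThalerCoboundary_of_monotoneOn (D := thalerB γ k) hγ hγ1
    (R := fun y => (thalerS γ k (thalerX γ 1) - thalerS γ k y) *
      (1 - thalerA γ ((thalerInv γ)^[k] y)))
    ((measurable_const.sub (measurable_thalerS γ k)).mul hmeas)
    (fun y hy z hz hyz => mul_le_mul
      (sub_le_sub_left (antitoneOn_thalerS hγ hγ1 k (hsub hy) (hsub hz) hyz) _)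
      (one_sub_thalerA_iterate_mono hγ hγ1 k (hsub hy) (hsub hz) hyz)
      (one_sub_thalerA_iterate_nonneg hγ hγ1 k (hsub hy))
      (sub_nonneg.2 (thalerS_le_thalerX_one hγ hγ1 k hz)))
    (by
      rw [sub_self, zero_mul, sub_zero]
      exact mul_le_mul_of_nonneg_right
        (sub_le_self _ (thalerS_nonneg hγ hγ1 (hsub h1I) k))
        (one_sub_thalerA_iterate_nonneg hγ hγ1 k (hsub h1I)))
  have h3 := h1.add hγ hγ1 (h2.const_mul (-1))
  convert h3 using 1
  · ext y
    simp only [thalerP]; push_cast; ring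
  · simp; ring

lemma summable_thalerB (hγ : 0 < γ) (hγ1 : γ ≠ 1) : Summable (thalerB γ) := by
  obtain ⟨C, hC, h⟩ := exists_thalerB_le hγ hγ1
  refine Summable.of_nonneg_of_le (thalerB_nonneg hγ hγ1) h (Summable.mul_left _ ?_)
  have := (summable_nat_add_iff 1).2 (Real.summable_nat_rpow.2
    (show -(1 + γ⁻¹) < -1 by have := inv_pos.2 hγ; linarith))
  simpa using this

lemma summable_thalerB_mul (hγ : 0 < γ) (hγ1 : γ ≠ 1) {χ : ℕ → ℂ} (hχ : ∀ k, ‖χ k‖ ≤ 1) :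
    Summable fun k => thalerB γ k * ‖χ k - 1‖ := by
  refine Summable.of_nonneg_of_le (fun k => mul_nonneg (thalerB_nonneg hγ hγ1 k) (norm_nonneg _))
    (fun k => mul_le_mul_of_nonneg_left ?_ (thalerB_nonneg hγ hγ1 k))
    ((summable_thalerB hγ hγ1).mul_right 2)
  refine (norm_sub_le _ _).trans ?_
  rw [norm_one]; linarith [hχ k]

/-- The size of the perturbation of the averaging operator caused by the weight `χ`. -/
def thalerD (γ : ℝ) (χ : ℕ → ℂ) : ℝ := ∑' k, thalerB γ k * ‖χ k - 1‖

lemma thalerD_nonneg (hγ : 0 < γ) (hγ1 : γ ≠ 1) (χ : ℕ → ℂ) : 0 ≤ thalerD γ χ :=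
  tsum_nonneg fun k => mul_nonneg (thalerB_nonneg hγ hγ1 k) (norm_nonneg _)

lemma norm_thalerQ_sub_le (hγ : 0 < γ) (hγ1 : γ ≠ 1) {χ : ℕ → ℂ} (hχ : ∀ k, ‖χ k‖ ≤ 1)
    {f : ℝ → ℂ} {C : ℝ} (hf : ∀ y ∈ Icc (thalerX γ 1) 1, ‖f y‖ ≤ C) {y : ℝ}
    (hy : y ∈ Icc (thalerX γ 1) 1) :
    ‖thalerQ γ χ f y - thalerQ γ (fun _ => (1 : ℂ)) f y‖ ≤ thalerD γ χ * C := by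
  have hy' := Icc_thalerX_subset hγ hγ1 hy
  rw [thalerQ_apply hy, thalerQ_apply hy,
    ← (summable_thalerQ_term hγ hγ1 hχ hf hy).tsum_sub
      (summable_thalerQ_term (c := 1) hγ hγ1 (by simp) hf hy)]
  refine tsum_of_norm_bounded ((summable_thalerB_mul hγ hγ1 hχ).hasSum.mul_right C) fun k => ?_
  rw [← mul_sub, ← sub_mul, norm_mul, norm_mul, ← mul_assoc]
  have hP : ‖(RCLike.ofReal (thalerP γ k y) : ℂ)‖ ≤ thalerB γ k := by
    rw [RCLike.norm_ofReal, abs_of_nonneg (thalerP_nonneg hγ hγ1 hy' k)]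
    exact thalerP_le_thalerB hγ hγ1 k hy
  exact mul_le_mul (mul_le_mul_of_nonneg_right hP (norm_nonneg _))
    (hf _ (thalerPsi_mem_Icc hγ hγ1 hy' k)) (norm_nonneg _)
    (mul_nonneg (thalerB_nonneg hγ hγ1 k) (norm_nonneg _))

lemma isThalerCoboundary_thalerQ (hγ : 0 < γ) (hγ1 : γ ≠ 1) {χ : ℕ → ℂ} (hχ : ∀ k, ‖χ k‖ ≤ 1) :
    IsThalerCoboundary γ (thalerQ γ χ fun _ => 1) (2 * thalerD γ χ / thalerA γ 1) := by
  have hA1 := thalerA_pos (γ := γ) zero_le_one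
  have hone : ∀ y ∈ Icc (thalerX γ 1) 1, ‖(fun _ => (1 : ℂ)) y‖ ≤ 1 := by simp
  have hB := summable_thalerB_mul hγ hγ1 hχ
  refine isThalerCoboundary_of_approx hγ hγ1
    (integrable_thalerMuY hγ hγ1 (measurable_thalerQ hγ hγ1 hχ measurable_const hone)
      fun y => norm_thalerQ_le hγ hγ1 hχ hone) fun ε hε => ?_
  have hfin : ∀ N, IsThalerCoboundary γ
      (fun y => 1 + ∑ k ∈ Finset.range N, (χ k - 1) * (thalerP γ k y : ℂ))
      (∑ k ∈ Finset.range N, ‖χ k - 1‖ * (2 * thalerB γ k / thalerA γ 1)) := by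
    intro N
    induction N with
    | zero => simpa using isThalerCoboundary_const hγ hγ1 1
    | succ N ih =>
      have := ih.add hγ hγ1 ((isThalerCoboundary_thalerP hγ hγ1 N).const_mul (χ N - 1))
      simpa only [Finset.sum_range_succ, ← add_assoc] using this
  have htail := tendsto_sum_nat_add fun k => thalerB γ k * ‖χ k - 1‖
  obtain ⟨N, hN⟩ := (htail.eventually_lt_const hε).exists
  refine ⟨_, (hfin N).mono ?_, fun y hy => ?_⟩
  · calc _ = 2 * (∑ k ∈ Finset.range N, thalerB γ k * ‖χ k - 1‖) / thalerA γ 1 := by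
          rw [Finset.mul_sum, Finset.sum_div]
          exact Finset.sum_congr rfl fun k _ => by ring
      _ ≤ _ := by
          have := hB.sum_le_tsum (Finset.range N) fun k _ =>
            mul_nonneg (thalerB_nonneg hγ hγ1 k) (norm_nonneg (χ k - 1))
          rw [thalerD]; gcongr
  · have hy' := Icc_thalerX_subset hγ hγ1 hy
    have h1 : HasSum (fun k => (thalerP γ k y : ℂ) * (χ k * 1)) (thalerQ γ χ (fun _ => 1) y) := by
      rw [thalerQ_apply hy]
      exact (summable_thalerQ_term hγ hγ1 hχ hone hy).hasSum
    have h2 : HasSum (fun k => (thalerP γ k y : ℂ) * (1 * 1)) 1 := by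
      have h := (summable_thalerQ_term (χ := fun _ => (1 : ℂ)) (c := 1) hγ hγ1 (by simp)
        hone hy).hasSum
      have h' := thalerQ_one_const hγ hγ1 (1 : ℂ) hy
      rw [thalerQ_apply hy] at h'
      rwa [h'] at h
    have h3 : HasSum (fun k => (thalerP γ k y : ℂ) * (χ k - 1)) _ :=
      (h1.sub h2).congr_fun fun k => by ring
    have h4 := (hasSum_nat_add_iff' N).2 h3
    have h5 : thalerQ γ χ (fun _ => 1) y -
        (1 + ∑ k ∈ Finset.range N, (χ k - 1) * (thalerP γ k y : ℂ)) =
        ∑' k, (thalerP γ (k + N) y : ℂ) * (χ (k + N) - 1) := by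
      rw [show (∑' k, (thalerP γ (k + N) y : ℂ) * (χ (k + N) - 1)) = _ from h4.tsum_eq, ← sub_sub]
      congr 1
      exact Finset.sum_congr rfl fun k _ => mul_comm _ _
    rw [h5]
    refine (tsum_of_norm_bounded ((summable_nat_add_iff N).2 hB).hasSum fun k => ?_).trans hN.le
    rw [norm_mul, Complex.norm_real, norm_of_nonneg (thalerP_nonneg hγ hγ1 hy' _)]
    exact mul_le_mul_of_nonneg_right (thalerP_le_thalerB hγ hγ1 _ hy) (norm_nonneg _)

/-- The product of the weights of the first `n` return times. -/
def thalerProd (γ xs : ℝ) (χ : ℕ → ℂ) (n : ℕ) (y : ℝ) : ℂ :=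
  ∏ j ∈ Finset.range n, χ (thalerTau γ xs ((thalerF γ xs)^[j] y))

lemma thalerProd_succ (γ xs : ℝ) (χ : ℕ → ℂ) (n : ℕ) (y : ℝ) :
    thalerProd γ xs χ (n + 1) y =
      χ (thalerTau γ xs y) * thalerProd γ xs χ n (thalerF γ xs y) := by
  rw [thalerProd, Finset.prod_range_succ', mul_comm]
  rfl

lemma norm_thalerProd_le (γ xs : ℝ) {χ : ℕ → ℂ} (hχ : ∀ k, ‖χ k‖ ≤ 1) (n : ℕ) (y : ℝ) :
    ‖thalerProd γ xs χ n y‖ ≤ 1 := by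
  rw [thalerProd, norm_prod]
  exact Finset.prod_le_one (fun _ _ => norm_nonneg _) fun _ _ => hχ _

lemma measurable_thalerProd (γ xs : ℝ) (χ : ℕ → ℂ) (n : ℕ) :
    Measurable (thalerProd γ xs χ n) :=
  Finset.measurable_prod _ fun j _ => (measurable_of_countable χ).comp
    ((measurable_thalerTau γ xs).comp ((measurable_thalerF γ xs).iterate j))

lemma norm_integral_thalerProd_mul_le (hγ : 0 < γ) (hγ1 : γ ≠ 1) {χ : ℕ → ℂ}
    (hχ : ∀ k, ‖χ k‖ ≤ 1) (n : ℕ) {f : ℝ → ℂ} {C : ℝ}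
    (hf : ∀ y ∈ Icc (thalerX γ 1) 1, ‖f y‖ ≤ C) :
    ‖∫ y, thalerProd γ (thalerX γ 1) χ n y * f y ∂thalerMuY γ (thalerX γ 1)‖ ≤ C := by
  have := isProbabilityMeasure_thalerMuY hγ hγ1
  have h := norm_integral_le_of_norm_le_const (μ := thalerMuY γ (thalerX γ 1))
    (f := fun y => thalerProd γ (thalerX γ 1) χ n y * f y) (C := C)
    ((ae_mem_Icc_thalerMuY γ).mono fun y hy => by
      rw [norm_mul]
      exact (mul_le_of_le_one_left (norm_nonneg _) (norm_thalerProd_le _ _ hχ n y)).trans (hf y hy))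
  simpa using h

/-- Up to a second order error, the weights of the successive return times decorrelate. -/
theorem norm_integral_thalerProd_sub_pow_le (hγ : 0 < γ) (hγ1 : γ ≠ 1) {χ : ℕ → ℂ}
    (hχ : ∀ k, ‖χ k‖ ≤ 1) (n : ℕ) :
    ‖∫ y, thalerProd γ (thalerX γ 1) χ n y ∂thalerMuY γ (thalerX γ 1) -
        (∫ y, thalerQ γ (fun k => χ (k + 1)) (fun _ => 1) y ∂thalerMuY γ (thalerX γ 1)) ^ n‖ ≤
      4 / thalerA γ 1 * (thalerD γ (fun k => χ (k + 1)) +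
        n * thalerD γ (fun k => χ (k + 1)) ^ 2) := by
  have := isProbabilityMeasure_thalerMuY hγ hγ1
  have hA1 := thalerA_pos (γ := γ) zero_le_one
  set μ := thalerMuY γ (thalerX γ 1) with hμ
  set χ' : ℕ → ℂ := fun k => χ (k + 1) with hχ'def
  have hχ' : ∀ k, ‖χ' k‖ ≤ 1 := fun k => hχ _
  set D := thalerD γ χ' with hDdef
  have hD0 : 0 ≤ D := thalerD_nonneg hγ hγ1 χ'
  set l := ∫ y, thalerQ γ χ' (fun _ => 1) y ∂μ with hl
  have hone : ∀ y ∈ Icc (thalerX γ 1) 1, ‖(fun _ => (1 : ℂ)) y‖ ≤ 1 := by simp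
  have hQm : Measurable (thalerQ γ χ' fun _ => 1) :=
    measurable_thalerQ hγ hγ1 hχ' measurable_const hone
  have hl1 : ‖l‖ ≤ 1 := by
    have := norm_integral_le_of_norm_le_const (μ := μ) ((ae_mem_Icc_thalerMuY γ).mono fun y hy =>
      norm_thalerQ_le hγ hγ1 hχ' hone hy)
    simpa using this
  have hlD : ‖l - 1‖ ≤ D := by
    have h1 : l - 1 = ∫ y, (thalerQ γ χ' (fun _ => 1) y - 1) ∂μ := by
      rw [integral_sub (integrable_thalerMuY hγ hγ1 hQm
        fun y => norm_thalerQ_le hγ hγ1 hχ' hone) (integrable_const _)]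
      simp [hl, hμ]
    rw [h1]
    have := norm_integral_le_of_norm_le_const (μ := μ)
      (f := fun y => thalerQ γ χ' (fun _ => 1) y - 1) (C := D)
      ((ae_mem_Icc_thalerMuY γ).mono fun y hy => by
        have := norm_thalerQ_sub_le hγ hγ1 hχ' hone hy
        rwa [thalerQ_one_const hγ hγ1 _ hy, mul_one] at this)
    simpa using this
  set C := 2 * D / thalerA γ 1 with hCdef
  have hC0 : 0 ≤ C := by positivity
  have key : ∀ ε > 0, ‖∫ y, thalerProd γ (thalerX γ 1) χ n y ∂μ - l ^ n‖ ≤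
      2 * C + n * (2 * (D * C) + ε) := by
    intro ε hε
    obtain ⟨u, hum, hu, hu'⟩ := (isThalerCoboundary_thalerQ hγ hγ1 hχ').2 ε hε
    have hv : ∀ y ∈ Icc (thalerX γ 1) 1, ‖(fun y => 1 + u y) y‖ ≤ 1 + C := fun y hy =>
      (norm_add_le _ _).trans (by rw [norm_one]; linarith [hu y hy])
    have hvm : Measurable fun y => 1 + u y := hum.const_add 1
    have hInt : ∀ m {f : ℝ → ℂ} {c : ℝ}, Measurable f →
        (∀ y ∈ Icc (thalerX γ 1) 1, ‖f y‖ ≤ c) →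
        Integrable (fun y => thalerProd γ (thalerX γ 1) χ m y * f y) μ := by
      intro m f c hfm hf
      refine integrable_thalerMuY (C := c) hγ hγ1 ((measurable_thalerProd _ _ _ _).mul hfm)
        fun y hy => ?_
      rw [norm_mul]
      exact (mul_le_of_le_one_left (norm_nonneg _) (norm_thalerProd_le _ _ hχ m y)).trans (hf y hy)
    have hdefect : ∀ y ∈ Icc (thalerX γ 1) 1,
        ‖thalerQ γ χ' (fun y => 1 + u y) y - l * (1 + u y)‖ ≤ 2 * (D * C) + ε := by
      intro y hy
      rw [thalerQ_add hγ hγ1 hχ' hone hu]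
      have h1 := norm_thalerQ_sub_le hγ hγ1 hχ' hu hy
      have h2 : ‖(l - 1) * u y‖ ≤ D * C := by
        rw [norm_mul]; exact mul_le_mul hlD (hu y hy) (norm_nonneg _) hD0
      calc _ = ‖(thalerQ γ χ' u y - thalerQ γ (fun _ => (1 : ℂ)) u y) - (l - 1) * u y +
            (thalerQ γ χ' (fun _ => 1) y - l - (u y - thalerQ γ (fun _ => (1 : ℂ)) u y))‖ := by
            congr 1; ring
        _ ≤ D * C + D * C + ε := (norm_add_le _ _).trans (add_le_add
            ((norm_sub_le _ _).trans (add_le_add h1 h2)) (hu' y hy))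
        _ = _ := by ring
    have hstep : ∀ m : ℕ, ‖∫ y, thalerProd γ (thalerX γ 1) χ (m + 1) y * (1 + u y) ∂μ -
        l * ∫ y, thalerProd γ (thalerX γ 1) χ m y * (1 + u y) ∂μ‖ ≤ 2 * (D * C) + ε := by
      intro m
      have h1 : ∫ y, thalerProd γ (thalerX γ 1) χ (m + 1) y * (1 + u y) ∂μ =
          ∫ y, thalerProd γ (thalerX γ 1) χ m y * thalerQ γ χ' (fun y => 1 + u y) y ∂μ := by
        simp only [thalerProd_succ]
        exact integral_thalerF_mul hγ hγ1 hχ hvm hv (measurable_thalerProd _ _ _ _)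
          (norm_thalerProd_le _ _ hχ m)
      rw [h1, ← integral_const_mul, ← integral_sub (hInt m (measurable_thalerQ hγ hγ1 hχ' hvm hv)
        fun y => norm_thalerQ_le hγ hγ1 hχ' hv) ((hInt m hvm hv).const_mul l)]
      rw [integral_congr_ae (g := fun y => thalerProd γ (thalerX γ 1) χ m y *
        (thalerQ γ χ' (fun y => 1 + u y) y - l * (1 + u y)))
        (Eventually.of_forall fun y => by ring)]
      exact norm_integral_thalerProd_mul_le hγ hγ1 hχ m hdefect
    have htel : ∀ m : ℕ, ‖∫ y, thalerProd γ (thalerX γ 1) χ m y * (1 + u y) ∂μ -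
        l ^ m * ∫ y, (1 + u y) ∂μ‖ ≤ m * (2 * (D * C) + ε) := by
      intro m
      induction m with
      | zero => simp [thalerProd]
      | succ m ih =>
        calc _ = ‖(∫ y, thalerProd γ (thalerX γ 1) χ (m + 1) y * (1 + u y) ∂μ -
              l * ∫ y, thalerProd γ (thalerX γ 1) χ m y * (1 + u y) ∂μ) +
              l * (∫ y, thalerProd γ (thalerX γ 1) χ m y * (1 + u y) ∂μ -
                l ^ m * ∫ y, (1 + u y) ∂μ)‖ := by congr 1; ring
          _ ≤ (2 * (D * C) + ε) + m * (2 * (D * C) + ε) := by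
              refine (norm_add_le _ _).trans (add_le_add (hstep m) ?_)
              rw [norm_mul]
              exact (mul_le_of_le_one_left (norm_nonneg _) hl1).trans ih
          _ = _ := by push_cast; ring
    have hsplit : ∫ y, thalerProd γ (thalerX γ 1) χ n y * (1 + u y) ∂μ =
        ∫ y, thalerProd γ (thalerX γ 1) χ n y ∂μ +
          ∫ y, thalerProd γ (thalerX γ 1) χ n y * u y ∂μ := by
      rw [← integral_add _ (hInt n hum hu)]
      · exact integral_congr_ae (Eventually.of_forall fun y => by ring)
      · simpa using hInt n measurable_const hone
    have hsplit0 : ∫ y, (1 + u y) ∂μ = 1 + ∫ y, u y ∂μ := by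
      rw [integral_add (integrable_const _) (integrable_thalerMuY hγ hγ1 hum hu)]
      simp [hμ]
    have hn := htel n
    rw [hsplit, hsplit0] at hn
    have h1 := norm_integral_thalerProd_mul_le hγ hγ1 hχ n hu
    have h2 : ‖∫ y, u y ∂μ‖ ≤ C := by
      simpa [thalerProd] using norm_integral_thalerProd_mul_le hγ hγ1 hχ 0 hu
    have h3 : ‖l ^ n * ∫ y, u y ∂μ‖ ≤ C := by
      rw [norm_mul, norm_pow]
      exact (mul_le_of_le_one_left (norm_nonneg _) (pow_le_one₀ (norm_nonneg _) hl1)).trans h2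
    calc _ = ‖(∫ y, thalerProd γ (thalerX γ 1) χ n y ∂μ +
          ∫ y, thalerProd γ (thalerX γ 1) χ n y * u y ∂μ - l ^ n * (1 + ∫ y, u y ∂μ)) -
          ∫ y, thalerProd γ (thalerX γ 1) χ n y * u y ∂μ + l ^ n * ∫ y, u y ∂μ‖ := by
          congr 1; ring
      _ ≤ n * (2 * (D * C) + ε) + C + C := (norm_add_le _ _).trans (add_le_add
          ((norm_sub_le _ _).trans (add_le_add hn h1)) h3)
      _ = _ := by ring
  have hlim : Tendsto (fun ε : ℝ => 2 * C + n * (2 * (D * C) + ε)) (𝓝[>] 0)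
      (𝓝 (2 * C + n * (2 * (D * C) + 0))) := by
    refine Tendsto.mono_left ?_ nhdsWithin_le_nhds
    exact Continuous.tendsto (by fun_prop) 0
  refine (ge_of_tendsto hlim (eventually_mem_nhdsWithin.mono fun ε hε => key ε hε)).trans
    (le_of_eq ?_)
  rw [hCdef]; field_simp; ring

end

section
variable {γ : ℝ}

/-- The law of the return time: `thalerPi γ k` is the `μ_Y`-probability of return time `k + 1`. -/
def thalerPi (γ : ℝ) (k : ℕ) : ℝ := ∫ y, thalerP γ k y ∂thalerMuY γ (thalerX γ 1)

lemma thalerPi_eq (hγ : 0 < γ) (hγ1 : γ ≠ 1) (k : ℕ) :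
    thalerPi γ k =
      (thalerM γ)⁻¹ * ∫ z in Ioc (thalerX γ (k + 1)) (thalerX γ k), (1 + z) ^ (-γ) := by
  rw [thalerPi, integral_thalerMuY hγ hγ1, smul_eq_mul]
  congr 1
  have := setIntegral_thalerX_Ioc hγ hγ1 k fun z => 1 - thalerA γ z
  rw [setIntegral_congr_fun (g := fun z => (1 + z) ^ (-γ)) measurableSet_Ioc fun z hz => ?_] at this
  · rw [this]
    rfl
  · simp only [smul_eq_mul]
    rw [← one_sub_thalerA_mul_thalerH (Ioc_thalerX_subset hγ hγ1 k hz).1, mul_comm (thalerH γ z)]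

lemma thalerPi_nonneg (hγ : 0 < γ) (hγ1 : γ ≠ 1) (k : ℕ) : 0 ≤ thalerPi γ k :=
  integral_nonneg_of_ae ((ae_mem_Icc_thalerMuY γ).mono fun _ hy =>
    thalerP_nonneg hγ hγ1 (Icc_thalerX_subset hγ hγ1 hy) k)

lemma hasSum_thalerPi (hγ : 0 < γ) (hγ1 : γ ≠ 1) : HasSum (thalerPi γ) 1 := by
  have := isProbabilityMeasure_thalerMuY hγ hγ1
  have h := hasSum_integral_thalerP (Φ := fun _ => (1 : ℝ)) (C := 1) hγ hγ1
    measurable_const (by simp)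
  simp only [smul_eq_mul, mul_one, integral_const, probReal_univ] at h
  exact h

lemma hasSum_integral_thalerQ_const (hγ : 0 < γ) (hγ1 : γ ≠ 1) {χ : ℕ → ℂ} (hχ : ∀ k, ‖χ k‖ ≤ 1) :
    HasSum (fun k => (thalerPi γ k : ℂ) * χ k)
      (∫ y, thalerQ γ χ (fun _ => 1) y ∂thalerMuY γ (thalerX γ 1)) := by
  have h := hasSum_integral_thalerQ (f := fun _ => (1 : ℂ)) (C := 1) hγ hγ1 hχ
    measurable_const (by simp)
  refine h.congr_fun fun k => ?_
  simp only [mul_one]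
  rw [integral_mul_const, thalerPi]
  congr 1
  exact (integral_complex_ofReal (f := thalerP γ k)).symm

lemma tendsto_thalerPi (hγ : 0 < γ) (hγ1 : γ ≠ 1) :
    Tendsto (fun k : ℕ => ((k : ℝ) + 1) ^ (1 + γ⁻¹) * thalerPi γ k) atTop
      (𝓝 (γ⁻¹ ^ (1 + γ⁻¹) / thalerM γ)) := by
  have hM := thalerM_pos hγ hγ1
  have hle : ∀ k, thalerX γ (k + 1) ≤ thalerX γ k := fun k =>
    (strictAnti_thalerX hγ hγ1 k.lt_succ_self).le
  have h0 := (tendsto_thalerX_sub hγ hγ1).div_const (thalerM γ)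
  have h1 : Tendsto (fun k => (1 + thalerX γ k) ^ (-γ)) atTop (𝓝 1) := by
    have := ((tendsto_thalerX hγ hγ1).const_add 1).rpow_const (p := -γ) (Or.inl (by norm_num))
    simpa using this
  have h2 := h1.mul h0
  rw [one_mul] at h2
  have hInt : ∀ k, IntegrableOn (fun z : ℝ => (1 + z) ^ (-γ))
      (Ioc (thalerX γ (k + 1)) (thalerX γ k)) := by
    intro k
    refine Measure.integrableOn_of_bounded (M := 1) measure_Ioc_lt_top.ne
      (by fun_prop : Measurable fun z : ℝ => (1 + z) ^ (-γ)).aestronglyMeasurable ?_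
    filter_upwards [ae_restrict_mem measurableSet_Ioc] with z hz
    have hz0 := (Ioc_thalerX_subset hγ hγ1 k hz).1
    rw [norm_of_nonneg (rpow_nonneg (by linarith) _)]
    exact rpow_le_one_of_one_le_of_nonpos (by linarith) (by linarith)
  refine tendsto_of_tendsto_of_tendsto_of_le_of_le h2 h0 (fun k => ?_) fun k => ?_
  · have h3 : (1 + thalerX γ k) ^ (-γ) * (thalerX γ k - thalerX γ (k + 1)) ≤
        ∫ z in Ioc (thalerX γ (k + 1)) (thalerX γ k), (1 + z) ^ (-γ) := by
      have := setIntegral_mono_on (f := fun _ => (1 + thalerX γ k) ^ (-γ))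
        (integrableOn_const measure_Ioc_lt_top.ne) (hInt k)
        measurableSet_Ioc fun z hz => by
          have hz0 := (Ioc_thalerX_subset hγ hγ1 k hz).1
          exact rpow_le_rpow_of_nonpos (by linarith) (by linarith [hz.2]) (by linarith)
      rw [setIntegral_const, Real.volume_real_Ioc_of_le (hle k), smul_eq_mul] at this
      linarith
    rw [thalerPi_eq hγ hγ1]
    calc _ = ((k : ℝ) + 1) ^ (1 + γ⁻¹) * ((thalerM γ)⁻¹ *
          ((1 + thalerX γ k) ^ (-γ) * (thalerX γ k - thalerX γ (k + 1)))) := by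
            rw [div_eq_mul_inv]; ring
      _ ≤ _ := by gcongr
  · have h3 : ∫ z in Ioc (thalerX γ (k + 1)) (thalerX γ k), (1 + z) ^ (-γ) ≤
        thalerX γ k - thalerX γ (k + 1) := by
      have := setIntegral_mono_on (g := fun _ => (1 : ℝ)) (hInt k)
        (integrableOn_const measure_Ioc_lt_top.ne)
        measurableSet_Ioc fun z hz => by
          have hz0 := (Ioc_thalerX_subset hγ hγ1 k hz).1
          exact rpow_le_one_of_one_le_of_nonpos (by linarith) (by linarith)
      rw [setIntegral_const, Real.volume_real_Ioc_of_le (hle k), smul_eq_mul] at this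
      linarith
    dsimp only
    rw [thalerPi_eq hγ hγ1]
    calc _ ≤ ((k : ℝ) + 1) ^ (1 + γ⁻¹) * ((thalerM γ)⁻¹ *
          (thalerX γ k - thalerX γ (k + 1))) := by gcongr
      _ = _ := by rw [div_eq_mul_inv]; ring

lemma hasSum_mul_thalerPi (hγ : 0 < γ) (hγ1 : γ < 1) :
    HasSum (fun k : ℕ => ((k : ℝ) + 1) * thalerPi γ k) (1 - 2 ^ (γ - 1))⁻¹ := by
  have hne := hγ1.ne
  have hM := thalerM_pos hγ hne
  set m : ℕ → ℝ := fun k =>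
    (thalerM γ)⁻¹ * ∫ x in Ioc (thalerX γ (k + 1)) (thalerX γ k), thalerH γ x with hm
  have hPi : ∀ k, thalerPi γ k = m k - m (k + 1) := by
    intro k
    rw [thalerPi, integral_thalerMuY hγ hne, smul_eq_mul, hm]
    dsimp only
    rw [setIntegral_thalerH_eq hγ hne, setIntegral_thalerH_eq hγ hne, ← mul_sub,
      ← integral_sub (integrable_thalerS hγ hne _) (integrable_thalerS hγ hne _)]
    simp only [thalerP_eq_sub, smul_eq_mul, mul_sub]
  have hsum : ∀ N : ℕ, ∑ k ∈ Finset.range N, ((k : ℝ) + 1) * thalerPi γ k =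
      ∑ k ∈ Finset.range N, m k - N * m N := by
    intro N
    induction N with
    | zero => simp
    | succ N ih => rw [Finset.sum_range_succ, Finset.sum_range_succ, ih, hPi]; push_cast; ring
  have hi1 : IntervalIntegrable (fun x : ℝ => x ^ (-γ)) volume 0 1 :=
    intervalIntegral.intervalIntegrable_rpow' (by linarith)
  have hi2 : IntervalIntegrable (fun x : ℝ => (x + 1) ^ (-γ)) volume 0 1 := by
    refine ContinuousOn.intervalIntegrable fun x hx => ?_
    rw [uIcc_of_le zero_le_one] at hx
    exact (((continuous_id.add continuous_const).continuousAt).rpow_const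
      (Or.inl (by simp; linarith [hx.1]))).continuousWithinAt
  have hmsum : HasSum m (1 - 2 ^ (γ - 1))⁻¹ := by
    have hInt : IntegrableOn (thalerH γ) (⋃ k, Ioc (thalerX γ (k + 1)) (thalerX γ k)) := by
      rw [iUnion_Ioc_thalerX hγ hne, ← intervalIntegrable_iff_integrableOn_Ioc_of_le zero_le_one]
      exact hi1.add hi2
    have hs := (hasSum_integral_iUnion (fun k => measurableSet_Ioc)
      (pairwise_disjoint_Ioc_thalerX hγ hne) hInt).mul_left (thalerM γ)⁻¹
    rw [iUnion_Ioc_thalerX hγ hne, ← intervalIntegral.integral_of_le zero_le_one] at hs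
    suffices h : (thalerM γ)⁻¹ * ∫ x in (0 : ℝ)..1, thalerH γ x = (1 - 2 ^ (γ - 1))⁻¹ by
      rw [← h]; exact hs
    have : ∫ x in (0 : ℝ)..1, thalerH γ x = 2 ^ (1 - γ) / (1 - γ) := by
      simp only [thalerH]
      rw [intervalIntegral.integral_add hi1 hi2, integral_rpow (Or.inl (by linarith)),
        intervalIntegral.integral_comp_add_right (fun x => x ^ (-γ)),
        integral_rpow (Or.inl (by linarith)), neg_add_eq_sub, zero_add, one_rpow,
        zero_rpow (by linarith), one_add_one_eq_two]
      ring
    rw [this, thalerM_eq hγ hne, show γ - 1 = -(1 - γ) by ring, rpow_neg zero_le_two]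
    have h2 : (1 : ℝ) < 2 ^ (1 - γ) := one_lt_rpow one_lt_two (by linarith)
    have h3 : (2 : ℝ) ^ (1 - γ) - 1 ≠ 0 := by linarith
    have h4 : (1 : ℝ) - (2 ^ (1 - γ))⁻¹ ≠ 0 := by
      have := inv_lt_one_of_one_lt₀ h2
      linarith
    have h5 : 1 - γ ≠ 0 := by linarith
    have h6 : (2 : ℝ) ^ (1 - γ) ≠ 0 := by positivity
    field_simp
  have hm0 : ∀ k, 0 ≤ m k := fun k => mul_nonneg (inv_nonneg.2 hM.le)
    (setIntegral_nonneg measurableSet_Ioc fun x hx =>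
      (thalerH_pos (Ioc_thalerX_subset hγ hne k hx).1).le)
  have hNm : Tendsto (fun N : ℕ => N * m N) atTop (𝓝 0) := by
    obtain ⟨C, hC, hCle⟩ := exists_setIntegral_thalerH_le hγ hne
    have h1 : Tendsto (fun N : ℕ => (thalerM γ)⁻¹ * C * ((N : ℝ) + 1) ^ (-(γ⁻¹ - 1))) atTop
        (𝓝 0) := by
      have := ((tendsto_rpow_neg_atTop (y := γ⁻¹ - 1)
        (sub_pos.2 ((one_lt_inv₀ hγ).2 hγ1))).comp
        (tendsto_atTop_add_const_right atTop (1 : ℝ) tendsto_natCast_atTop_atTop)).const_mul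
        ((thalerM γ)⁻¹ * C)
      simpa using this
    refine squeeze_zero (fun N => mul_nonneg N.cast_nonneg (hm0 N)) (fun N => ?_) h1
    have hN : (0 : ℝ) < N + 1 := by positivity
    calc (N : ℝ) * m N ≤ (N + 1) * ((thalerM γ)⁻¹ * (C * ((N : ℝ) + 1) ^ (-γ⁻¹))) := by
          refine mul_le_mul (by linarith) ?_ (hm0 N) hN.le
          exact mul_le_mul_of_nonneg_left (hCle N) (inv_nonneg.2 hM.le)
      _ = _ := by
          rw [show -(γ⁻¹ - 1) = 1 + -γ⁻¹ by ring, rpow_add hN, rpow_one]; ring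
  rw [hasSum_iff_tendsto_nat_of_nonneg fun k =>
    mul_nonneg (by positivity) (thalerPi_nonneg hγ hne k)]
  simp only [hsum]
  simpa using hmsum.tendsto_sum_nat.sub hNm

/-- The transfer operator defect is bounded by a power of the frequency. -/
lemma exists_thalerD_le (hγ : 0 < γ) (hγ1 : γ ≠ 1) {θ : ℝ} (hθ0 : 0 < θ) (hθ1 : θ ≤ 1)
    (hθ : θ < γ⁻¹) :
    ∃ C, 0 ≤ C ∧ ∀ (s : ℝ), 0 < s → ∀ χ : ℕ → ℂ, (∀ k, ‖χ k‖ ≤ 1) →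
      (∀ k : ℕ, ‖χ k - 1‖ ≤ 2 * (s * (k + 1))) → thalerD γ χ ≤ C * s ^ θ := by
  obtain ⟨C, hC, hB⟩ := exists_thalerB_le hγ hγ1
  have hsm : Summable fun k : ℕ => ((k : ℝ) + 1) ^ (θ - (1 + γ⁻¹)) := by
    have := (summable_nat_add_iff 1).2
      (Real.summable_nat_rpow.2 (show θ - (1 + γ⁻¹) < -1 by linarith))
    simpa using this
  refine ⟨∑' k : ℕ, 2 * C * ((k : ℝ) + 1) ^ (θ - (1 + γ⁻¹)), tsum_nonneg fun k => by positivity,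
    fun s hs χ hχ hχ1 => ?_⟩
  rw [thalerD, ← tsum_mul_right]
  refine (summable_thalerB_mul hγ hγ1 hχ).tsum_le_tsum (fun k => ?_) ((hsm.mul_left _).mul_right _)
  have hk : (0 : ℝ) < k + 1 := by positivity
  have h2 : ‖χ k - 1‖ ≤ 2 * (s * (k + 1)) ^ θ := by
    rcases le_total (s * (k + 1)) 1 with h | h
    · refine (hχ1 k).trans ?_
      gcongr
      simpa using rpow_le_rpow_of_exponent_ge (by positivity) h hθ1
    · have := one_le_rpow h hθ0.le
      have := norm_sub_le (χ k) 1
      have := hχ k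
      rw [norm_one] at *
      linarith
  calc _ ≤ C * ((k : ℝ) + 1) ^ (-(1 + γ⁻¹)) * (2 * (s * (k + 1)) ^ θ) :=
        mul_le_mul (hB k) h2 (norm_nonneg _) (by positivity)
    _ = _ := by
        rw [mul_rpow hs.le hk.le, sub_eq_add_neg θ, rpow_add hk]; ring

end

section

lemma integrableOn_min_rpow {a : ℝ} (ha : -1 < a) (ha' : a < 0) :
    IntegrableOn (fun u : ℝ => min (u ^ (a - 1)) (u ^ a)) (Ioi 0) := by
  have hm : Measurable fun u : ℝ => min (u ^ (a - 1)) (u ^ a) := by fun_prop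
  rw [← Ioc_union_Ioi_eq_Ioi zero_le_one]
  refine IntegrableOn.union ?_ ?_
  · have h : IntegrableOn (fun u : ℝ => u ^ a) (Ioc 0 1) :=
      (intervalIntegrable_iff_integrableOn_Ioc_of_le zero_le_one).1
        (intervalIntegral.intervalIntegrable_rpow' ha)
    refine h.mono' hm.aestronglyMeasurable ?_
    filter_upwards [ae_restrict_mem measurableSet_Ioc] with u hu
    rw [norm_of_nonneg (le_min (rpow_nonneg hu.1.le _) (rpow_nonneg hu.1.le _))]
    exact min_le_right _ _
  · have h : IntegrableOn (fun u : ℝ => u ^ (a - 1)) (Ioi 1) :=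
      integrableOn_Ioi_rpow_of_lt (by linarith) zero_lt_one
    refine h.mono' hm.aestronglyMeasurable ?_
    filter_upwards [ae_restrict_mem measurableSet_Ioi] with u hu
    have hu0 : (0 : ℝ) ≤ u := zero_le_one.trans (le_of_lt hu)
    rw [norm_of_nonneg (le_min (rpow_nonneg hu0 _) (rpow_nonneg hu0 _))]
    exact min_le_left _ _

/-- The remainder of the exponential series after `n` terms. -/
def expRem (n : ℕ) (w : ℂ) : ℂ := Complex.exp w - ∑ i ∈ Finset.range n, w ^ i / (i.factorial : ℂ)

lemma hasDerivAt_expRem_succ (n : ℕ) (w : ℂ) : HasDerivAt (expRem (n + 1)) (expRem n w) w := by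
  have h : HasDerivAt (fun w : ℂ => ∑ i ∈ Finset.range (n + 1), w ^ i / (i.factorial : ℂ))
      (∑ i ∈ Finset.range n, w ^ i / (i.factorial : ℂ)) w := by
    simp only [Finset.sum_range_succ' _ n, pow_zero]
    refine HasDerivAt.add_const _ (HasDerivAt.fun_sum fun i _ => ?_)
    have := (hasDerivAt_pow (i + 1) w).div_const ((i + 1).factorial : ℂ)
    suffices h : ((i + 1 : ℕ) : ℂ) * w ^ (i + 1 - 1) / ((i + 1).factorial : ℂ) =
        w ^ i / (i.factorial : ℂ) by
      rw [h] at this; exact this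
    have h1 : ((i : ℂ) + 1) ≠ 0 := by exact_mod_cast i.succ_ne_zero
    have h2 : (i.factorial : ℂ) ≠ 0 := by exact_mod_cast i.factorial_ne_zero
    rw [Nat.factorial_succ]
    push_cast
    field_simp
  exact (Complex.hasDerivAt_exp w).sub h

lemma continuous_expRem (n : ℕ) : Continuous (expRem n) := by
  unfold expRem
  fun_prop

lemma norm_expRem_le {n : ℕ} (hn : n ≤ 1) {w : ℂ} (hw : w.re ≤ 0) :
    ‖expRem (n + 1) w‖ ≤ 3 * ‖w‖ ^ n ∧ ‖expRem (n + 1) w‖ ≤ 3 * ‖w‖ ^ (n + 1) := by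
  have h0 : ‖Complex.exp w‖ ≤ 1 := by
    rw [Complex.norm_exp]
    exact exp_le_one_iff.2 hw
  have hw0 := norm_nonneg w
  interval_cases n
  · have e : expRem (0 + 1) w = Complex.exp w - 1 := by simp [expRem]
    have h1 : ‖Complex.exp w - 1‖ ≤ 2 := (norm_sub_le _ _).trans (by rw [norm_one]; linarith)
    rw [e, pow_zero, zero_add, pow_one, mul_one]
    refine ⟨by linarith, ?_⟩
    rcases le_total ‖w‖ 1 with h | h
    · have := Complex.norm_exp_sub_one_le h
      linarith
    · linarith
  · have e : expRem (1 + 1) w = Complex.exp w - 1 - w := by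
      simp [expRem, Finset.sum_range_succ]; ring
    have h1 : ‖Complex.exp w - 1 - w‖ ≤ 2 + ‖w‖ :=
      (norm_sub_le _ _).trans (by
        gcongr; exact (norm_sub_le _ _).trans (by rw [norm_one]; linarith))
    rw [e, pow_one, one_add_one_eq_two]
    rcases le_total ‖w‖ 1 with h | h
    · have := Complex.norm_exp_sub_one_sub_id_le h
      constructor <;> nlinarith
    · constructor <;> nlinarith

lemma norm_expRem_mul_rpow_le {n : ℕ} (hn : n ≤ 1) {r : ℂ} (hr : 0 ≤ r.re) {K : ℝ} (hK : 1 ≤ K)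
    (hrK : ‖r‖ ≤ K) (α : ℝ) {u : ℝ} (hu : 0 < u) :
    ‖expRem (n + 1) (-(r * u)) * ((u ^ (-1 - α) : ℝ) : ℂ)‖ ≤
      3 * K ^ (n + 1) * min (u ^ ((n : ℝ) - α - 1)) (u ^ ((n : ℝ) - α)) := by
  have hre : (-(r * (u : ℂ))).re ≤ 0 := by
    simp only [Complex.neg_re, Complex.mul_re, Complex.ofReal_re, Complex.ofReal_im, mul_zero,
      sub_zero, neg_nonpos]
    positivity
  obtain ⟨h1, h2⟩ := norm_expRem_le hn hre
  have hn1 : ‖-(r * (u : ℂ))‖ = ‖r‖ * u := by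
    rw [norm_neg, norm_mul, Complex.norm_real, norm_of_nonneg hu.le]
  have hr0 := norm_nonneg r
  have hp : 0 ≤ u ^ (-1 - α) := rpow_nonneg hu.le _
  rw [hn1, mul_pow] at h1 h2
  rw [norm_mul, Complex.norm_real, norm_of_nonneg hp]
  have e1 : u ^ n * u ^ (-1 - α) = u ^ ((n : ℝ) - α - 1) := by
    rw [← rpow_natCast, ← rpow_add hu]; congr 1; ring
  have e2 : u ^ (n + 1) * u ^ (-1 - α) = u ^ ((n : ℝ) - α) := by
    rw [← rpow_natCast, ← rpow_add hu]; congr 1; push_cast; ring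
  have k1 : ‖r‖ ^ n ≤ K ^ (n + 1) :=
    (pow_le_pow_left₀ hr0 hrK n).trans (pow_le_pow_right₀ hK n.le_succ)
  have k2 : ‖r‖ ^ (n + 1) ≤ K ^ (n + 1) := pow_le_pow_left₀ hr0 hrK _
  rw [mul_min_of_nonneg _ _ (by positivity)]
  refine le_min ?_ ?_
  · rw [← e1]
    calc _ ≤ 3 * (‖r‖ ^ n * u ^ n) * u ^ (-1 - α) := by gcongr
      _ = 3 * ‖r‖ ^ n * (u ^ n * u ^ (-1 - α)) := by ring
      _ ≤ _ := by gcongr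
  · rw [← e2]
    calc _ ≤ 3 * (‖r‖ ^ (n + 1) * u ^ (n + 1)) * u ^ (-1 - α) := by gcongr
      _ = 3 * ‖r‖ ^ (n + 1) * (u ^ (n + 1) * u ^ (-1 - α)) := by ring
      _ ≤ _ := by gcongr

lemma measurable_expRem_mul_rpow (n : ℕ) (r : ℂ) (α : ℝ) :
    Measurable fun u : ℝ => expRem n (-(r * u)) * ((u ^ (-1 - α) : ℝ) : ℂ) := by
  have := (continuous_expRem n).measurable
  exact (this.comp (by fun_prop)).mul (by fun_prop)

lemma integrableOn_expRem_mul_rpow {n : ℕ} (hn : n ≤ 1) {r : ℂ} (hr : 0 ≤ r.re) {α : ℝ}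
    (hα : (n : ℝ) < α) (hα' : α < n + 1) :
    IntegrableOn (fun u : ℝ => expRem (n + 1) (-(r * u)) * ((u ^ (-1 - α) : ℝ) : ℂ)) (Ioi 0) := by
  refine ((integrableOn_min_rpow (a := n - α) (by linarith) (by linarith)).const_mul
    (3 * max 1 ‖r‖ ^ (n + 1))).mono' (measurable_expRem_mul_rpow _ _ _).aestronglyMeasurable ?_
  filter_upwards [ae_restrict_mem measurableSet_Ioi] with u hu
  exact norm_expRem_mul_rpow_le hn hr (le_max_left _ _) (le_max_right _ _) α hu

lemma integral_expRem_succ {n : ℕ} (hn : n ≤ 1) {r : ℂ} (hr : 0 ≤ r.re) {α : ℝ}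
    (hα : (n : ℝ) < α) (hα' : α < n + 1)
    (hInt : IntegrableOn (fun u : ℝ => expRem n (-(r * u)) * ((u ^ (-1 - (α - 1)) : ℝ) : ℂ))
      (Ioi 0)) :
    ∫ u in Ioi (0 : ℝ), expRem (n + 1) (-(r * u)) * ((u ^ (-1 - α) : ℝ) : ℂ) =
      -(r / α) * ∫ u in Ioi (0 : ℝ), expRem n (-(r * u)) * ((u ^ (-1 - (α - 1)) : ℝ) : ℂ) := by
  have hα0 : 0 < α := lt_of_le_of_lt n.cast_nonneg hα
  have hαC : (α : ℂ) ≠ 0 := by exact_mod_cast hα0.ne'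
  set U : ℝ → ℂ := fun u => expRem (n + 1) (-(r * u)) with hU
  set U' : ℝ → ℂ := fun u => expRem n (-(r * u)) * (-r) with hU'
  set V : ℝ → ℂ := fun u => ((-(u ^ (-α)) / α : ℝ) : ℂ) with hV
  set V' : ℝ → ℂ := fun u => ((u ^ (-1 - α) : ℝ) : ℂ) with hV'
  have hdU : ∀ x ∈ Ioi (0 : ℝ), HasDerivAt U (U' x) x := by
    intro x _
    have h1 : HasDerivAt (fun z : ℂ => -(r * z)) (-r) x := by
      have := ((hasDerivAt_id (x : ℂ)).const_mul r).neg
      rw [mul_one] at this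
      exact this
    exact ((hasDerivAt_expRem_succ n (-(r * x))).comp (x : ℂ) h1).comp_ofReal
  have hdV : ∀ x ∈ Ioi (0 : ℝ), HasDerivAt V (V' x) x := by
    intro x hx
    have h1 := ((Real.hasDerivAt_rpow_const (p := -α) (Or.inl (ne_of_gt hx))).neg.div_const α)
    have h2 : -(-α * x ^ (-α - 1)) / α = x ^ (-1 - α) := by
      rw [show -α - 1 = -1 - α by ring]; field_simp
    rw [h2] at h1
    exact h1.ofReal_comp
  have hUV' : IntegrableOn (U * V') (Ioi 0) := integrableOn_expRem_mul_rpow hn hr hα hα'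
  have e1 : ∀ u : ℝ, U' u * V u =
      (r / α) * (expRem n (-(r * u)) * ((u ^ (-1 - (α - 1)) : ℝ) : ℂ)) := by
    intro u
    simp only [hU', hV]
    rw [show -1 - (α - 1) = -α by ring]
    push_cast
    field_simp
  have hU'V : IntegrableOn (U' * V) (Ioi 0) :=
    (Integrable.const_mul hInt (r / α)).congr (Eventually.of_forall fun u => (e1 u).symm)
  have hbd : ∀ u ∈ Ioi (0 : ℝ), ‖(U * V) u‖ ≤ 3 * max 1 ‖r‖ ^ (n + 1) / α *
      min (u ^ ((n : ℝ) - α)) (u ^ ((n : ℝ) - α + 1)) := by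
    intro u hu
    have hu0 : (0 : ℝ) < u := hu
    have h := norm_expRem_mul_rpow_le hn hr (le_max_left 1 ‖r‖) (le_max_right _ _) α hu
    have e2 : (U * V) u = -((u : ℂ) / α) *
        (expRem (n + 1) (-(r * u)) * ((u ^ (-1 - α) : ℝ) : ℂ)) := by
      simp only [Pi.mul_apply, hU, hV]
      rw [show -α = 1 + (-1 - α) by ring, rpow_add hu0, rpow_one]
      push_cast
      field_simp
    rw [e2, norm_mul, norm_neg, norm_div, Complex.norm_real, Complex.norm_real,
      norm_of_nonneg hu0.le, norm_of_nonneg hα0.le]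
    have e3 : min (u ^ ((n : ℝ) - α)) (u ^ ((n : ℝ) - α + 1)) =
        u * min (u ^ ((n : ℝ) - α - 1)) (u ^ ((n : ℝ) - α)) := by
      rw [mul_min_of_nonneg _ _ hu0.le, rpow_add_one hu0.ne', rpow_sub_one hu0.ne']
      congr 1
      · field_simp
      · ring
    rw [e3]
    refine (mul_le_mul_of_nonneg_left h (by positivity)).trans_eq ?_
    ring
  have hz : Tendsto (U * V) (𝓝[>] 0) (𝓝 0) := by
    have h1 : Tendsto (fun u : ℝ => 3 * max 1 ‖r‖ ^ (n + 1) / α * u ^ ((n : ℝ) - α + 1)) (𝓝[>] 0)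
        (𝓝 0) := by
      have h2 : Tendsto (fun u : ℝ => u ^ ((n : ℝ) - α + 1)) (𝓝[>] 0) (𝓝 0) := by
        have := (continuousAt_rpow_const (0 : ℝ) ((n : ℝ) - α + 1)
          (Or.inr (by linarith))).tendsto
        rw [zero_rpow (by linarith)] at this
        exact this.mono_left nhdsWithin_le_nhds
      simpa using h2.const_mul (3 * max 1 ‖r‖ ^ (n + 1) / α)
    refine squeeze_zero_norm' ?_ h1
    filter_upwards [self_mem_nhdsWithin] with u hu
    exact (hbd u hu).trans (mul_le_mul_of_nonneg_left (min_le_right _ _) (by positivity))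
  have hi : Tendsto (U * V) atTop (𝓝 0) := by
    have h1 : Tendsto (fun u : ℝ => 3 * max 1 ‖r‖ ^ (n + 1) / α * u ^ ((n : ℝ) - α)) atTop
        (𝓝 0) := by
      have := (tendsto_rpow_neg_atTop (y := α - n) (by linarith)).const_mul
        (3 * max 1 ‖r‖ ^ (n + 1) / α)
      rw [mul_zero, neg_sub] at this
      exact this
    refine squeeze_zero_norm' ?_ h1
    filter_upwards [eventually_gt_atTop 0] with u hu
    exact (hbd u hu).trans (mul_le_mul_of_nonneg_left (min_le_left _ _) (by positivity))
  have h := integral_Ioi_mul_deriv_eq_deriv_mul hdU hdV hUV' hU'V hz hi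
  rw [sub_zero, zero_sub] at h
  simp only [e1] at h
  rw [integral_const_mul] at h
  rw [neg_mul]
  exact h

end

section

lemma integrableOn_rpow_mul_cexp {a : ℝ} (ha : 0 < a) {r : ℂ} (hr : 0 < r.re) :
    IntegrableOn (fun u : ℝ => Complex.exp (-(r * u)) * ((u ^ (a - 1) : ℝ) : ℂ)) (Ioi 0) := by
  have h := integrableOn_rpow_mul_exp_neg_mul_rpow (p := 1) (s := a - 1) (by linarith) one_pos hr
  refine h.mono' (Measurable.aestronglyMeasurable (by fun_prop)) ?_
  filter_upwards [ae_restrict_mem measurableSet_Ioi] with u hu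
  rw [norm_mul, Complex.norm_exp, Complex.norm_real, norm_of_nonneg (rpow_nonneg (le_of_lt hu) _),
    rpow_one, mul_comm]
  simp

lemma integral_rpow_mul_cexp {a : ℝ} (ha : 0 < a) {r : ℂ} (hr : 0 < r.re) :
    ∫ u in Ioi (0 : ℝ), Complex.exp (-(r * u)) * ((u ^ (a - 1) : ℝ) : ℂ) =
      r ^ (-a : ℂ) * Real.Gamma a := by
  set μ : Measure ℝ := (volume.restrict (Ioi 0)).withDensity fun u => ENNReal.ofReal (u ^ (a - 1))
    with hμ
  have hdm : Measurable fun u : ℝ => ENNReal.ofReal (u ^ (a - 1)) := by fun_prop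
  have hmgf : ∀ z : ℂ, ProbabilityTheory.complexMGF id μ z =
      ∫ u in Ioi (0 : ℝ), Complex.exp (z * u) * ((u ^ (a - 1) : ℝ) : ℂ) := by
    intro z
    rw [ProbabilityTheory.complexMGF, hμ, integral_withDensity_eq_integral_toReal_smul hdm
      (Eventually.of_forall fun _ => ENNReal.ofReal_lt_top)]
    refine setIntegral_congr_fun measurableSet_Ioi fun u hu => ?_
    simp only [id_eq, ENNReal.toReal_ofReal (rpow_nonneg (le_of_lt hu) _), Complex.real_smul]
    ring
  have hsub : Iio (0 : ℝ) ⊆ interior (ProbabilityTheory.integrableExpSet id μ) := by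
    refine interior_maximal (fun t ht => ?_) isOpen_Iio
    have h := integrableOn_rpow_mul_cexp ha (r := ((-t : ℝ) : ℂ)) (by simpa using ht)
    simp only [ProbabilityTheory.integrableExpSet, mem_ofPred_eq]
    rw [hμ, integrable_withDensity_iff_integrable_smul' hdm
      (Eventually.of_forall fun _ => ENNReal.ofReal_lt_top)]
    refine h.norm.congr ?_
    filter_upwards [ae_restrict_mem measurableSet_Ioi] with u hu
    rw [norm_mul, Complex.norm_exp, Complex.norm_real,
      norm_of_nonneg (rpow_nonneg (le_of_lt hu) _),
      ENNReal.toReal_ofReal (rpow_nonneg (le_of_lt hu) _), smul_eq_mul, mul_comm]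
    simp
  set S : Set ℂ := {z | z.re < 0} with hS
  have hSopen : IsOpen S := isOpen_lt Complex.continuous_re continuous_const
  have hf : AnalyticOnNhd ℂ (ProbabilityTheory.complexMGF id μ) S :=
    ProbabilityTheory.analyticOnNhd_complexMGF.mono fun z hz => hsub hz
  have hg : AnalyticOnNhd ℂ (fun z : ℂ => (-z) ^ (-a : ℂ) * Real.Gamma a) S := by
    refine DifferentiableOn.analyticOnNhd (fun z hz => ?_) hSopen
    refine DifferentiableAt.differentiableWithinAt ?_
    refine DifferentiableAt.mul_const (DifferentiableAt.cpow_const ?_ (Or.inl ?_)) _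
    · fun_prop
    · have : z.re < 0 := hz
      simpa using this
  have hpre : IsPreconnected S := (convex_halfSpace_re_lt 0).isPreconnected
  have hreal : ∀ x : ℝ, 0 < x → ProbabilityTheory.complexMGF id μ ((-x : ℝ) : ℂ) =
      (-((-x : ℝ) : ℂ)) ^ (-a : ℂ) * Real.Gamma a := by
    intro x hx
    rw [hmgf]
    have h := Complex.integral_cpow_mul_exp_neg_mul_Ioi (a := (a : ℂ)) (by simpa using ha) hx
    rw [Complex.Gamma_ofReal] at h
    have e : (-((-x : ℝ) : ℂ)) ^ (-a : ℂ) = (1 / (x : ℂ)) ^ (a : ℂ) := by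
      push_cast
      rw [neg_neg, one_div, Complex.inv_cpow _ _ (by
        rw [Complex.arg_ofReal_of_nonneg hx.le]; exact pi_pos.ne), Complex.cpow_neg]
    rw [e, ← h]
    refine setIntegral_congr_fun measurableSet_Ioi fun u hu => ?_
    rw [Complex.ofReal_cpow (le_of_lt hu)]
    push_cast
    rw [mul_comm, neg_mul]
  have hfreq : ∃ᶠ z in 𝓝[≠] (-1 : ℂ), ProbabilityTheory.complexMGF id μ z =
      (-z) ^ (-a : ℂ) * Real.Gamma a := by
    have ht : Tendsto (fun x : ℝ => ((-x : ℝ) : ℂ)) (𝓝[≠] 1) (𝓝[≠] (-1 : ℂ)) := by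
      refine tendsto_nhdsWithin_iff.2 ⟨?_, ?_⟩
      · have : Continuous fun x : ℝ => ((-x : ℝ) : ℂ) := by fun_prop
        have := this.tendsto 1
        push_cast at this
        exact_mod_cast this.mono_left nhdsWithin_le_nhds
      · filter_upwards [self_mem_nhdsWithin] with x hx
        intro h
        have h' : ((-x : ℝ) : ℂ) = ((-1 : ℝ) : ℂ) := by simpa using h
        exact hx (by simpa using Complex.ofReal_injective h')
    refine ht.frequently (Eventually.frequently ?_)
    filter_upwards [nhdsWithin_le_nhds (lt_mem_nhds (zero_lt_one (α := ℝ)))] with x hx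
    exact hreal x hx
  have := hf.eqOn_of_preconnected_of_frequently_eq hg hpre (z₀ := -1)
    (by simp [hS]) hfreq (show -r ∈ S by simpa [hS] using hr)
  rw [hmgf] at this
  simpa using this

lemma Gamma_neg_eq {α : ℝ} (hα : α ≠ 0) : Real.Gamma (-α) = -(Real.Gamma (1 - α) / α) := by
  have := Real.Gamma_add_one (s := -α) (by simpa using hα)
  rw [show -α + 1 = 1 - α by ring] at this
  rw [this]; field_simp

lemma integral_expRem_of_re_pos {n : ℕ} (hn : n ≤ 1) {r : ℂ} (hr : 0 < r.re) {α : ℝ}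
    (hα : (n : ℝ) < α) (hα' : α < n + 1) :
    ∫ u in Ioi (0 : ℝ), expRem (n + 1) (-(r * u)) * ((u ^ (-1 - α) : ℝ) : ℂ) =
      r ^ (α : ℂ) * Real.Gamma (-α) := by
  have hr0 : r ≠ 0 := by rintro rfl; simp at hr
  have hstep : ∀ α : ℝ, α ≠ 0 → -(r / α) * (r ^ ((α - 1 : ℝ) : ℂ) * Real.Gamma (-(α - 1))) =
      r ^ (α : ℂ) * Real.Gamma (-α) := by
    intro α h0
    have hC : (α : ℂ) ≠ 0 := by exact_mod_cast h0
    rw [Gamma_neg_eq h0, neg_sub]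
    push_cast
    rw [Complex.cpow_sub _ _ hr0, Complex.cpow_one]
    field_simp
  have key : ∀ α : ℝ, 0 < α → α < 1 →
      ∫ u in Ioi (0 : ℝ), expRem 1 (-(r * u)) * ((u ^ (-1 - α) : ℝ) : ℂ) =
      r ^ (α : ℂ) * Real.Gamma (-α) := by
    intro α h0 h1
    have e : ∀ u : ℝ, expRem 0 (-(r * u)) * ((u ^ (-1 - (α - 1)) : ℝ) : ℂ) =
        Complex.exp (-(r * u)) * ((u ^ ((1 - α) - 1) : ℝ) : ℂ) := by
      intro u
      rw [show -1 - (α - 1) = (1 - α) - 1 by ring]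
      simp [expRem]
    rw [integral_expRem_succ (n := 0) zero_le_one hr.le (by simpa using h0) (by simpa using h1)]
    · simp only [e]
      rw [integral_rpow_mul_cexp (by linarith) hr, ← hstep α h0.ne',
        show (-((1 - α : ℝ) : ℂ)) = ((α - 1 : ℝ) : ℂ) by push_cast; ring, neg_sub]
    · simp only [e]
      exact integrableOn_rpow_mul_cexp (by linarith) hr
  interval_cases n
  · exact key α (by simpa using hα) (by simpa using hα')
  · norm_num at hα hα'
    have h1 : ((0 : ℕ) : ℝ) < α - 1 := by push_cast; linarith
    have h2 : α - 1 < (0 : ℕ) + 1 := by push_cast; linarith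
    rw [integral_expRem_succ (n := 1) le_rfl hr.le (by simpa using hα) (by norm_num; exact hα')
      (integrableOn_expRem_mul_rpow zero_le_one hr.le h1 h2),
      key (α - 1) (by linarith) (by linarith), hstep α (by linarith)]

/-- The Lévy-Khintchine integral of the one-sided stable law. -/
lemma integral_expRem_I {n : ℕ} (hn : n ≤ 1) {α : ℝ} (hα : (n : ℝ) < α) (hα' : α < n + 1) :
    ∫ u in Ioi (0 : ℝ), expRem (n + 1) (Complex.I * u) * ((u ^ (-1 - α) : ℝ) : ℂ) =
      (Complex.cos (α * π / 2) - Complex.I * Complex.sin (α * π / 2)) * Real.Gamma (-α) := by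
  have hα0 : 0 < α := lt_of_le_of_lt n.cast_nonneg hα
  have hr : Tendsto (fun ε : ℝ => (ε : ℂ) - Complex.I) (𝓝[>] 0) (𝓝 (-Complex.I)) := by
    have : Continuous fun ε : ℝ => (ε : ℂ) - Complex.I := by fun_prop
    have := this.tendsto 0
    simp only [Complex.ofReal_zero, zero_sub] at this
    exact this.mono_left nhdsWithin_le_nhds
  have h1 : Tendsto (fun ε : ℝ => ∫ u in Ioi (0 : ℝ),
      expRem (n + 1) (-(((ε : ℂ) - Complex.I) * u)) * ((u ^ (-1 - α) : ℝ) : ℂ)) (𝓝[>] 0)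
      (𝓝 (∫ u in Ioi (0 : ℝ), expRem (n + 1) (Complex.I * u) * ((u ^ (-1 - α) : ℝ) : ℂ))) := by
    refine tendsto_integral_filter_of_dominated_convergence
      (fun u => 3 * 2 ^ (n + 1) * min (u ^ ((n : ℝ) - α - 1)) (u ^ ((n : ℝ) - α)))
      (Eventually.of_forall fun ε => (measurable_expRem_mul_rpow _ _ _).aestronglyMeasurable) ?_
      ((integrableOn_min_rpow (by linarith) (by linarith)).const_mul _) ?_
    · filter_upwards [Ioc_mem_nhdsGT (zero_lt_one (α := ℝ))] with ε hε
      filter_upwards [ae_restrict_mem measurableSet_Ioi] with u hu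
      refine norm_expRem_mul_rpow_le hn (by simpa using hε.1.le) one_le_two ?_ α hu
      refine (norm_sub_le _ _).trans ?_
      rw [Complex.norm_I, Complex.norm_real, norm_of_nonneg hε.1.le]
      linarith [hε.2]
    · refine Eventually.of_forall fun u => Tendsto.mul_const _ ?_
      have h2 := ((continuous_expRem (n + 1)).tendsto _).comp (hr.mul_const (u : ℂ)).neg
      rw [neg_mul, neg_neg] at h2
      exact h2
  have h2 : Tendsto (fun ε : ℝ => ((ε : ℂ) - Complex.I) ^ (α : ℂ) * Real.Gamma (-α)) (𝓝[>] 0)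
      (𝓝 ((-Complex.I) ^ (α : ℂ) * Real.Gamma (-α))) := by
    refine Tendsto.mul_const _ ?_
    exact (continuousAt_cpow_const (b := (α : ℂ)) (by simp [Complex.mem_slitPlane_iff])).tendsto.comp
      hr
  have h3 : (-Complex.I) ^ (α : ℂ) =
      Complex.cos (α * π / 2) - Complex.I * Complex.sin (α * π / 2) := by
    rw [Complex.cpow_def_of_ne_zero (by simp), Complex.log_neg_I,
      show -(π / 2 : ℂ) * Complex.I * α = (-(α * π / 2)) * Complex.I by ring, Complex.exp_mul_I,
      Complex.cos_neg, Complex.sin_neg]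
    ring
  rw [← h3]
  refine tendsto_nhds_unique (h1.congr' ?_) h2
  filter_upwards [self_mem_nhdsWithin] with ε hε
  exact integral_expRem_of_re_pos hn (by simpa using hε) hα hα'

end

section

lemma iUnion_Ioc_mul_nat {s : ℝ} (hs : 0 < s) :
    ⋃ k : ℕ, Ioc (s * k) (s * (k + 1)) = Ioi 0 := by
  ext u
  simp only [mem_iUnion, mem_Ioc, mem_Ioi]
  constructor
  · rintro ⟨k, h1, -⟩
    exact lt_of_le_of_lt (by positivity) h1
  · intro hu
    have hc : 0 < ⌈u / s⌉₊ := Nat.ceil_pos.2 (by positivity)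
    obtain ⟨k, hk⟩ := Nat.exists_eq_add_of_lt hc
    rw [zero_add] at hk
    have h := (Nat.ceil_eq_iff (a := u / s) k.succ_ne_zero).1 hk
    refine ⟨k, ?_, ?_⟩
    · have := h.1
      rw [Nat.succ_sub_one, lt_div_iff₀ hs] at this
      linarith
    · have := h.2
      rw [div_le_iff₀ hs] at this
      push_cast at this
      linarith

lemma ceil_div_eq {s u : ℝ} (hs : 0 < s) {k : ℕ} (hu : u ∈ Ioc (s * k) (s * (k + 1))) :
    ⌈u / s⌉₊ = k + 1 := by
  rw [Nat.ceil_eq_iff k.succ_ne_zero, Nat.succ_sub_one, lt_div_iff₀ hs, div_le_iff₀ hs]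
  push_cast
  constructor <;> linarith [hu.1, hu.2]

lemma pairwise_disjoint_Ioc_mul_nat {s : ℝ} (hs : 0 < s) :
    Pairwise (Function.onFun Disjoint fun k : ℕ => Ioc (s * k) (s * (k + 1))) := by
  intro i j hij
  refine Set.disjoint_left.2 fun u hi hj => hij ?_
  have := (ceil_div_eq hs hi).symm.trans (ceil_div_eq hs hj)
  omega

/-- The step function whose integral is the Riemann sum of `f` against the weights `p`. -/
def stepFun (α : ℝ) (p : ℕ → ℝ) (f : ℝ → ℂ) (s u : ℝ) : ℂ :=
  ((s ^ (-1 - α) * p (⌈u / s⌉₊ - 1) : ℝ) : ℂ) * f (s * ⌈u / s⌉₊)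

lemma measurable_stepFun (α : ℝ) (p : ℕ → ℝ) (f : ℝ → ℂ) (s : ℝ) :
    Measurable (stepFun α p f s) := by
  have h : Measurable fun j : ℕ => ((s ^ (-1 - α) * p (j - 1) : ℝ) : ℂ) * f (s * j) :=
    measurable_from_nat
  exact h.comp (Nat.measurable_ceil.comp (measurable_id.div_const s))

variable {α a c C C₀ : ℝ} {p : ℕ → ℝ} {f : ℝ → ℂ}

lemma le_mul_ceil_div {s u : ℝ} (hs : 0 < s) : u ≤ s * ⌈u / s⌉₊ := by
  have := Nat.le_ceil (u / s)
  rw [div_le_iff₀ hs] at this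
  linarith

lemma mul_ceil_div_lt {s u : ℝ} (hs : 0 < s) (hu : 0 < u) : s * ⌈u / s⌉₊ < u + s := by
  have := Nat.ceil_lt_add_one (a := u / s) (by positivity)
  calc s * ⌈u / s⌉₊ < s * (u / s + 1) := by gcongr
    _ = u + s := by field_simp

lemma rpow_mul_weight {s u : ℝ} (hs : 0 < s) (hu : 0 < u) :
    s ^ (-1 - α) * p (⌈u / s⌉₊ - 1) = (s * ⌈u / s⌉₊) ^ (-1 - α) *
      ((((⌈u / s⌉₊ - 1 : ℕ) : ℝ) + 1) ^ (1 + α) * p (⌈u / s⌉₊ - 1)) := by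
  have hc : 0 < ⌈u / s⌉₊ := Nat.ceil_pos.2 (by positivity)
  have h1 : ((⌈u / s⌉₊ - 1 : ℕ) : ℝ) + 1 = ⌈u / s⌉₊ := by
    exact_mod_cast Nat.sub_add_cancel hc
  have hc' : (0 : ℝ) < ⌈u / s⌉₊ := by exact_mod_cast hc
  rw [h1, mul_rpow hs.le hc'.le, mul_assoc, ← mul_assoc (_ ^ (-1 - α)) (_ ^ (1 + α)),
    ← rpow_add hc', show -1 - α + (1 + α) = 0 by ring, rpow_zero, one_mul]

lemma norm_stepFun_le (ha' : a < 0) (hp : ∀ k : ℕ, |((k : ℝ) + 1) ^ (1 + α) * p k| ≤ C)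
    (hf : ∀ v, 0 < v → ‖f v‖ * v ^ (-1 - α) ≤ C₀ * min (v ^ (a - 1)) (v ^ a)) (hC₀ : 0 ≤ C₀)
    {s u : ℝ} (hs : 0 < s) (hu : 0 < u) :
    ‖stepFun α p f s u‖ ≤ C * (C₀ * min (u ^ (a - 1)) (u ^ a)) := by
  set v : ℝ := s * ⌈u / s⌉₊ with hv
  have huv : u ≤ v := le_mul_ceil_div hs
  have hv0 : 0 < v := hu.trans_le huv
  have hC : 0 ≤ C := (abs_nonneg _).trans (hp 0)
  rw [stepFun, rpow_mul_weight hs hu, norm_mul, Complex.norm_real, norm_mul, Real.norm_eq_abs,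
    abs_of_nonneg (rpow_nonneg hv0.le _), Real.norm_eq_abs, ← hv]
  calc _ ≤ v ^ (-1 - α) * C * ‖f v‖ := by
        gcongr
        exact hp _
    _ = C * (‖f v‖ * v ^ (-1 - α)) := by ring
    _ ≤ C * (C₀ * min (v ^ (a - 1)) (v ^ a)) := mul_le_mul_of_nonneg_left (hf v hv0) hC
    _ ≤ _ := by
        gcongr C * (C₀ * min ?_ ?_)
        · exact rpow_le_rpow_of_nonpos hu huv (by linarith)
        · exact rpow_le_rpow_of_nonpos hu huv ha'.le

lemma integral_stepFun (ha : -1 < a) (ha' : a < 0)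
    (hp : ∀ k : ℕ, |((k : ℝ) + 1) ^ (1 + α) * p k| ≤ C)
    (hf : ∀ v, 0 < v → ‖f v‖ * v ^ (-1 - α) ≤ C₀ * min (v ^ (a - 1)) (v ^ a)) (hC₀ : 0 ≤ C₀)
    {s : ℝ} (hs : 0 < s) :
    HasSum (fun k : ℕ => ((s ^ (-α) * p k : ℝ) : ℂ) * f (s * (k + 1)))
      (∫ u in Ioi 0, stepFun α p f s u) := by
  have hInt : IntegrableOn (stepFun α p f s) (Ioi 0) := by
    refine (((integrableOn_min_rpow ha ha').const_mul C₀).const_mul C).mono'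
      (measurable_stepFun _ _ _ _).aestronglyMeasurable ?_
    filter_upwards [ae_restrict_mem measurableSet_Ioi] with u hu
    exact norm_stepFun_le ha' hp hf hC₀ hs hu
  rw [← iUnion_Ioc_mul_nat hs] at hInt ⊢
  refine (hasSum_integral_iUnion (fun k => measurableSet_Ioc) (pairwise_disjoint_Ioc_mul_nat hs)
    hInt).congr_fun fun k => ?_
  rw [setIntegral_congr_fun (g := fun _ => ((s ^ (-1 - α) * p k : ℝ) : ℂ) * f (s * (k + 1)))
    measurableSet_Ioc fun u hu => ?_]
  · rw [setIntegral_const, Real.volume_real_Ioc_of_le (by nlinarith),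
      show s * ((k : ℝ) + 1) - s * k = s by ring, Complex.real_smul, ← mul_assoc,
      ← Complex.ofReal_mul, ← mul_assoc, show -α = 1 + (-1 - α) by ring, rpow_add hs, rpow_one]
  · simp only [stepFun, ceil_div_eq hs hu, Nat.succ_sub_one]
    push_cast
    rfl

/-- Riemann sums against regularly varying weights converge to an integral. -/
lemma tendsto_tsum_regularlyVarying (ha : -1 < a) (ha' : a < 0)
    (hp : Tendsto (fun k : ℕ => ((k : ℝ) + 1) ^ (1 + α) * p k) atTop (𝓝 c))
    (hfc : Continuous f)
    (hf : ∀ v, 0 < v → ‖f v‖ * v ^ (-1 - α) ≤ C₀ * min (v ^ (a - 1)) (v ^ a)) (hC₀ : 0 ≤ C₀) :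
    Tendsto (fun s : ℝ => ((s ^ (-α) : ℝ) : ℂ) * ∑' k : ℕ, (p k : ℂ) * f (s * (k + 1))) (𝓝[>] 0)
      (𝓝 (c * ∫ u in Ioi 0, f u * ((u ^ (-1 - α) : ℝ) : ℂ))) := by
  obtain ⟨C, hC⟩ := hp.abs.bddAbove_range
  have hpC : ∀ k : ℕ, |((k : ℝ) + 1) ^ (1 + α) * p k| ≤ C := fun k => hC ⟨k, rfl⟩
  have h1 : Tendsto (fun s : ℝ => ∫ u in Ioi 0, stepFun α p f s u) (𝓝[>] 0)
      (𝓝 (∫ u in Ioi 0, (((u ^ (-1 - α) * c : ℝ) : ℂ) * f u))) := by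
    refine tendsto_integral_filter_of_dominated_convergence
      (fun u => C * (C₀ * min (u ^ (a - 1)) (u ^ a)))
      (Eventually.of_forall fun s => (measurable_stepFun _ _ _ _).aestronglyMeasurable) ?_
      (((integrableOn_min_rpow ha ha').const_mul C₀).const_mul C) ?_
    · filter_upwards [self_mem_nhdsWithin] with s hs
      filter_upwards [ae_restrict_mem measurableSet_Ioi] with u hu
      exact norm_stepFun_le ha' hpC hf hC₀ hs hu
    · filter_upwards [ae_restrict_mem measurableSet_Ioi] with u hu
      have hu0 : (0 : ℝ) < u := hu
      have hv : Tendsto (fun s : ℝ => s * (⌈u / s⌉₊ : ℝ)) (𝓝[>] 0) (𝓝 u) := by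
        have h2 : Tendsto (fun s : ℝ => u + s) (𝓝[>] 0) (𝓝 u) := by
          have : Continuous fun s : ℝ => u + s := by fun_prop
          simpa using (this.tendsto 0).mono_left nhdsWithin_le_nhds
        refine tendsto_of_tendsto_of_tendsto_of_le_of_le' tendsto_const_nhds h2 ?_ ?_
        · filter_upwards [self_mem_nhdsWithin] with s hs using le_mul_ceil_div hs
        · filter_upwards [self_mem_nhdsWithin] with s hs using (mul_ceil_div_lt hs hu).le
      have hj : Tendsto (fun s : ℝ => ⌈u / s⌉₊ - 1) (𝓝[>] 0) atTop := by
        refine (tendsto_sub_atTop_nat 1).comp (tendsto_nat_ceil_atTop.comp ?_)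
        have h4 := tendsto_inv_nhdsGT_zero.const_mul_atTop hu0
        exact h4.congr fun s => (div_eq_mul_inv _ _).symm
      have h3 : Tendsto (fun s : ℝ => (((s * ⌈u / s⌉₊) ^ (-1 - α) *
          ((((⌈u / s⌉₊ - 1 : ℕ) : ℝ) + 1) ^ (1 + α) * p (⌈u / s⌉₊ - 1)) : ℝ) : ℂ) *
          f (s * ⌈u / s⌉₊)) (𝓝[>] 0) (𝓝 (((u ^ (-1 - α) * c : ℝ) : ℂ) * f u)) := by
        refine Tendsto.mul ?_ ((hfc.tendsto u).comp hv)
        refine (Complex.continuous_ofReal.tendsto _).comp ?_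
        exact (hv.rpow_const (Or.inl hu0.ne')).mul (hp.comp hj)
      refine h3.congr' ?_
      filter_upwards [self_mem_nhdsWithin] with s hs
      rw [stepFun, rpow_mul_weight hs hu0]
  rw [← integral_const_mul]
  have e : ∫ u in Ioi (0 : ℝ), (((u ^ (-1 - α) * c : ℝ) : ℂ) * f u) =
      ∫ u in Ioi (0 : ℝ), (c : ℂ) * (f u * ((u ^ (-1 - α) : ℝ) : ℂ)) :=
    setIntegral_congr_fun measurableSet_Ioi fun u _ => by push_cast; ring
  rw [← e]
  refine h1.congr' ?_
  filter_upwards [self_mem_nhdsWithin] with s hs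
  rw [← (integral_stepFun ha ha' hpC hf hC₀ hs).tsum_eq, ← tsum_mul_left]
  refine tsum_congr fun k => ?_
  push_cast
  ring

end

section

lemma cos_half_mul_Gamma_pos {α : ℝ} (hα : α ∈ Ioo (0 : ℝ) 1 ∪ Ioo (1 : ℝ) 2) :
    0 < stableGa α := by
  rw [stableGa]
  rcases hα with ⟨h0, h1⟩ | ⟨h1, h2⟩
  · refine mul_pos (Gamma_pos_of_pos (by linarith)) (cos_pos_of_mem_Ioo ⟨?_, ?_⟩) <;>
      nlinarith [pi_pos]
  · refine mul_pos_of_neg_of_neg ?_ (cos_neg_of_pi_div_two_lt_of_lt ?_ ?_)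
    · have h := Real.Gamma_add_one (s := 1 - α) (by linarith)
      have h' : 0 < Gamma (1 - α + 1) := Gamma_pos_of_pos (by linarith)
      rw [h] at h'
      exact neg_of_mul_pos_right h' (by linarith)
    all_goals nlinarith [pi_pos]

lemma stableDa_eq {α : ℝ} (h0 : 0 < α) (h1 : α ≠ 1) :
    stableDa α = α ^ α / thalerM α⁻¹ * stableGa α := by
  rw [stableDa, thalerM_eq (inv_pos.2 h0) (by simpa using h1), div_div_eq_mul_div, mul_div_assoc]

lemma stableDa_pos {α : ℝ} (hα : α ∈ Ioo (0 : ℝ) 1 ∪ Ioo (1 : ℝ) 2) : 0 < stableDa α := by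
  have h0 : 0 < α := by rcases hα with h | h <;> linarith [h.1]
  have h1 : α ≠ 1 := by
    rcases hα with h | h
    · exact h.2.ne
    · exact h.1.ne'
  have := thalerM_pos (inv_pos.2 h0) (by simpa using h1)
  rw [stableDa_eq h0 h1]
  have := cos_half_mul_Gamma_pos hα
  positivity

/-- The characteristic function of the return time. -/
def returnChar (γ s : ℝ) : ℂ :=
  ∑' k : ℕ, (thalerPi γ k : ℂ) * Complex.exp (Complex.I * (s * (k + 1)))

lemma hasSum_returnChar {γ : ℝ} (hγ : 0 < γ) (hγ1 : γ ≠ 1) (s : ℝ) :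
    HasSum (fun k : ℕ => (thalerPi γ k : ℂ) * Complex.exp (Complex.I * (s * (k + 1))))
      (returnChar γ s) := by
  refine (hasSum_integral_thalerQ_const hγ hγ1
    (χ := fun k => Complex.exp (Complex.I * (s * (k + 1)))) fun k => ?_).summable.hasSum
  rw [Complex.norm_exp]
  simp

lemma hasSum_stableLa {α : ℝ} {n : ℕ} (hn : n ≤ 1) (hα0 : 0 < α) (hα : (n : ℝ) < α)
    (hα' : α < n + 1) :
    HasSum (fun k : ℕ => (n : ℝ) * (((k : ℝ) + 1) * thalerPi α⁻¹ k)) (stableLa α) := by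
  interval_cases n
  · have : α < 1 := by simpa using hα'
    simp [stableLa, this, hasSum_zero]
  · have h1 : 1 < α := by simpa using hα
    rw [stableLa, if_neg h1.not_gt]
    simpa using hasSum_mul_thalerPi (inv_pos.2 hα0) (inv_lt_one_of_one_lt₀ h1)

lemma expRem_succ_eq {n : ℕ} (hn : n ≤ 1) (w : ℂ) :
    expRem (n + 1) w = Complex.exp w - 1 - n * w := by
  interval_cases n <;> simp [expRem, Finset.sum_range_succ, sub_sub]

lemma hasSum_returnChar_sub {α : ℝ} {n : ℕ} (hn : n ≤ 1) (hα0 : 0 < α) (hα : (n : ℝ) < α)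
    (hα' : α < n + 1) (hα1 : α ≠ 1) (s : ℝ) :
    HasSum (fun k : ℕ => (thalerPi α⁻¹ k : ℂ) * expRem (n + 1) (Complex.I * ((s * (k + 1) : ℝ) : ℂ)))
      (returnChar α⁻¹ s - 1 - Complex.I * s * stableLa α) := by
  have hγ : 0 < α⁻¹ := inv_pos.2 hα0
  have hγ1 : α⁻¹ ≠ 1 := by simpa using hα1
  have h1 := hasSum_returnChar hγ hγ1 s
  have h2 : HasSum (fun k => (thalerPi α⁻¹ k : ℂ)) 1 := by
    have h := Complex.hasSum_ofReal.2 (hasSum_thalerPi hγ hγ1)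
    rw [Complex.ofReal_one] at h
    exact h
  have h3 := (Complex.hasSum_ofReal.2 (hasSum_stableLa hn hα0 hα hα')).mul_left (Complex.I * s)
  refine ((h1.sub h2).sub h3).congr_fun fun k => ?_
  rw [expRem_succ_eq hn]
  push_cast
  ring

lemma neg_mul_stable_eq {α : ℝ} (hα : α ∈ Ioo (0 : ℝ) 1 ∪ Ioo (1 : ℝ) 2) :
    ((α⁻¹⁻¹ ^ (1 + α⁻¹⁻¹) / thalerM α⁻¹ : ℝ) : ℂ) *
      ((Complex.cos (α * π / 2) - Complex.I * Complex.sin (α * π / 2)) * Real.Gamma (-α)) =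
    -(stableDa α : ℂ) * (1 - Complex.I * (Real.tan (α * π / 2) : ℝ)) := by
  have h0 : 0 < α := by rcases hα with h | h <;> linarith [h.1]
  have h1 : α ≠ 1 := by
    rcases hα with h | h
    · exact h.2.ne
    · exact h.1.ne'
  have hM := thalerM_pos (inv_pos.2 h0) (by simpa using h1)
  have hG := cos_half_mul_Gamma_pos hα
  have hcos : Real.cos (α * π / 2) ≠ 0 := by
    intro h
    rw [stableGa, h, mul_zero] at hG
    exact hG.false
  have e1 : Complex.cos (α * π / 2) = (Real.cos (α * π / 2) : ℝ) := by push_cast; rfl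
  have e2 : Complex.sin (α * π / 2) = (Real.sin (α * π / 2) : ℝ) := by push_cast; rfl
  have hcos' : ((Real.cos (α * π / 2) : ℝ) : ℂ) ≠ 0 := by exact_mod_cast hcos
  have hα' : (α : ℂ) ≠ 0 := by exact_mod_cast h0.ne'
  have hM' : (thalerM α⁻¹ : ℂ) ≠ 0 := by exact_mod_cast hM.ne'
  rw [e1, e2, stableDa_eq h0 h1, stableGa, Gamma_neg_eq h0.ne', inv_inv, rpow_add h0, rpow_one,
    Real.tan_eq_sin_div_cos]
  simp only [Complex.ofReal_mul, Complex.ofReal_div, Complex.ofReal_neg]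
  field_simp

lemma tendsto_returnChar {α : ℝ} (hα : α ∈ Ioo (0 : ℝ) 1 ∪ Ioo (1 : ℝ) 2) :
    Tendsto (fun s : ℝ => ((s ^ (-α) : ℝ) : ℂ) *
        (returnChar α⁻¹ s - 1 - Complex.I * s * stableLa α)) (𝓝[>] 0)
      (𝓝 (-(stableDa α : ℂ) * (1 - Complex.I * (Real.tan (α * π / 2) : ℝ)))) := by
  obtain ⟨n, hn, hnα, hnα'⟩ : ∃ n : ℕ, n ≤ 1 ∧ (n : ℝ) < α ∧ α < n + 1 := by
    rcases hα with h | h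
    · exact ⟨0, by simp, by simpa using h.1, by simpa using h.2⟩
    · exact ⟨1, le_rfl, by simpa using h.1, by push_cast; linarith [h.2]⟩
  have h0 : 0 < α := by rcases hα with h | h <;> linarith [h.1]
  have h1 : α ≠ 1 := by
    rcases hα with h | h
    · exact h.2.ne
    · exact h.1.ne'
  have hp := tendsto_thalerPi (inv_pos.2 h0) (by simpa using h1)
  have h := tendsto_tsum_regularlyVarying (a := n - α) (α := α) (C₀ := 3)
    (f := fun v : ℝ => expRem (n + 1) (Complex.I * v)) (c := α⁻¹⁻¹ ^ (1 + α⁻¹⁻¹) / thalerM α⁻¹)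
    (p := thalerPi α⁻¹)
    (by linarith) (by linarith) (by simpa only [inv_inv] using hp)
    ((continuous_expRem (n + 1)).comp (by fun_prop)) (fun v hv => ?_) (by norm_num)
  · rw [integral_expRem_I hn hnα hnα', neg_mul_stable_eq hα] at h
    refine h.congr fun s => ?_
    rw [(hasSum_returnChar_sub hn h0 hnα hnα' h1 s).tsum_eq]
  · have h := norm_expRem_mul_rpow_le hn (r := -Complex.I) (by simp) le_rfl (by simp) α hv
    rw [norm_mul, Complex.norm_real, norm_of_nonneg (rpow_nonneg hv.le _)] at h
    simpa using h

/-- The real-linear map `x + iy ↦ x + iby`. -/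
def skewIm (b : ℝ) : ℂ →L[ℝ] ℂ :=
  Complex.ofRealCLM.comp Complex.reCLM +
    (b : ℝ) • (Complex.I • (Complex.ofRealCLM.comp Complex.imCLM))

lemma skewIm_apply (b : ℝ) (z : ℂ) : skewIm b z = z.re + Complex.I * b * z.im := by
  simp [skewIm]
  ring

lemma skewIm_real_mul (b r : ℝ) (z : ℂ) : skewIm b (r * z) = r * skewIm b z := by
  simp [skewIm_apply]
  ring

lemma norm_skewIm_le {b : ℝ} (hb : |b| ≤ 1) (z : ℂ) : ‖skewIm b z‖ ≤ ‖z‖ := by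
  rw [skewIm_apply, Complex.norm_def, Complex.norm_def]
  refine Real.sqrt_le_sqrt ?_
  have : b ^ 2 ≤ 1 := (sq_le_one_iff_abs_le_one b).2 hb
  simp [Complex.normSq_apply]
  nlinarith [sq_nonneg z.im, mul_le_mul_of_nonneg_right this (sq_nonneg z.im)]

lemma tendsto_skewIm_returnChar {α : ℝ} (hα : α ∈ Ioo (0 : ℝ) 1 ∪ Ioo (1 : ℝ) 2) (b : ℝ) :
    Tendsto (fun s : ℝ => ((s ^ (-α) : ℝ) : ℂ) *
        (skewIm b (returnChar α⁻¹ s) - 1 - Complex.I * s * b * stableLa α)) (𝓝[>] 0)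
      (𝓝 (-(stableDa α : ℂ) * (1 - Complex.I * b * (Real.tan (α * π / 2) : ℝ)))) := by
  have h := ((skewIm b).continuous.tendsto _).comp (tendsto_returnChar hα)
  have e : skewIm b (-(stableDa α : ℂ) * (1 - Complex.I * (Real.tan (α * π / 2) : ℝ))) =
      -(stableDa α : ℂ) * (1 - Complex.I * b * (Real.tan (α * π / 2) : ℝ)) := by
    rw [← Complex.ofReal_neg, skewIm_real_mul, skewIm_apply]
    simp only [Complex.sub_re, Complex.sub_im, Complex.mul_re, Complex.mul_im, Complex.I_re,
      Complex.I_im, Complex.ofReal_re, Complex.ofReal_im, Complex.one_re, Complex.one_im]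
    push_cast
    ring
  rw [e] at h
  refine h.congr fun s => ?_
  rw [Function.comp_apply, skewIm_real_mul, map_sub, map_sub]
  congr 2
  · simp [skewIm_apply]
  · rw [skewIm_apply]
    simp
    ring

lemma norm_one_add_mul_exp_neg_sub_one_le {w : ℂ} (hw : ‖w‖ ≤ 1) :
    ‖(1 + w) * Complex.exp (-w) - 1‖ ≤ 3 * ‖w‖ ^ 2 := by
  have h1 := Complex.norm_exp_sub_one_sub_id_le (x := -w) (by simpa using hw)
  have e : (1 + w) * Complex.exp (-w) - 1 =
      (1 + w) * (Complex.exp (-w) - 1 - -w) - w ^ 2 := by ring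
  rw [norm_neg] at h1
  rw [e]
  calc _ ≤ ‖1 + w‖ * ‖Complex.exp (-w) - 1 - -w‖ + ‖w‖ ^ 2 := by
        refine (norm_sub_le _ _).trans ?_
        rw [norm_mul, norm_pow]
    _ ≤ (1 + 1) * ‖w‖ ^ 2 + ‖w‖ ^ 2 := by
        gcongr
        refine (norm_add_le _ _).trans ?_
        rw [norm_one]
        linarith
    _ = _ := by ring

lemma tendsto_rpow_neg_mul_sq {α : ℝ} (hα : α < 2) :
    Tendsto (fun s : ℝ => s ^ (-α) * s ^ 2) (𝓝[>] 0) (𝓝 0) := by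
  have h : Tendsto (fun s : ℝ => s ^ (2 - α)) (𝓝[>] 0) (𝓝 0) := by
    have := (continuous_rpow_const (q := 2 - α) (by linarith)).tendsto 0
    rw [zero_rpow (by linarith)] at this
    exact this.mono_left nhdsWithin_le_nhds
  refine h.congr' ?_
  filter_upwards [self_mem_nhdsWithin] with s hs
  rw [← rpow_natCast, ← rpow_add hs]
  congr 1
  push_cast
  ring

lemma tendsto_centered_returnChar {α : ℝ} (hα : α ∈ Ioo (0 : ℝ) 1 ∪ Ioo (1 : ℝ) 2) (b : ℝ) :
    Tendsto (fun s : ℝ => ((s ^ (-α) : ℝ) : ℂ) *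
        (skewIm b (returnChar α⁻¹ s) * Complex.exp (-(Complex.I * s * b * stableLa α)) - 1))
      (𝓝[>] 0)
      (𝓝 (-(stableDa α : ℂ) * (1 - Complex.I * b * (Real.tan (α * π / 2) : ℝ)))) := by
  have hα2 : α < 2 := by rcases hα with h | h <;> linarith [h.2]
  set w : ℝ → ℂ := fun s => Complex.I * s * b * stableLa α with hw
  have hwc : Continuous w := by fun_prop
  have hw0 : w 0 = 0 := by simp [hw]
  have hexp : Tendsto (fun s => Complex.exp (-w s)) (𝓝[>] 0) (𝓝 1) := by
    have : Continuous fun s => Complex.exp (-w s) := by fun_prop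
    have := this.tendsto 0
    rw [hw0, neg_zero, Complex.exp_zero] at this
    exact this.mono_left nhdsWithin_le_nhds
  have hrem : Tendsto (fun s : ℝ => ((s ^ (-α) : ℝ) : ℂ) * ((1 + w s) * Complex.exp (-w s) - 1))
      (𝓝[>] 0) (𝓝 0) := by
    have hb := (tendsto_rpow_neg_mul_sq hα2).const_mul (3 * (|b| * |stableLa α|) ^ 2)
    rw [mul_zero] at hb
    refine squeeze_zero_norm' ?_ hb
    have hsm : ∀ᶠ s in 𝓝[>] (0 : ℝ), ‖w s‖ < 1 := by
      have := hwc.norm.tendsto 0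
      rw [hw0, norm_zero] at this
      exact (this.mono_left nhdsWithin_le_nhds).eventually_lt_const one_pos
    filter_upwards [hsm, self_mem_nhdsWithin] with s hs hs0
    have hn : ‖w s‖ = s * (|b| * |stableLa α|) := by
      simp only [hw, norm_mul, Complex.norm_I, Complex.norm_real, Real.norm_eq_abs, one_mul]
      rw [abs_of_pos hs0, mul_assoc]
    rw [norm_mul, Complex.norm_real, norm_of_nonneg (rpow_nonneg (le_of_lt hs0) _)]
    refine (mul_le_mul_of_nonneg_left (norm_one_add_mul_exp_neg_sub_one_le hs.le)
      (rpow_nonneg (le_of_lt hs0) _)).trans (le_of_eq ?_)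
    rw [hn]
    ring
  have h := ((tendsto_skewIm_returnChar hα b).mul hexp).add hrem
  rw [mul_one, add_zero] at h
  refine h.congr fun s => ?_
  simp only [hw]
  ring

end

section

variable {β : ℝ} {ν : Measure (ℕ → ℝ)}

/-- The sign encoded by a Boolean. -/
def boolSign (x : Bool) : ℝ := if x then 1 else -1

lemma boolSign_eq (x : Bool) : boolSign x = 1 ∨ boolSign x = -1 := by
  cases x <;> simp [boolSign]

lemma ae_sign_eq [IsProbabilityMeasure ν] (hβ : β ∈ Icc (-1 : ℝ) 1)
    (hν : ∀ (s : Finset ℕ) (ε : ℕ → ℝ), (∀ i, ε i = 1 ∨ ε i = -1) →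
      ν {ω | ∀ i ∈ s, ω i = ε i} = ∏ i ∈ s, ENNReal.ofReal ((1 + β * ε i) / 2)) (j : ℕ) :
    ∀ᵐ ω ∂ν, ω j = 1 ∨ ω j = -1 := by
  have h1 := hν {j} (fun _ => 1) (by simp)
  have h2 := hν {j} (fun _ => -1) (by simp)
  simp only [Finset.mem_singleton, forall_eq, Finset.prod_singleton] at h1 h2
  have hm : ∀ a : ℝ, MeasurableSet {ω : ℕ → ℝ | ω j = a} := fun a =>
    measurableSet_eq_fun (measurable_pi_apply j) measurable_const
  have hd : Disjoint {ω : ℕ → ℝ | ω j = 1} {ω : ℕ → ℝ | ω j = -1} := by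
    refine Set.disjoint_left.2 fun ω h h' => ?_
    have h3 : ω j = 1 := h
    have h4 : ω j = -1 := h'
    linarith
  have hu : ν ({ω : ℕ → ℝ | ω j = 1} ∪ {ω : ℕ → ℝ | ω j = -1}) = 1 := by
    rw [measure_union hd (hm _), h1, h2, ← ENNReal.ofReal_add (by linarith [hβ.1])
      (by linarith [hβ.2]), ← ENNReal.ofReal_one]
    congr 1
    ring
  exact mem_ae_iff.2 ((prob_compl_eq_zero_iff ((hm _).union (hm _))).2 hu)

/-- The characteristic function of a weighted sum of independent biased signs. -/
lemma integral_exp_sum_sign [IsProbabilityMeasure ν] (hβ : β ∈ Icc (-1 : ℝ) 1)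
    (hν : ∀ (s : Finset ℕ) (ε : ℕ → ℝ), (∀ i, ε i = 1 ∨ ε i = -1) →
      ν {ω | ∀ i ∈ s, ω i = ε i} = ∏ i ∈ s, ENNReal.ofReal ((1 + β * ε i) / 2))
    (c : ℕ → ℝ) (n : ℕ) :
    ∫ ω, Complex.exp (Complex.I * ((∑ j ∈ Finset.range n, ω j * c j : ℝ) : ℂ)) ∂ν =
      ∏ j ∈ Finset.range n, skewIm β (Complex.exp (Complex.I * c j)) := by
  classical
  set e : Bool → ℝ → ℂ := fun x a => Complex.exp (Complex.I * ((boolSign x * a : ℝ) : ℂ)) with he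
  set A : (Fin n → Bool) → Set (ℕ → ℝ) := fun x => {ω | ∀ i : Fin n, ω i = boolSign (x i)} with hA
  have hAm : ∀ x, MeasurableSet (A x) := fun x => by
    have : A x = ⋂ i : Fin n, {ω : ℕ → ℝ | ω i = boolSign (x i)} := by
      ext ω
      simp [hA]
    rw [this]
    exact MeasurableSet.iInter fun i => measurable_pi_apply (i : ℕ) (measurableSet_singleton _)
  have hAν : ∀ x, ν.real (A x) = ∏ i : Fin n, (1 + β * boolSign (x i)) / 2 := fun x => by
    have h := hν (Finset.range n) (fun i => if h : i < n then boolSign (x ⟨i, h⟩) else 1)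
      fun i => by
        by_cases h : i < n
        · simpa [h] using boolSign_eq _
        · simp [h]
    have hs : {ω : ℕ → ℝ | ∀ i ∈ Finset.range n,
        ω i = if h : i < n then boolSign (x ⟨i, h⟩) else 1} = A x := by
      ext ω
      constructor
      · intro hω i
        simpa using hω i (Finset.mem_range.2 i.2)
      · intro hω i hi
        have hi' := Finset.mem_range.1 hi
        rw [dif_pos hi']
        exact hω ⟨i, hi'⟩
    rw [hs, Finset.prod_range] at h
    rw [measureReal_def, h, ENNReal.toReal_prod]
    refine Finset.prod_congr rfl fun i _ => ?_
    rw [ENNReal.toReal_ofReal, dif_pos i.2]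
    rw [dif_pos i.2]
    rcases boolSign_eq (x i) with h | h <;> simp only [Fin.eta, h] <;> linarith [hβ.1, hβ.2]
  have hae : ∀ᵐ ω ∂ν, Complex.exp (Complex.I * ((∑ j ∈ Finset.range n, ω j * c j : ℝ) : ℂ)) =
      ∑ x : Fin n → Bool, (A x).indicator (fun _ => ∏ i : Fin n, e (x i) (c i)) ω := by
    filter_upwards [ae_all_iff.2 (ae_sign_eq hβ hν)] with ω hω
    set x₀ : Fin n → Bool := fun i => decide (ω i = 1) with hx₀
    have hb : ∀ i : Fin n, boolSign (x₀ i) = ω i := fun i => by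
      rcases hω i with h | h
      · simp [hx₀, boolSign, h]
      · simp [hx₀, boolSign, h]
        norm_num
    rw [Finset.sum_eq_single x₀]
    · have hmem : ω ∈ A x₀ := fun i => (hb i).symm
      rw [indicator_of_mem hmem, Complex.ofReal_sum, Finset.mul_sum,
        Complex.exp_sum, Finset.prod_range]
      simp only [he, hb]
    · intro x _ hx
      refine indicator_of_notMem (fun hxω => hx (funext fun i => ?_)) _
      have h1 := hxω i
      rw [← hb i] at h1
      revert h1
      cases x i <;> cases x₀ i <;> norm_num [boolSign]
    · simp
  rw [integral_congr_ae hae, integral_finsetSum _ fun x _ =>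
    (integrable_const _).indicator (hAm x)]
  calc _ = ∑ x : Fin n → Bool,
        ∏ i : Fin n, (((1 + β * boolSign (x i)) / 2 : ℝ) : ℂ) * e (x i) (c i) := by
        refine Finset.sum_congr rfl fun x _ => ?_
        rw [integral_indicator_const _ (hAm x), hAν, Complex.real_smul, Complex.ofReal_prod,
          Finset.prod_mul_distrib]
    _ = ∏ i : Fin n, ∑ b : Bool, (((1 + β * boolSign b) / 2 : ℝ) : ℂ) * e b (c i) := by
        rw [Finset.prod_univ_sum, Fintype.piFinset_univ]
    _ = _ := by
        rw [Finset.prod_range]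
        refine Finset.prod_congr rfl fun i _ => ?_
        rw [Fintype.sum_bool, skewIm_apply]
        simp only [he, boolSign, if_true, Bool.false_eq_true, if_false, one_mul, neg_mul]
        rw [mul_comm Complex.I, mul_comm Complex.I, Complex.exp_ofReal_mul_I_re,
          Complex.exp_ofReal_mul_I_im, Complex.exp_mul_I, Complex.exp_mul_I]
        push_cast
        rw [Complex.cos_neg, Complex.sin_neg]
        ring

end

section

variable {γ : ℝ}

/-- The conditional characteristic function at `s` of a biased sign times the return time `k`. -/
def signChar (b s : ℝ) (k : ℕ) : ℂ := skewIm b (Complex.exp (Complex.I * ((s * k : ℝ) : ℂ)))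

lemma norm_signChar_le {b : ℝ} (hb : |b| ≤ 1) (s : ℝ) (k : ℕ) : ‖signChar b s k‖ ≤ 1 := by
  refine (norm_skewIm_le hb _).trans ?_
  rw [mul_comm, Complex.norm_exp_ofReal_mul_I]

lemma norm_signChar_sub_one_le {b : ℝ} (hb : |b| ≤ 1) {s : ℝ} (hs : 0 ≤ s) (k : ℕ) :
    ‖signChar b s k - 1‖ ≤ s * k := by
  have h1 : skewIm b 1 = 1 := by simp [skewIm_apply]
  have h : signChar b s k - 1 = skewIm b (Complex.exp (Complex.I * ((s * k : ℝ) : ℂ)) - 1) := by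
    rw [map_sub, h1, signChar]
  rw [h]
  refine (norm_skewIm_le hb _).trans (Real.norm_exp_I_mul_ofReal_sub_one_le.trans ?_)
  rw [norm_of_nonneg (by positivity)]

lemma signChar_mul_sign (b s : ℝ) {σ : ℝ} (hσ : σ = 1 ∨ σ = -1) (k : ℕ) :
    skewIm b (Complex.exp (Complex.I * ((σ * s * k : ℝ) : ℂ))) = signChar (b * σ) s k := by
  rw [signChar, skewIm_apply, skewIm_apply, mul_comm Complex.I ((σ * s * k : ℝ) : ℂ),
    mul_comm Complex.I ((s * k : ℝ) : ℂ), Complex.exp_ofReal_mul_I_re, Complex.exp_ofReal_mul_I_im, Complex.exp_ofReal_mul_I_re,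
    Complex.exp_ofReal_mul_I_im]
  rcases hσ with rfl | rfl
  · simp
  · rw [show -1 * s * (k : ℝ) = -(s * k) by ring, Real.cos_neg, Real.sin_neg]
    push_cast
    ring

lemma integral_thalerQ_signChar (hγ : 0 < γ) (hγ1 : γ ≠ 1) {b : ℝ} (hb : |b| ≤ 1) (s : ℝ) :
    ∫ y, thalerQ γ (fun k => signChar b s (k + 1)) (fun _ => 1) y ∂thalerMuY γ (thalerX γ 1) =
      skewIm b (returnChar γ s) := by
  have h1 := hasSum_integral_thalerQ_const hγ hγ1 (χ := fun k => signChar b s (k + 1))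
    fun k => norm_signChar_le hb s _
  have h2 := (hasSum_returnChar hγ hγ1 s).mapL (skewIm b)
  refine h1.unique (h2.congr_fun fun k => ?_)
  rw [skewIm_real_mul, signChar]
  push_cast
  rfl

lemma integral_exp_signed_sum {β xs : ℝ} {ν : Measure (ℕ → ℝ)} [IsProbabilityMeasure ν]
    [IsProbabilityMeasure (thalerMuY γ xs)] (hβ : β ∈ Icc (-1 : ℝ) 1)
    (hν : ∀ (s : Finset ℕ) (ε : ℕ → ℝ), (∀ i, ε i = 1 ∨ ε i = -1) →
      ν {ω | ∀ i ∈ s, ω i = ε i} = ∏ i ∈ s, ENNReal.ofReal ((1 + β * ε i) / 2))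
    {σ : ℝ} (hσ : σ = 1 ∨ σ = -1) (s m : ℝ) (n : ℕ) :
    ∫ p : ℝ × (ℕ → ℝ), Complex.exp (Complex.I * ((σ * s *
        ((∑ j ∈ Finset.range n, p.2 j * (thalerTau γ xs ((thalerF γ xs)^[j] p.1) : ℝ)) -
          n * β * m) : ℝ) : ℂ)) ∂((thalerMuY γ xs).prod ν) =
      Complex.exp (-(Complex.I * s * (β * σ : ℝ) * m)) ^ n *
        ∫ y, thalerProd γ xs (signChar (β * σ) s) n y ∂thalerMuY γ xs := by
  have hm : Measurable fun p : ℝ × (ℕ → ℝ) => Complex.exp (Complex.I * ((σ * s *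
        ((∑ j ∈ Finset.range n, p.2 j * (thalerTau γ xs ((thalerF γ xs)^[j] p.1) : ℝ)) -
          n * β * m) : ℝ) : ℂ)) := by
    have hτ : ∀ j, Measurable fun p : ℝ × (ℕ → ℝ) =>
        (thalerTau γ xs ((thalerF γ xs)^[j] p.1) : ℝ) := fun j =>
      (measurable_of_countable fun k : ℕ => (k : ℝ)).comp
        ((measurable_thalerTau γ xs).comp (((measurable_thalerF γ xs).iterate j).comp
          measurable_fst))
    have hω : ∀ j, Measurable fun p : ℝ × (ℕ → ℝ) => p.2 j := fun j =>
      (measurable_pi_apply j).comp measurable_snd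
    have hsum := Finset.measurable_sum (Finset.range n) fun j _ => (hω j).mul (hτ j)
    exact Complex.measurable_exp.comp ((Complex.measurable_ofReal.comp
      ((hsum.sub_const _).const_mul _)).const_mul _)
  rw [integral_prod _ (Integrable.of_bound hm.aestronglyMeasurable 1 (ae_of_all _ fun p => by
    rw [mul_comm, Complex.norm_exp_ofReal_mul_I])), ← integral_const_mul]
  refine integral_congr_ae (ae_of_all _ fun y => ?_)
  have h := integral_exp_sum_sign hβ hν
    (fun j => σ * s * (thalerTau γ xs ((thalerF γ xs)^[j] y) : ℝ)) n
  simp only [signChar_mul_sign β s hσ] at h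
  simp only [thalerProd]
  rw [← h, ← integral_const_mul]
  refine integral_congr_ae (ae_of_all _ fun ω => ?_)
  simp only
  rw [← Complex.exp_nat_mul, ← Complex.exp_add]
  congr 1
  have e : ∑ j ∈ Finset.range n, ω j * (σ * s * (thalerTau γ xs ((thalerF γ xs)^[j] y) : ℝ)) =
      σ * s * ∑ j ∈ Finset.range n, ω j * (thalerTau γ xs ((thalerF γ xs)^[j] y) : ℝ) := by
    rw [Finset.mul_sum]
    exact Finset.sum_congr rfl fun j _ => by ring
  rw [e]
  push_cast
  ring

lemma tendsto_thalerD_error {α b : ℝ} (hα : α ∈ Ioo (0 : ℝ) 1 ∪ Ioo (1 : ℝ) 2) (hb : |b| ≤ 1)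
    {s : ℕ → ℝ} (hs0 : ∀ᶠ n in atTop, 0 < s n) (hs : Tendsto s atTop (𝓝 0)) {K : ℝ}
    (hns : ∀ᶠ n : ℕ in atTop, n * s n ^ α = K) :
    Tendsto (fun n : ℕ => thalerD α⁻¹ (fun k => signChar b (s n) (k + 1)) +
      n * thalerD α⁻¹ (fun k => signChar b (s n) (k + 1)) ^ 2) atTop (𝓝 0) := by
  have h0 : 0 < α := by rcases hα with h | h <;> linarith [h.1]
  have h1 : α ≠ 1 := by
    rcases hα with h | h
    · exact h.2.ne
    · exact h.1.ne'
  have hγ1 : α⁻¹ ≠ 1 := by simpa using h1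
  obtain ⟨θ, hθα, hθ1, hθ⟩ : ∃ θ, α < 2 * θ ∧ θ ≤ 1 ∧ θ < α := by
    rcases hα with h | h
    · exact ⟨3 / 4 * α, by linarith, by linarith [h.2], by linarith⟩
    · exact ⟨1, by linarith [h.2], le_rfl, h.1⟩
  have hθ0 : 0 < θ := by linarith
  obtain ⟨C, hC, hD⟩ := exists_thalerD_le (inv_pos.2 h0) hγ1 hθ0 hθ1 (by simpa using hθ)
  have hpow : ∀ q : ℝ, 0 < q → Tendsto (fun n => s n ^ q) atTop (𝓝 0) := fun q hq => by
    have := hs.rpow_const (p := q) (Or.inr hq.le)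
    rwa [zero_rpow hq.ne'] at this
  have hlim : Tendsto (fun n => C * s n ^ θ + C ^ 2 * K * s n ^ (2 * θ - α)) atTop (𝓝 0) := by
    have := ((hpow θ hθ0).const_mul C).add ((hpow (2 * θ - α) (by linarith)).const_mul (C ^ 2 * K))
    simpa using this
  refine squeeze_zero' (Eventually.of_forall fun n => ?_) ?_ hlim
  · have := thalerD_nonneg (inv_pos.2 h0) hγ1 fun k => signChar b (s n) (k + 1)
    positivity
  · filter_upwards [hs0, hns] with n hn hK
    have hDn := hD (s n) hn (fun k => signChar b (s n) (k + 1)) (fun k => norm_signChar_le hb _ _)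
      fun k => by
        have := norm_signChar_sub_one_le hb hn.le (k + 1)
        push_cast at this
        have h3 : 0 ≤ s n * ((k : ℝ) + 1) := by positivity
        linarith
    have hDn0 := thalerD_nonneg (inv_pos.2 h0) hγ1 fun k => signChar b (s n) (k + 1)
    refine add_le_add hDn ?_
    calc _ ≤ (n : ℝ) * (C * s n ^ θ) ^ 2 := by gcongr
      _ = C ^ 2 * (n * s n ^ α) * s n ^ (2 * θ - α) := by
          rw [rpow_sub hn, show 2 * θ = θ + θ by ring, rpow_add hn]
          have := (rpow_pos_of_pos hn α).ne'
          field_simp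
      _ = _ := by rw [hK]

lemma tendsto_signed_thalerProd {α b : ℝ} (hα : α ∈ Ioo (0 : ℝ) 1 ∪ Ioo (1 : ℝ) 2) (hb : |b| ≤ 1)
    {s : ℕ → ℝ} (hs0 : ∀ᶠ n in atTop, 0 < s n) (hs : Tendsto s atTop (𝓝 0)) {K : ℝ}
    (hns : ∀ᶠ n : ℕ in atTop, n * s n ^ α = K) :
    Tendsto (fun n : ℕ => Complex.exp (-(Complex.I * s n * b * stableLa α)) ^ n *
      ∫ y, thalerProd α⁻¹ (thalerX α⁻¹ 1) (signChar b (s n)) n y ∂thalerMuY α⁻¹ (thalerX α⁻¹ 1))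
      atTop (𝓝 (Complex.exp (K * (-(stableDa α : ℂ) *
        (1 - Complex.I * b * (Real.tan (α * π / 2) : ℝ)))))) := by
  have h0 : 0 < α := by rcases hα with h | h <;> linarith [h.1]
  have h1 : α ≠ 1 := by
    rcases hα with h | h
    · exact h.2.ne
    · exact h.1.ne'
  have hγ1 : α⁻¹ ≠ 1 := by simpa using h1
  set E : ℕ → ℂ := fun n => Complex.exp (-(Complex.I * s n * b * stableLa α)) with hE
  have hEn : ∀ n, ‖E n‖ = 1 := fun n => by
    simp [hE, Complex.norm_exp]
  have hsw : Tendsto s atTop (𝓝[>] 0) :=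
    tendsto_nhdsWithin_iff.2 ⟨hs, hs0⟩
  have hg : Tendsto (fun n : ℕ => (n : ℂ) * (skewIm b (returnChar α⁻¹ (s n)) * E n - 1)) atTop
      (𝓝 (K * (-(stableDa α : ℂ) * (1 - Complex.I * b * (Real.tan (α * π / 2) : ℝ))))) := by
    refine (((tendsto_centered_returnChar hα b).comp hsw).const_mul (K : ℂ)).congr' ?_
    filter_upwards [hs0, hns] with n hn hK
    rw [Function.comp_apply, ← mul_assoc, ← Complex.ofReal_mul, ← hK, mul_assoc, ← rpow_add hn,
      add_neg_cancel, rpow_zero, mul_one, Complex.ofReal_natCast]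
  have hpow := Complex.tendsto_one_add_pow_exp_of_tendsto hg
  have herr : Tendsto (fun n : ℕ => E n ^ n *
      (∫ y, thalerProd α⁻¹ (thalerX α⁻¹ 1) (signChar b (s n)) n y
        ∂thalerMuY α⁻¹ (thalerX α⁻¹ 1) - skewIm b (returnChar α⁻¹ (s n)) ^ n)) atTop (𝓝 0) := by
    have h := (tendsto_thalerD_error hα hb hs0 hs hns).const_mul (4 / thalerA α⁻¹ 1)
    rw [mul_zero] at h
    refine squeeze_zero_norm (fun n => ?_) h
    rw [norm_mul, norm_pow, hEn, one_pow, one_mul,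
      ← integral_thalerQ_signChar (inv_pos.2 h0) hγ1 hb]
    exact norm_integral_thalerProd_sub_pow_le (inv_pos.2 h0) hγ1
      (fun k => norm_signChar_le hb (s n) k) n
  have h := hpow.add herr
  rw [add_zero] at h
  refine h.congr fun n => ?_
  rw [add_sub_cancel, mul_pow]
  ring

end

/-- Theorem 2.5, via characteristic functions: Fix `α ∈ (0,1) ∪ (1,2)`,
`β ∈ [−1,1]`, `γ = 1/α`.  Let `ν` be the Bernoulli product measure `ν_β^{⊗ℕ}` on
sign sequences, characterized on cylinder sets by
`ν{ω : ω_i = ε_i for i ∈ s} = ∏_{i ∈ s} (1 + β ε_i)/2` for `ε_i ∈ {−1,1}`.  Then for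
every `t ∈ ℝ` the characteristic function of
`n^(−γ)·d_α^(−γ)·(Σ_{j<n} ω_j τ(F^j y) − n β ℓ_α)` under `μ_Y ⊗ ν` converges to
`exp(−|t|^α (1 − i β sgn(t) tan(απ/2)))`, the characteristic function of `X_{α,1,β}`. -/
theorem thaler_stable_law_two_sided (α : ℝ)
    (hα : α ∈ Set.Ioo (0 : ℝ) 1 ∪ Set.Ioo (1 : ℝ) 2)
    (β : ℝ) (hβ : β ∈ Set.Icc (-1 : ℝ) 1)
    (xs : ℝ) (hxs : xs ∈ Set.Ioo (0 : ℝ) 1)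
    (hxseq : xs ^ (1 - α⁻¹) + (1 + xs) ^ (1 - α⁻¹) = 2)
    (ν : Measure (ℕ → ℝ)) [IsProbabilityMeasure ν]
    (hν : ∀ (s : Finset ℕ) (ε : ℕ → ℝ), (∀ i, ε i = 1 ∨ ε i = -1) →
      ν {ω | ∀ i ∈ s, ω i = ε i} = ∏ i ∈ s, ENNReal.ofReal ((1 + β * ε i) / 2)) :
    ∀ t : ℝ,
      Tendsto
        (fun n : ℕ =>
          ∫ p : ℝ × (ℕ → ℝ), Complex.exp (Complex.I * (t : ℂ) *
            (((n : ℝ) ^ (-α⁻¹) * stableDa α ^ (-α⁻¹) *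
              ((∑ j ∈ Finset.range n,
                  p.2 j * (thalerTau α⁻¹ xs ((thalerF α⁻¹ xs)^[j] p.1) : ℝ))
                - n * β * stableLa α) : ℝ) : ℂ))
            ∂((thalerMuY α⁻¹ xs).prod ν))
        atTop
        (nhds (Complex.exp (-((|t| ^ α : ℝ) : ℂ) *
          (1 - Complex.I * (β : ℂ) * ((Real.sign t : ℝ) : ℂ) *
            ((Real.tan (α * π / 2) : ℝ) : ℂ))))) := by
  intro t
  have h0 : 0 < α := by rcases hα with h | h <;> linarith [h.1]
  have h1 : α ≠ 1 := by
    rcases hα with h | h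
    · exact h.2.ne
    · exact h.1.ne'
  have hγ1 : α⁻¹ ≠ 1 := by simpa using h1
  have hxs' : xs = thalerX α⁻¹ 1 := by rw [thalerX_one_eq, thalerInv_one hγ1 hxs hxseq]
  have := isProbabilityMeasure_thalerMuY (inv_pos.2 h0) hγ1
  have hd := stableDa_pos hα
  subst hxs'
  rcases eq_or_ne t 0 with rfl | ht
  · simp [zero_rpow h0.ne']
  have hσ : Real.sign t = 1 ∨ Real.sign t = -1 := (Real.sign_apply_eq_of_ne_zero t ht).symm
  have hσt : Real.sign t * |t| = t := by
    rcases ht.lt_or_gt with h | h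
    · rw [Real.sign_of_neg h, abs_of_neg h]; ring
    · rw [Real.sign_of_pos h, abs_of_pos h]; ring
  have hb : |β * Real.sign t| ≤ 1 := by
    rw [abs_mul]
    rcases hσ with h | h <;> rw [h] <;> simpa using abs_le.2 hβ
  set s : ℕ → ℝ := fun n => |t| * ((n : ℝ) ^ (-α⁻¹) * stableDa α ^ (-α⁻¹)) with hsdef
  have hs0 : ∀ᶠ n in atTop, 0 < s n := by
    filter_upwards [eventually_gt_atTop 0] with n hn
    have : (0 : ℝ) < n := by exact_mod_cast hn
    positivity
  have hs : Tendsto s atTop (𝓝 0) := by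
    have h := (tendsto_rpow_neg_atTop (inv_pos.2 h0)).comp (tendsto_natCast_atTop_atTop (R := ℝ))
    simpa using (h.mul_const (stableDa α ^ (-α⁻¹))).const_mul |t|
  have hns : ∀ᶠ n : ℕ in atTop, n * s n ^ α = |t| ^ α / stableDa α := by
    filter_upwards [eventually_gt_atTop 0] with n hn
    have hn' : (0 : ℝ) < n := by exact_mod_cast hn
    have e : -α⁻¹ * α = -1 := by field_simp
    rw [hsdef, mul_rpow (abs_nonneg t) (by positivity), mul_rpow (by positivity) (by positivity),
      ← rpow_mul hn'.le, ← rpow_mul hd.le, e, rpow_neg_one, rpow_neg_one]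
    field_simp
  have h := tendsto_signed_thalerProd hα hb hs0 hs hns
  have hd' : (stableDa α : ℂ) ≠ 0 := by exact_mod_cast hd.ne'
  have e : ((|t| ^ α / stableDa α : ℝ) : ℂ) * (-(stableDa α : ℂ) *
      (1 - Complex.I * (β * Real.sign t : ℝ) * (Real.tan (α * π / 2) : ℝ))) =
      -((|t| ^ α : ℝ) : ℂ) * (1 - Complex.I * (β : ℂ) * ((Real.sign t : ℝ) : ℂ) *
        ((Real.tan (α * π / 2) : ℝ) : ℂ)) := by
    rw [Complex.ofReal_div, Complex.ofReal_mul β]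
    field_simp
  rw [e] at h
  refine h.congr fun n => ?_
  rw [← integral_exp_signed_sum hβ hν hσ]
  refine integral_congr_ae (ae_of_all _ fun p => ?_)
  simp only [hsdef]
  rw [mul_assoc Complex.I, ← Complex.ofReal_mul]
  congr 3
  conv_rhs => rw [← hσt]
  ring
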